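/- arXiv:1601.06264 — 2 statements merged into one kernel-verified Lean document; each statement's English description precedes it below -/
import Mathlib

section
/- Let P, Q ∈ ℂ[X₁,…,Xₙ] and suppose V := Z_P. Then the following are equivalent: (i) every positive definite linear functional Λ on ℂ[X₁,…,Xₙ] vanishing on the ideal (P) generated by P is a moment functional (i.e., V is of type A); (ii) every positive definite linear functional Λ on ℂ[X₁,…,Xₙ] such that N(Λ) = I_ℂ(V) is a moment functional (i.e., V is of type C). -/
open MeasureTheory
open scoped ComplexOrder

noncomputable def evalC {n : ℕ} (P : MvPolynomial (Fin n) ℂ) (x : Fin n → ℝ) : ℂ :=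
  MvPolynomial.aeval (fun i => (x i : ℂ)) P

noncomputable def starC {n : ℕ} (P : MvPolynomial (Fin n) ℂ) : MvPolynomial (Fin n) ℂ :=
  MvPolynomial.map (starRingEnd ℂ) P

def IsPosDefC {n : ℕ} (Λ : MvPolynomial (Fin n) ℂ →ₗ[ℂ] ℂ) : Prop :=
  ∀ P : MvPolynomial (Fin n) ℂ, 0 ≤ Λ (starC P * P)

def IsMomentC {n : ℕ} (Λ : MvPolynomial (Fin n) ℂ →ₗ[ℂ] ℂ) : Prop :=
  ∃ μ : Measure (Fin n → ℝ),
    (∀ Q : MvPolynomial (Fin n) ℂ, Integrable (fun x => evalC Q x) μ) ∧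
    (∀ Q : MvPolynomial (Fin n) ℂ, Λ Q = ∫ x, evalC Q x ∂μ)

noncomputable def vanishingIdealC {n : ℕ} (Z : Set (Fin n → ℝ)) :
    Ideal (MvPolynomial (Fin n) ℂ) where
  carrier := {P | ∀ x ∈ Z, evalC P x = 0}
  add_mem' := by
    intro a b ha hb x hx
    simp only [Set.mem_setOf_eq, evalC, map_add] at *
    rw [ha x hx, hb x hx, add_zero]
  zero_mem' := by
    intro x hx
    simp [evalC]
  smul_mem' := by
    intro c a ha x hx
    simp only [Set.mem_setOf_eq, evalC, smul_eq_mul, map_mul] at *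
    rw [ha x hx, mul_zero]

def zeroSetC {n : ℕ} (I : Ideal (MvPolynomial (Fin n) ℂ)) : Set (Fin n → ℝ) :=
  {x | ∀ P ∈ I, evalC P x = 0}

def zSetC {n : ℕ} (P : MvPolynomial (Fin n) ℂ) : Set (Fin n → ℝ) :=
  {x | evalC P x = 0}

def VanishesOnC {n : ℕ} (Λ : MvPolynomial (Fin n) ℂ →ₗ[ℂ] ℂ)
    (I : Ideal (MvPolynomial (Fin n) ℂ)) : Prop :=
  ∀ P ∈ I, Λ P = 0

def nSetC {n : ℕ} (Λ : MvPolynomial (Fin n) ℂ →ₗ[ℂ] ℂ) : Set (MvPolynomial (Fin n) ℂ) :=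
  {P | Λ (starC P * P) = 0}

def IsTypeAC {n : ℕ} (P : MvPolynomial (Fin n) ℂ) : Prop :=
  ∀ Λ : MvPolynomial (Fin n) ℂ →ₗ[ℂ] ℂ,
    IsPosDefC Λ → VanishesOnC Λ (Ideal.span {P}) → IsMomentC Λ

section RealAlgebra

open Polynomial

theorem IsSumSq.exists_of_surjective {A B : Type*} [Semiring A] [Semiring B] {f : A →+* B}
    (hf : Function.Surjective f) {s : B} (hs : IsSumSq s) : ∃ t : A, IsSumSq t ∧ f t = s := by
  induction hs with
  | zero => exact ⟨0, .zero, map_zero f⟩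
  | sq_add a _ ih =>
    obtain ⟨t, ht, rfl⟩ := ih
    obtain ⟨b, rfl⟩ := hf a
    exact ⟨b * b + t, .sq_add b ht, by simp⟩

theorem IsSumSq.ringHom_map {A B : Type*} [Semiring A] [Semiring B] (f : A →+* B) {s : A}
    (hs : IsSumSq s) : IsSumSq (f s) := by
  induction hs with
  | zero => simp
  | sq_add a _ ih => simpa using ih.sq_add (f a)

theorem IntermediateField.exists_maximal_isSemireal (K Ω : Type*) [Field K] [Field Ω] [Algebra K Ω]
    [Algebra.IsAlgebraic K Ω] [IsSemireal K] :
    ∃ E : IntermediateField K Ω, IsSemireal E ∧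
      ∀ θ : Ω, θ ∉ E → ∃ s : E[X], IsSumSq s ∧ aeval θ (1 + s) = 0 := by
  have hbot : IsSemireal (⊥ : IntermediateField K Ω) := by
    refine ⟨fun {s} hs h => ?_⟩
    have hs' := hs.ringHom_map (IntermediateField.botEquiv K Ω : _ →+* K)
    refine IsSemireal.one_add_ne_zero hs' ?_
    simpa using congrArg (IntermediateField.botEquiv K Ω) h
  obtain ⟨E, -, hE, hmax⟩ := zorn_le_nonempty₀ {E : IntermediateField K Ω | IsSemireal E}
    (fun c hc hchain F hF => by
      have : Nonempty c := ⟨⟨F, hF⟩⟩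
      refine ⟨sSup c, ?_, fun _ => le_sSup⟩
      have hmem : ∀ x, x ∈ sSup c ↔ ∃ i ∈ c, x ∈ i := by
        intro x
        rw [sSup_eq_iSup', ← SetLike.mem_coe,
          IntermediateField.coe_iSup_of_directed hchain.directed]
        simp
      have key : ∀ s : (sSup c : IntermediateField K Ω), IsSumSq s →
          ∃ i ∈ c, ∃ t : i, IsSumSq t ∧ (t : Ω) = s := by
        intro s hs
        induction hs with
        | zero => exact ⟨F, hF, 0, .zero, rfl⟩
        | sq_add a _ ih =>
          obtain ⟨i, hi, t, ht, hts⟩ := ih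
          obtain ⟨j, hj, haj⟩ := (hmem _).1 a.2
          rcases hchain.total hi hj with hij | hij
          · refine ⟨j, hj, ⟨a, haj⟩ * ⟨a, haj⟩ + IntermediateField.inclusion hij t,
              .sq_add _ (ht.ringHom_map (IntermediateField.inclusion hij : i →+* j)), ?_⟩
            simp [hts]
          · refine ⟨i, hi, ⟨a, hij haj⟩ * ⟨a, hij haj⟩ + t, .sq_add _ ht, ?_⟩
            simp [hts]
      refine ⟨fun {s} hs h => ?_⟩
      obtain ⟨i, hi, t, ht, hts⟩ := key s hs
      have : IsSemireal i := hc hi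
      refine IsSemireal.one_add_ne_zero ht (Subtype.ext ?_)
      simpa [hts] using congrArg Subtype.val h) ⊥ hbot
  refine ⟨E, hE, fun θ hθ => ?_⟩
  have halg : IsAlgebraic E θ := (Algebra.IsAlgebraic.isAlgebraic (R := K) θ).tower_top E
  set E' := (IntermediateField.adjoin E {θ}).restrictScalars K with hE'
  have hle : E ≤ E' := fun x hx =>
    (IntermediateField.adjoin E {θ}).algebraMap_mem ⟨x, hx⟩
  have hθ' : θ ∈ E' := IntermediateField.mem_adjoin_simple_self E θ
  have hns : ¬ IsSemireal (IntermediateField.adjoin E {θ}) := fun h =>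
    hθ (hmax (y := E') h hle hθ')
  rw [isSemireal_iff] at hns
  push Not at hns
  obtain ⟨s, hs, h1⟩ := hns
  have hsurj : Function.Surjective
      (aeval (IntermediateField.AdjoinSimple.gen E θ) : E[X] →ₐ[E] _).toRingHom := by
    intro x
    have hx : (x : Ω) ∈ Algebra.adjoin E {θ} := by
      rw [← IntermediateField.adjoin_simple_toSubalgebra_of_isAlgebraic halg]; exact x.2
    rw [Algebra.adjoin_singleton_eq_range_aeval] at hx
    obtain ⟨p, hp⟩ := hx
    refine ⟨p, Subtype.ext ?_⟩
    simpa [IntermediateField.AdjoinSimple.coe_aeval_gen_apply] using! hp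
  obtain ⟨t, ht, hts⟩ := hs.exists_of_surjective hsurj
  refine ⟨t, ht, ?_⟩
  have := IntermediateField.AdjoinSimple.coe_aeval_gen_apply (F := E) θ (1 + t)
  rw [← this]
  have h2 : aeval (IntermediateField.AdjoinSimple.gen E θ) t = s := hts
  rw [map_add, map_one, h2, h1]; rfl

theorem IsSumSq.exists_modEq_natDegree_le {F : Type*} [Field F] {f : F[X]} (hf : f.natDegree ≠ 0)
    {s : F[X]} (hs : IsSumSq s) :
    ∃ t : F[X], IsSumSq t ∧ f ∣ s - t ∧ t.natDegree ≤ 2 * (f.natDegree - 1) := by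
  induction hs with
  | zero => exact ⟨0, .zero, by simp, by simp⟩
  | @sq_add a r _ ih =>
    obtain ⟨t, ht, hdvd, hdeg⟩ := ih
    refine ⟨(a % f) * (a % f) + t, .sq_add _ ht, ?_, ?_⟩
    · have h1 : f ∣ a - a % f := by
        rw [EuclideanDomain.mod_eq_sub_mul_div]; simp
      have h2 : a * a + r - ((a % f) * (a % f) + t) = (a - a % f) * (a + a % f) + (r - t) := by ring
      rw [h2]
      exact dvd_add (h1.mul_right _) hdvd
    · have := natDegree_mod_lt a hf
      refine (natDegree_add_le _ _).trans (max_le ?_ hdeg)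
      refine natDegree_mul_le.trans ?_
      omega

theorem IsSumSq.exists_aeval_sqrt_eq {F L : Type*} [Field F] [Field L] [Algebra F L] {a : F} {θ : L}
    (hθ : θ ^ 2 = algebraMap F L a) {s : F[X]} (hs : IsSumSq s) :
    ∃ b c d : F, IsSumSq b ∧ IsSumSq c ∧
      aeval θ s = algebraMap F L (b + a * c) + algebraMap F L d * θ := by
  induction hs with
  | zero => exact ⟨0, 0, 0, .zero, .zero, by simp⟩
  | sq_add p _ ih =>
    obtain ⟨b, c, d, hb, hc, h⟩ := ih
    obtain ⟨u, v, huv⟩ : ∃ u v : F, aeval θ p = algebraMap F L u + algebraMap F L v * θ := by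
      set q : F[X] := X ^ 2 - C a
      have hq : aeval θ q = 0 := by simp [q, hθ]
      have hmon : q.Monic := monic_X_pow_sub_C a two_ne_zero
      have hlt : (p %ₘ q).degree < 2 := by
        have := degree_modByMonic_lt p hmon
        rwa [show q.degree = 2 from degree_X_pow_sub_C two_pos a] at this
      refine ⟨(p %ₘ q).coeff 0, (p %ₘ q).coeff 1, ?_⟩
      have h1 := congrArg (aeval θ) (modByMonic_add_div p q)
      rw [map_add, map_mul, hq, zero_mul, add_zero] at h1
      rw [← h1]
      have h2 : (p %ₘ q).degree ≤ 1 := degree_le_of_natDegree_le (n := 1) (by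
      by_cases h0 : p %ₘ q = 0
      · simp [h0]
      · have := (natDegree_lt_iff_degree_lt (n := 2) h0).2 (by exact_mod_cast hlt)
        omega)
      conv_lhs => rw [eq_X_add_C_of_degree_le_one h2]
      simp; ring
    refine ⟨u * u + b, v * v + c, 2 * u * v + d, hb.sq_add u, hc.sq_add v, ?_⟩
    rw [map_add, map_mul, h, huv]
    simp only [map_add, map_mul, map_ofNat]
    linear_combination (algebraMap F L v) ^ 2 * hθ

theorem exists_linearOrder_of_isSquare_or {E : Type*} [Field E] [IsSemireal E]
    (h : ∀ a : E, IsSquare a ∨ IsSumSq (-a)) :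
    ∃ _ : LinearOrder E, IsStrictOrderedRing E := by
  let C : RingCone E :=
    { Subsemiring.sumSq E with
      eq_zero_of_mem_of_neg_mem' := by
        intro a ha hna
        by_contra h0
        have h1 : IsSumSq (-1 : E) := by
          have ha' : IsSumSq a := by simpa using! ha
          have hna' : IsSumSq (-a) := by simpa using! hna
          have := (ha'.mul hna').mul (IsSumSq.mul_self a⁻¹)
          convert this using 1
          field_simp
        exact IsSemireal.not_isSumSq_neg_one E h1 }
  have hC : ∀ a, a ∈ C ↔ IsSumSq a := fun a => by
    rw [← Subsemiring.mem_sumSq]; rfl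
  have : HasMemOrNegMem C := ⟨fun a => by
    rw [hC, hC]; exact (h a).imp_left IsSquare.isSumSq⟩
  classical
  let o : LinearOrder E := LinearOrder.mkOfAddGroupCone C
  have : IsOrderedRing E := IsOrderedRing.mkOfCone C
  exact ⟨o, IsOrderedRing.toIsStrictOrderedRing E⟩

/-- Polynomial functions on `R` satisfy the intermediate value property. -/
def PolyIVT (R : Type*) [Field R] [LinearOrder R] : Prop :=
  ∀ (f : R[X]) (a b : R), a < b → f.eval a * f.eval b < 0 → ∃ c, a < c ∧ c < b ∧ f.eval c = 0

theorem polyIVT_of_dvd_one_add {E : Type*} [Field E] [LinearOrder E] [IsStrictOrderedRing E]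
    (h : ∀ f : E[X], Irreducible f → f.natDegree ≠ 1 → ∃ s, IsSumSq s ∧ f ∣ 1 + s) :
    PolyIVT E := by
  intro f a b hab
  induction hn : f.natDegree using Nat.strong_induction_on generalizing f with
  | _ n ih =>
  intro hf
  have hf0 : f ≠ 0 := by rintro rfl; simp at hf
  have hfu : ¬ IsUnit f := by
    intro hu
    obtain ⟨c, -, rfl⟩ := isUnit_iff.1 hu
    simp only [eval_C] at hf
    nlinarith [mul_self_nonneg c]
  by_cases hirr : Irreducible f
  · by_cases h1 : f.natDegree = 1
    · obtain ⟨u, hu, v, rfl⟩ := natDegree_eq_one.1 h1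
      simp only [eval_add, eval_mul, eval_C, eval_X] at hf
      have key : ∀ x, u * x + v = u * (x - -v / u) := fun x => by field_simp; ring
      rw [key, key] at hf
      have hu2 : 0 < u * u := mul_self_pos.2 hu
      have hlt : (a - -v / u) * (b - -v / u) < 0 := by
        by_contra hge
        push Not at hge
        have := mul_nonneg hu2.le hge
        nlinarith
      rcases mul_neg_iff.1 hlt with ⟨h1, h2⟩ | ⟨h1, h2⟩
      · linarith
      · exact ⟨-v / u, by linarith, by linarith, by simp; field_simp; ring⟩
    · obtain ⟨s, hs, hdvd⟩ := h f hirr h1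
      have hpos : f.natDegree ≠ 0 := (hirr.natDegree_pos).ne'
      obtain ⟨t, ht, hst, hdeg⟩ := hs.exists_modEq_natDegree_le hpos
      have hdvd' : f ∣ 1 + t := by
        have := dvd_sub hdvd hst
        rwa [show 1 + s - (s - t) = 1 + t by ring] at this
      obtain ⟨g, hg⟩ := hdvd'
      have hev : ∀ x, 0 < f.eval x * g.eval x := fun x => by
        rw [← eval_mul, ← hg, eval_add, eval_one]
        have : IsSumSq (t.eval x) := ht.ringHom_map (evalRingHom x)
        linarith [this.nonneg]
      have hg0 : g ≠ 0 := by
        rintro rfl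
        simpa using hev a
      have hgdeg : g.natDegree < n := by
        have h2 : (1 + t).natDegree ≤ 2 * (f.natDegree - 1) :=
          (natDegree_add_le _ _).trans (max_le (by simp) hdeg)
        rw [hg, natDegree_mul hf0 hg0] at h2
        omega
      obtain ⟨c, -, -, hc⟩ := ih _ hgdeg g rfl (by
        have := mul_pos (hev a) (hev b)
        by_contra hge
        push Not at hge
        nlinarith [mul_nonneg hge (neg_nonneg.2 hf.le)])
      exact absurd (hev c) (by simp [hc])
  · rw [irreducible_iff] at hirr
    push Not at hirr
    obtain ⟨g, k, rfl, hg, hk⟩ := hirr hfu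
    have hg0 : g ≠ 0 := left_ne_zero_of_mul hf0
    have hk0 : k ≠ 0 := right_ne_zero_of_mul hf0
    have hgd : 0 < g.natDegree := by
      rw [Nat.pos_iff_ne_zero, Ne, natDegree_eq_zero]
      rintro ⟨c, rfl⟩
      exact hg (isUnit_C.2 (by rw [isUnit_iff_ne_zero]; rintro rfl; simp at hg0))
    have hkd : 0 < k.natDegree := by
      rw [Nat.pos_iff_ne_zero, Ne, natDegree_eq_zero]
      rintro ⟨c, rfl⟩
      exact hk (isUnit_C.2 (by rw [isUnit_iff_ne_zero]; rintro rfl; simp at hk0))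
    rw [natDegree_mul hg0 hk0] at hn
    have hmul : (g.eval a * g.eval b) * (k.eval a * k.eval b) < 0 := by
      simp only [eval_mul] at hf; linarith
    rcases mul_neg_iff.1 hmul with ⟨-, h2⟩ | ⟨h1, -⟩
    · obtain ⟨c, h1, h2, h3⟩ := ih k.natDegree (by omega) k rfl h2
      exact ⟨c, h1, h2, by simp [h3]⟩
    · obtain ⟨c, h1, h2, h3⟩ := ih g.natDegree (by omega) g rfl h1
      exact ⟨c, h1, h2, by simp [h3]⟩

theorem IsSemireal.exists_ringHom_polyIVT (K : Type) [Field K] [IsSemireal K] :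
    ∃ (R : Type) (_ : Field R) (_ : LinearOrder R) (_ : IsStrictOrderedRing R),
      Nonempty (K →+* R) ∧ PolyIVT R := by
  obtain ⟨E, hE, hmax⟩ := IntermediateField.exists_maximal_isSemireal K (AlgebraicClosure K)
  have hsq : ∀ a : E, IsSquare a ∨ IsSumSq (-a) := by
    intro a
    obtain ⟨θ, hθ⟩ := IsAlgClosed.exists_pow_nat_eq (algebraMap E (AlgebraicClosure K) a) two_pos
    by_cases hmem : θ ∈ E
    · left
      refine ⟨⟨θ, hmem⟩, Subtype.ext ?_⟩
      rw [← pow_two]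
      exact hθ.symm
    · right
      obtain ⟨s, hs, h1⟩ := hmax θ hmem
      obtain ⟨b, c, d, hb, hc, h2⟩ := hs.exists_aeval_sqrt_eq hθ
      rw [map_add, map_one, h2] at h1
      have hd : d = 0 := by
        by_contra hd
        apply hmem
        have : θ = algebraMap E (AlgebraicClosure K) (-(1 + (b + a * c)) / d) := by
          have hd' : algebraMap E (AlgebraicClosure K) d ≠ 0 := by simpa using hd
          rw [map_div₀, eq_div_iff hd']
          simp only [map_neg, map_add, map_one] at h1 ⊢
          linear_combination h1
        rw [this]
        exact (-(1 + (b + a * c)) / d).2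
      have h3 : 1 + (b + a * c) = 0 := by
        apply (algebraMap E (AlgebraicClosure K)).injective
        rw [hd] at h1
        simpa using h1
      have hc0 : c ≠ 0 := by
        rintro rfl
        exact IsSemireal.one_add_ne_zero hb (by simpa using h3)
      have : -a = (1 + b) * c * (c⁻¹ * c⁻¹) := by
        field_simp
        linear_combination -h3
      rw [this]
      exact ((IsSumSq.one.add hb).mul hc).mul (IsSumSq.mul_self _)
  obtain ⟨o, ho⟩ := exists_linearOrder_of_isSquare_or hsq
  refine ⟨E, inferInstance, o, ho, ⟨algebraMap K E⟩, polyIVT_of_dvd_one_add fun f hf h1 => ?_⟩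
  obtain ⟨θ, hθ⟩ := IsAlgClosed.exists_aeval_eq_zero (AlgebraicClosure K) f
    (by simpa using! (degree_pos_of_irreducible hf).ne')
  have hmem : θ ∉ E := by
    intro hmem
    have hroot : f.IsRoot (⟨θ, hmem⟩ : E) := by
      apply (algebraMap E (AlgebraicClosure K)).injective
      rw [map_zero, ← hθ, ← aeval_algebraMap_apply_eq_algebraMap_eval]
      rfl
    exact h1 (natDegree_eq_of_degree_eq_some (degree_eq_one_of_irreducible_of_root hf hroot))
  obtain ⟨s, hs, h2⟩ := hmax θ hmem
  refine ⟨s, hs, ?_⟩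
  have h3 := minpoly.eq_of_irreducible hf hθ
  exact (Dvd.intro _ h3).trans (minpoly.dvd E θ h2)

section IntermediateValue

variable {R : Type*} [Field R] [LinearOrder R] [IsStrictOrderedRing R]

theorem PolyIVT.sign_eval_eq (hR : PolyIVT R) {f : R[X]} {a b : R}
    (h : ∀ x ∈ Set.uIcc a b, f.eval x ≠ 0) :
    SignType.sign (f.eval a) = SignType.sign (f.eval b) := by
  wlog hab : a ≤ b generalizing a b
  · exact (this (by rwa [Set.uIcc_comm]) (le_of_not_ge hab)).symm
  rw [Set.uIcc_of_le hab] at h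
  rcases hab.eq_or_lt with rfl | hlt
  · rfl
  have ha := h a ⟨le_rfl, hab⟩
  have hb := h b ⟨hab, le_rfl⟩
  have hnn : ¬ f.eval a * f.eval b < 0 := fun hneg => by
    obtain ⟨c, h1, h2, h3⟩ := hR f a b hlt hneg
    exact h c ⟨h1.le, h2.le⟩ h3
  rcases ha.lt_or_gt with ha | ha <;> rcases hb.lt_or_gt with hb | hb
  · rw [sign_neg ha, sign_neg hb]
  · exact absurd (mul_neg_of_neg_of_pos ha hb) hnn
  · exact absurd (mul_neg_of_pos_of_neg ha hb) hnn
  · rw [sign_pos ha, sign_pos hb]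

theorem PolyIVT.exists_derivative_eval_eq_zero (hR : PolyIVT R) {f : R[X]} {a b : R} (hab : a < b)
    (ha : f.eval a = 0) (hb : f.eval b = 0) : ∃ c, a < c ∧ c < b ∧ f.derivative.eval c = 0 := by
  by_cases hf : f = 0
  · obtain ⟨c, h1, h2⟩ := exists_between hab
    exact ⟨c, h1, h2, by simp [hf]⟩
  obtain ⟨b', hb', hmin⟩ : ∃ b' ∈ f.roots.toFinset.filter (fun x => a < x ∧ x ≤ b),
      ∀ x ∈ f.roots.toFinset.filter (fun x => a < x ∧ x ≤ b), b' ≤ x :=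
    Finset.exists_min_image _ id ⟨b, by simp [hf, hb, hab]⟩
  simp only [Finset.mem_filter, Multiset.mem_toFinset, mem_roots hf, IsRoot.def] at hb' hmin
  obtain ⟨hb'0, hab', hb'b⟩ := hb'
  obtain ⟨g₁, hg₁, hg₁'⟩ := exists_eq_pow_rootMultiplicity_mul_and_not_dvd f hf a
  have hm : 0 < f.rootMultiplicity a := (rootMultiplicity_pos hf).2 ha
  set m := f.rootMultiplicity a
  have hg0 : g₁ ≠ 0 := by rintro rfl; simp at hg₁'
  have hg₁b : g₁.eval b' = 0 := by
    have := hb'0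
    rw [hg₁, eval_mul] at this
    refine (mul_eq_zero.1 this).resolve_left ?_
    simp only [eval_pow, eval_sub, eval_X, eval_C]
    exact pow_ne_zero _ (sub_ne_zero.2 hab'.ne')
  obtain ⟨g, hg, hg'⟩ := exists_eq_pow_rootMultiplicity_mul_and_not_dvd g₁ hg0 b'
  have hn : 0 < g₁.rootMultiplicity b' := (rootMultiplicity_pos hg0).2 hg₁b
  set n := g₁.rootMultiplicity b'
  rw [dvd_iff_isRoot, IsRoot.def] at hg' hg₁'
  have hga : g.eval a ≠ 0 := fun h => hg₁' (by rw [hg, eval_mul, h, mul_zero])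
  have hsign : SignType.sign (g.eval a) = SignType.sign (g.eval b') := by
    refine hR.sign_eval_eq fun x hx h => ?_
    rw [Set.uIcc_of_le hab'.le] at hx
    rcases hx.1.eq_or_lt with rfl | hax
    · exact hga h
    rcases hx.2.eq_or_lt with rfl | hxb
    · exact hg' h
    exact (hmin x ⟨by rw [hg₁, hg]; simp [h], hax, hx.2.trans hb'b⟩).not_gt hxb
  have hpos : 0 < g.eval a * g.eval b' := by
    rcases hga.lt_or_gt with h | h
    · rw [sign_neg h] at hsign
      exact mul_pos_of_neg_of_neg h (sign_eq_neg_one_iff.1 hsign.symm)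
    · rw [sign_pos h] at hsign
      exact mul_pos h (sign_eq_one_iff.1 hsign.symm)
  obtain ⟨m, hm'⟩ : ∃ k, m = k + 1 := ⟨m - 1, by omega⟩
  obtain ⟨n, hn'⟩ : ∃ k, n = k + 1 := ⟨n - 1, by omega⟩
  set q : R[X] := C ((m : R) + 1) * (X - C b') * g + C ((n : R) + 1) * (X - C a) * g +
    (X - C a) * (X - C b') * derivative g with hq
  have hfq : f.derivative = (X - C a) ^ m * (X - C b') ^ n * q := by
    rw [hg₁, hg, hm', hn']
    simp only [derivative_mul, derivative_X_sub_C_pow, hq, Nat.add_sub_cancel, Nat.cast_add,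
      Nat.cast_one, map_add, map_one, map_natCast]
    ring
  have hqs : q.eval a * q.eval b' < 0 := by
    have h1 : q.eval a * q.eval b' =
        -(((m : R) + 1) * ((n : R) + 1) * (b' - a) ^ 2 * (g.eval a * g.eval b')) := by
      simp [hq]; ring
    rw [h1]
    have : 0 < b' - a := sub_pos.2 hab'
    exact neg_neg_of_pos (by positivity)
  obtain ⟨c, h1, h2, h3⟩ := hR q a b' hab' hqs
  exact ⟨c, h1, h2.trans_le hb'b, by rw [hfq, eval_mul, h3, mul_zero]⟩

theorem PolyIVT.eq_of_derivative_ne_zero (hR : PolyIVT R) {f : R[X]} {u v : R}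
    (hf : ∀ x, u < x → x < v → f.derivative.eval x ≠ 0) {x y : R} (hx : x ∈ Set.Icc u v)
    (hy : y ∈ Set.Icc u v) (hfx : f.eval x = 0) (hfy : f.eval y = 0) : x = y := by
  by_contra hne
  rcases lt_or_gt_of_ne hne with h | h
  · obtain ⟨c, h1, h2, h3⟩ := hR.exists_derivative_eval_eq_zero h hfx hfy
    exact hf c (hx.1.trans_lt h1) (h2.trans_le hy.2) h3
  · obtain ⟨c, h1, h2, h3⟩ := hR.exists_derivative_eval_eq_zero h hfy hfx
    exact hf c (hy.1.trans_lt h1) (h2.trans_le hx.2) h3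

theorem PolyIVT.eval_mul_eval_neg (hR : PolyIVT R) {f : R[X]} {u y v : R}
    (hf : ∀ x, u < x → x < v → f.derivative.eval x ≠ 0) (huy : u < y) (hyv : y < v)
    (hy : f.eval y = 0) : f.eval u * f.eval v < 0 := by
  obtain ⟨g, rfl⟩ := dvd_iff_isRoot.2 hy
  have hg : ∀ x ∈ Set.uIcc u v, g.eval x ≠ 0 := by
    intro x hx h
    rw [Set.uIcc_of_le (huy.trans hyv).le] at hx
    obtain rfl := hR.eq_of_derivative_ne_zero hf hx ⟨huy.le, hyv.le⟩ (by simp [h]) hy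
    exact hf x huy hyv (by simp [derivative_mul, h])
  have hs := hR.sign_eval_eq hg
  have hpos : 0 < g.eval u * g.eval v := by
    rcases (hg u Set.left_mem_uIcc).lt_or_gt with h | h
    · rw [sign_neg h] at hs
      exact mul_pos_of_neg_of_neg h (sign_eq_neg_one_iff.1 hs.symm)
    · rw [sign_pos h] at hs
      exact mul_pos h (sign_eq_one_iff.1 hs.symm)
  have h1 : 0 < (y - u) * (v - y) := mul_pos (sub_pos.2 huy) (sub_pos.2 hyv)
  simp only [eval_mul, eval_sub, eval_X, eval_C]
  nlinarith [mul_pos h1 hpos]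

end IntermediateValue

section Cuts

variable {K R : Type*} [Field K] [LinearOrder K] [IsStrictOrderedRing K]
  [Field R] [LinearOrder R] [IsStrictOrderedRing R]

theorem Polynomial.exists_abs_lt_of_eval₂_eq_zero {i : K →+* R} (hi : StrictMono i) {f : K[X]}
    (hf : f ≠ 0) {y : R} (hy : f.eval₂ i y = 0) : ∃ k, |y| < i k := by
  wlog hmon : f.Monic generalizing f
  · exact this (mul_ne_zero hf (by simpa using hf)) (by simp [eval₂_mul, hy])
      (monic_mul_leadingCoeff_inv hf)
  set n := f.natDegree with hn
  set B : R := ∑ j ∈ Finset.range n, |i (f.coeff j)| with hB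
  have hiabs : ∀ k, |i k| = i |k| := by
    intro k
    rcases le_total 0 k with h | h
    · rw [abs_of_nonneg h, abs_of_nonneg (by simpa using hi.monotone h)]
    · rw [abs_of_nonpos h, abs_of_nonpos (by simpa using hi.monotone h), map_neg]
  have hBk : B = i (∑ j ∈ Finset.range n, |f.coeff j|) := by simp [hB, hiabs]
  have hB0 : 0 ≤ B := Finset.sum_nonneg fun _ _ => abs_nonneg _
  suffices |y| ≤ 1 + B from
    ⟨2 + ∑ j ∈ Finset.range n, |f.coeff j|, by rw [map_add, ← hBk, map_ofNat]; linarith⟩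
  by_contra hlt
  push Not at hlt
  have h1 : 1 < |y| := by linarith
  have hn0 : n ≠ 0 := by
    intro h0
    have := eq_one_of_monic_natDegree_zero hmon h0
    simp [this] at hy
  have h2 : y ^ n = -∑ j ∈ Finset.range n, i (f.coeff j) * y ^ j := by
    have h3 := hy
    rw [hmon.as_sum] at h3
    simp only [eval₂_add, eval₂_pow, eval₂_X, eval₂_finsetSum, eval₂_mul, eval₂_C] at h3
    linear_combination h3
  have h4 : |y| ^ n ≤ B * |y| ^ (n - 1) := by
    rw [← abs_pow, h2, abs_neg]
    refine (Finset.abs_sum_le_sum_abs _ _).trans ?_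
    rw [hB, Finset.sum_mul]
    refine Finset.sum_le_sum fun j hj => ?_
    rw [abs_mul, abs_pow]
    have := Finset.mem_range.1 hj
    exact mul_le_mul_of_nonneg_left (pow_le_pow_right₀ h1.le (by omega)) (abs_nonneg _)
  have h5 : |y| ^ n = |y| * |y| ^ (n - 1) := (mul_pow_sub_one hn0 _).symm
  rw [h5] at h4
  have := le_of_mul_le_mul_right h4 (by positivity)
  linarith

theorem StrictMono.exists_same_cut {i : K →+* R} (hi : StrictMono i) {y : R}
    (hy : y ∉ Set.range i) (A : Finset K) : ∃ m, ∀ a ∈ A, a ≠ m ∧ (i a < y ↔ a < m) := by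
  obtain ⟨m, h1, h2⟩ := Order.exists_between_finsets (A.filter (fun a => i a < y))
    (A.filter (fun a => y < i a)) (fun a ha b hb => by
      simp only [Finset.mem_filter] at ha hb
      exact hi.lt_iff_lt.1 (ha.2.trans hb.2))
  refine ⟨m, fun a ha => ?_⟩
  rcases lt_trichotomy (i a) y with h | h | h
  · have := h1 a (by simp [ha, h])
    exact ⟨this.ne, iff_of_true h this⟩
  · exact absurd ⟨a, h⟩ hy
  · have := h2 a (by simp [ha, h])
    exact ⟨this.ne', iff_of_false h.not_gt this.not_gt⟩

theorem StrictMono.exists_bounds {i : K →+* R} {y : R} (hy : y ∉ Set.range i)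
    (hb : ∃ k, |y| < i k) (A : Finset K) :
    ∃ u v, i u < y ∧ y < i v ∧ ∀ a ∈ A, a ≤ u ∨ v ≤ a := by
  obtain ⟨k, hk⟩ := hb
  rw [abs_lt] at hk
  obtain ⟨u, hu, hu'⟩ := Finset.exists_max_image ((insert (-k) A).filter (fun a => i a < y)) id
    ⟨-k, by simp [hk.1]⟩
  obtain ⟨v, hv, hv'⟩ := Finset.exists_min_image ((insert k A).filter (fun a => y < i a)) id
    ⟨k, by simp [hk.2]⟩
  simp only [Finset.mem_filter, id] at hu hu' hv hv'
  refine ⟨u, v, hu.2, hv.2, fun a ha => ?_⟩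
  rcases lt_trichotomy (i a) y with h | h | h
  · exact .inl (hu' a ⟨Finset.mem_insert_of_mem ha, h⟩)
  · exact absurd ⟨a, h⟩ hy
  · exact .inr (hv' a ⟨Finset.mem_insert_of_mem ha, h⟩)

theorem StrictMono.sign_eval₂_apply {i : K →+* R} (hi : StrictMono i) (h : K[X]) (m : K) :
    SignType.sign (h.eval₂ i (i m)) = SignType.sign (h.eval m) := by
  rw [eval₂_at_apply]
  rcases lt_trichotomy (h.eval m) 0 with h0 | h0 | h0
  · rw [sign_neg h0, sign_neg (by simpa using hi h0)]
  · simp [h0]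
  · rw [sign_pos h0, sign_pos (by simpa using hi h0)]

theorem PolyIVT.sign_eval₂_eq_of_same_cut (hR : PolyIVT R) {i : K →+* R} (hi : StrictMono i)
    {h : K[X]} (hroots : ∀ y, h.eval₂ i y = 0 → y ∈ Set.range i) {y : R} (hy : y ∉ Set.range i)
    {m : K} (hm : ∀ a, h.eval a = 0 → a ≠ m ∧ (i a < y ↔ a < m)) :
    SignType.sign (h.eval₂ i y) = SignType.sign (h.eval m) := by
  rw [← hi.sign_eval₂_apply, ← eval_map, ← eval_map]
  refine hR.sign_eval_eq fun x hx hx0 => ?_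
  rw [eval_map] at hx0
  obtain ⟨a, rfl⟩ := hroots x hx0
  rw [eval₂_at_apply, map_eq_zero] at hx0
  obtain ⟨h1, h2⟩ := hm a hx0
  rcases lt_or_gt_of_ne h1 with h3 | h3
  · have h4 := h2.2 h3
    rcases Set.mem_uIcc.1 hx with h5 | h5
    · exact absurd h5.1 h4.not_ge
    · exact absurd h5.1 (hi h3).not_ge
  · have h4 : ¬ i a < y := fun h => (h2.1 h).not_gt h3
    have h5 : y ≠ i a := fun h => hy ⟨a, h.symm⟩
    have h6 : y < i a := lt_of_le_of_ne (not_lt.1 h4) h5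
    rcases Set.mem_uIcc.1 hx with h7 | h7
    · exact absurd h7.2 (hi h3).not_ge
    · exact absurd h7.2 h6.not_ge

end Cuts

section Extension

variable {K R R' : Type*} [Field K] [LinearOrder K] [IsStrictOrderedRing K]
  [Field R] [LinearOrder R] [IsStrictOrderedRing R]
  [Field R'] [LinearOrder R'] [IsStrictOrderedRing R']

theorem PolyIVT.lt_root_iff (hR : PolyIVT R) {i : K →+* R} (hi : StrictMono i) {f : K[X]} {u v : K}
    (hf : ∀ x, i u < x → x < i v → f.derivative.eval₂ i x ≠ 0) {y : R} (huy : i u < y)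
    (hyv : y < i v) (hy : f.eval₂ i y = 0) (hy' : y ∉ Set.range i) :
    f.eval u * f.eval v < 0 ∧
      ∀ w, u < w → w < v → (i w < y ↔ 0 < f.eval u * f.eval w) := by
  have key : ∀ a b, u ≤ a → b ≤ v → i a < y → y < i b → f.eval a * f.eval b < 0 := by
    intro a b hua hbv ha hb
    have := hR.eval_mul_eval_neg (f := f.map i) (u := i a) (y := y) (v := i b)
      (fun x h1 h2 => by
        rw [derivative_map, eval_map]
        exact hf x ((hi.monotone hua).trans_lt h1) (h2.trans_le (hi.monotone hbv)))
      ha hb (by rwa [eval_map])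
    rw [eval_map, eval_map, eval₂_at_apply, eval₂_at_apply, ← map_mul] at this
    rwa [← map_zero i, hi.lt_iff_lt] at this
  refine ⟨key u v le_rfl le_rfl huy hyv, fun w huw hwv => ⟨fun h => ?_, fun h => ?_⟩⟩
  · have h1 := key u v le_rfl le_rfl huy hyv
    have h2 := key w v huw.le le_rfl h hyv
    have h3 := mul_pos_of_neg_of_neg h1 h2
    rw [show f.eval u * f.eval v * (f.eval w * f.eval v) =
      f.eval u * f.eval w * (f.eval v * f.eval v) by ring] at h3
    exact pos_of_mul_pos_left h3 (mul_self_nonneg _)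
  · by_contra hlt
    have h1 : y < i w := lt_of_le_of_ne (not_lt.1 hlt) fun h => hy' ⟨w, h.symm⟩
    exact (key u w le_rfl hwv.le huy h1).not_gt h

theorem mem_range_of_eval₂_eq_zero_aux (hR : PolyIVT R) (hR' : PolyIVT R') {i : K →+* R}
    (hi : StrictMono i) {i' : K →+* R'} (hi' : StrictMono i') {d : ℕ}
    (ih : ∀ h : K[X], h ≠ 0 → h.natDegree < d → ∀ y, h.eval₂ i y = 0 → y ∈ Set.range i)
    (ih' : ∀ h : K[X], h ≠ 0 → h.natDegree < d → ∀ y, h.eval₂ i' y = 0 → y ∈ Set.range i')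
    (hmax : ∀ y z, (∀ h : K[X], SignType.sign (h.eval₂ i y) = SignType.sign (h.eval₂ i' z)) →
      y ∈ Set.range i)
    {f : K[X]} (hf : f ≠ 0) (hfd : f.natDegree = d) {y : R} (hy : f.eval₂ i y = 0) :
    y ∈ Set.range i := by
  by_contra hy'
  have hd : f.natDegree ≠ 0 := fun h => by
    rw [eq_C_of_natDegree_eq_zero h, eval₂_C, map_eq_zero] at hy
    rw [eq_C_of_natDegree_eq_zero h, hy, map_zero] at hf
    exact hf rfl
  have hf' : f.derivative ≠ 0 := fun h => hd (derivative_eq_zero.1 h)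
  have hf'd : f.derivative.natDegree < d := hfd ▸ natDegree_derivative_lt hd
  obtain ⟨u, v, huy, hyv, huv⟩ := StrictMono.exists_bounds hy'
    (exists_abs_lt_of_eval₂_eq_zero hi hf hy) f.derivative.roots.toFinset
  have hder : ∀ x, i u < x → x < i v → f.derivative.eval₂ i x ≠ 0 := by
    intro x h1 h2 h3
    obtain ⟨a, rfl⟩ := ih _ hf' hf'd x h3
    rw [eval₂_at_apply, map_eq_zero] at h3
    rcases huv a (by simpa [hf'] using h3) with h | h
    · exact (hi.lt_iff_lt.1 h1).not_ge h
    · exact (hi.lt_iff_lt.1 h2).not_ge h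
  have hder' : ∀ x, i' u < x → x < i' v → f.derivative.eval₂ i' x ≠ 0 := by
    intro x h1 h2 h3
    obtain ⟨a, rfl⟩ := ih' _ hf' hf'd x h3
    rw [eval₂_at_apply, map_eq_zero] at h3
    rcases huv a (by simpa [hf'] using h3) with h | h
    · exact (hi'.lt_iff_lt.1 h1).not_ge h
    · exact (hi'.lt_iff_lt.1 h2).not_ge h
  obtain ⟨hneg, hcut⟩ := hR.lt_root_iff hi hder huy hyv hy hy'
  obtain ⟨z, huz, hzv, hz⟩ := hR' (f.map i') (i' u) (i' v)
    (hi' (hi.lt_iff_lt.1 (huy.trans hyv))) (by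
      rw [eval_map, eval_map, eval₂_at_apply, eval₂_at_apply, ← map_mul]
      simpa using hi' hneg)
  rw [eval_map] at hz
  have hz' : z ∉ Set.range i' := by
    rintro ⟨k, rfl⟩
    rw [eval₂_at_apply, map_eq_zero] at hz
    refine hy' ⟨k, hR.eq_of_derivative_ne_zero (f := f.map i) (u := i u) (v := i v)
      (fun x h1 h2 => ?_) ⟨(hi (hi'.lt_iff_lt.1 huz)).le, (hi (hi'.lt_iff_lt.1 hzv)).le⟩
      ⟨huy.le, hyv.le⟩ (by rw [eval_map, eval₂_at_apply, hz, map_zero]) (by rwa [eval_map])⟩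
    rw [derivative_map, eval_map]
    exact hder x h1 h2
  obtain ⟨-, hcut'⟩ := hR'.lt_root_iff hi' hder' huz hzv hz hz'
  have hsame : ∀ w, i w < y ↔ i' w < z := by
    intro w
    rcases le_or_gt w u with h | h
    · exact iff_of_true ((hi.monotone h).trans_lt huy) ((hi'.monotone h).trans_lt huz)
    rcases lt_or_ge w v with h' | h'
    · rw [hcut w h h', hcut' w h h']
    · exact iff_of_false (hyv.trans_le (hi.monotone h')).not_gt
        (hzv.trans_le (hi'.monotone h')).not_gt
  refine hy' (hmax y z fun h => ?_)
  have e1 : h.eval₂ i y = (h % f).eval₂ i y := by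
    conv_lhs => rw [← EuclideanDomain.div_add_mod h f]
    rw [eval₂_add, eval₂_mul, hy, zero_mul, zero_add]
  have e2 : h.eval₂ i' z = (h % f).eval₂ i' z := by
    conv_lhs => rw [← EuclideanDomain.div_add_mod h f]
    rw [eval₂_add, eval₂_mul, hz, zero_mul, zero_add]
  rw [e1, e2]
  by_cases hr : h % f = 0
  · simp [hr]
  have hrd : (h % f).natDegree < d := hfd ▸ natDegree_mod_lt h hd
  obtain ⟨m, hm⟩ := hi.exists_same_cut hy' (h % f).roots.toFinset
  have hm1 : ∀ a, (h % f).eval a = 0 → a ≠ m ∧ (i a < y ↔ a < m) := fun a ha =>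
    hm a (by simpa [hr] using ha)
  rw [hR.sign_eval₂_eq_of_same_cut hi (ih _ hr hrd) hy' hm1,
    hR'.sign_eval₂_eq_of_same_cut hi' (ih' _ hr hrd) hz' fun a ha => ?_]
  rw [← hsame]
  exact hm1 a ha

theorem mem_range_of_eval₂_eq_zero (hR : PolyIVT R) (hR' : PolyIVT R') {i : K →+* R}
    (hi : StrictMono i) {i' : K →+* R'} (hi' : StrictMono i')
    (hmax : ∀ y z, (∀ h : K[X], SignType.sign (h.eval₂ i y) = SignType.sign (h.eval₂ i' z)) →
      y ∈ Set.range i ∧ z ∈ Set.range i') (f : K[X]) (hf : f ≠ 0) :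
    (∀ y, f.eval₂ i y = 0 → y ∈ Set.range i) ∧ (∀ z, f.eval₂ i' z = 0 → z ∈ Set.range i') := by
  induction hd : f.natDegree using Nat.strong_induction_on generalizing f with
  | _ d ih =>
    have ih1 := fun h h0 hlt => (ih _ hlt h h0 rfl).1
    have ih2 := fun h h0 hlt => (ih _ hlt h h0 rfl).2
    exact ⟨fun y hy => mem_range_of_eval₂_eq_zero_aux hR hR' hi hi' ih1 ih2
        (fun y z h => (hmax y z h).1) hf hd hy,
      fun z hz => mem_range_of_eval₂_eq_zero_aux hR' hR hi' hi ih2 ih1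
        (fun z y h => (hmax y z fun p => (h p).symm).2) hf hd hz⟩

theorem exists_sign_eval₂_eq_of_mem_range_of_root (hR : PolyIVT R) {i : K →+* R}
    (hi : StrictMono i) {i' : K →+* R'} (hi' : StrictMono i')
    (hroots : ∀ f : K[X], f ≠ 0 → (∀ y, f.eval₂ i y = 0 → y ∈ Set.range i))
    (y : R) (L : Finset K[X]) : ∃ z : R', ∀ f ∈ L,
      SignType.sign (f.eval₂ i y) = SignType.sign (f.eval₂ i' z) := by
  classical
  by_cases hy : y ∈ Set.range i
  · obtain ⟨k, rfl⟩ := hy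
    exact ⟨i' k, fun f _ => by rw [hi.sign_eval₂_apply, hi'.sign_eval₂_apply]⟩
  obtain ⟨m, hm⟩ := hi.exists_same_cut hy (L.biUnion fun f => f.roots.toFinset)
  refine ⟨i' m, fun f hf => ?_⟩
  by_cases hf0 : f = 0
  · simp [hf0]
  rw [hi'.sign_eval₂_apply, hR.sign_eval₂_eq_of_same_cut hi (hroots f hf0) hy]
  exact fun a ha => hm a (Finset.mem_biUnion.2 ⟨f, hf, by simpa [hf0] using ha⟩)

end Extension

section CommonSubfield

variable {R R' : Type} [Field R] [LinearOrder R] [IsStrictOrderedRing R]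
  [Field R'] [LinearOrder R'] [IsStrictOrderedRing R']

theorem Subring.exists_maximal_pos_iff_pos (S₀ : Subring (R × R'))
    (h₀ : ∀ s ∈ S₀, 0 < s.1 ↔ 0 < s.2) :
    ∃ S : Subring (R × R'), S₀ ≤ S ∧ (∀ s ∈ S, 0 < s.1 ↔ 0 < s.2) ∧
      ∀ t : R × R', (∀ h : S[X], 0 < (h.eval₂ S.subtype t).1 ↔ 0 < (h.eval₂ S.subtype t).2) →
        t ∈ S := by
  obtain ⟨S, hS, hmax⟩ := zorn_le_nonempty₀
    {S : Subring (R × R') | ∀ s ∈ S, 0 < s.1 ↔ 0 < s.2} (fun c hc hchain S hS =>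
      ⟨sSup c, fun s hs => by
        obtain ⟨T, hT, hsT⟩ := (Subring.mem_sSup_of_directedOn ⟨S, hS⟩ hchain.directedOn).1 hs
        exact hc hT s hsT, fun T hT => le_sSup hT⟩) S₀ h₀
  refine ⟨S, hS, hmax.prop, fun t ht => ?_⟩
  refine hmax.le_of_ge (y := (eval₂RingHom S.subtype t).range) ?_ ?_ ⟨X, by simp⟩
  · rintro _ ⟨h, rfl⟩
    exact ht h
  · intro s hs
    exact ⟨C ⟨s, hs⟩, by simp⟩

theorem Subring.eval₂_inv_mul_pow_mem {F : Type*} [CommRing F] (S : Subring F) {s t : F}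
    (hs : s ∈ S) (hst : t * s = 1) (h : S[X]) : ∃ e, h.eval₂ S.subtype t * s ^ e ∈ S := by
  induction h using Polynomial.induction_on with
  | C a => exact ⟨0, by simp⟩
  | add p q hp hq =>
    obtain ⟨e, he⟩ := hp
    obtain ⟨e', he'⟩ := hq
    refine ⟨e + e', ?_⟩
    rw [eval₂_add, show (p.eval₂ S.subtype t + q.eval₂ S.subtype t) * s ^ (e + e') =
      p.eval₂ S.subtype t * s ^ e * s ^ e' + q.eval₂ S.subtype t * s ^ e' * s ^ e by ring]
    exact add_mem (mul_mem he (pow_mem hs _)) (mul_mem he' (pow_mem hs _))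
  | monomial n a _ =>
    refine ⟨n + 1, ?_⟩
    rw [eval₂_mul, eval₂_C, eval₂_pow, eval₂_X, mul_assoc, ← mul_pow, hst]
    simp

theorem exists_maximal_common_ordered_field {D : Type*} [CommRing D] (ρ : D →+* R) (ρ' : D →+* R')
    (hρ : ∀ d, 0 < ρ d ↔ 0 < ρ' d) :
    ∃ (K : Type) (_ : Field K) (_ : LinearOrder K) (_ : IsStrictOrderedRing K)
      (i : K →+* R) (i' : K →+* R') (φ : D →+* K), StrictMono i ∧ StrictMono i' ∧
      i.comp φ = ρ ∧ i'.comp φ = ρ' ∧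
      ∀ y z, (∀ h : K[X], SignType.sign (h.eval₂ i y) = SignType.sign (h.eval₂ i' z)) →
        y ∈ Set.range i ∧ z ∈ Set.range i' := by
  obtain ⟨S, hS, hpos, hmax⟩ := Subring.exists_maximal_pos_iff_pos (ρ.prod ρ').range (by
    rintro _ ⟨d, rfl⟩
    exact hρ d)
  have hzero : ∀ s ∈ S, s.1 = 0 ↔ s.2 = 0 := by
    intro s hs
    have h1 := hpos s hs
    have h2 := hpos (-s) (neg_mem hs)
    simp only [Prod.fst_neg, Prod.snd_neg, neg_pos] at h2
    constructor
    · intro h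
      exact le_antisymm (not_lt.1 fun h' => (h1.2 h').ne' h) (not_lt.1 fun h' => (h2.2 h').ne h)
    · intro h
      exact le_antisymm (not_lt.1 fun h' => (h1.1 h').ne' h) (not_lt.1 fun h' => (h2.1 h').ne h)
  have hfst : ∀ s : S, s.1.1 = 0 → s = 0 := fun s h =>
    Subtype.ext (Prod.ext h ((hzero s s.2).1 h))
  have hfield : IsField S := by
    refine ⟨⟨0, 1, zero_ne_one⟩, mul_comm, fun {s} hs => ?_⟩
    have h1 : s.1.1 ≠ 0 := fun h => hs (hfst s h)
    have h2 : s.1.2 ≠ 0 := fun h => h1 ((hzero s s.2).2 h)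
    set t : R × R' := (s.1.1⁻¹, s.1.2⁻¹) with ht
    have hts : t * s.1 = 1 := Prod.ext (inv_mul_cancel₀ h1) (inv_mul_cancel₀ h2)
    refine ⟨⟨t, hmax t fun h => ?_⟩, Subtype.ext (by rw [mul_comm]; exact hts)⟩
    obtain ⟨e, he⟩ := S.eval₂_inv_mul_pow_mem s.2 hts h
    have := hpos _ (mul_mem he (pow_mem s.2 e))
    simp only [Prod.fst_mul, Prod.snd_mul, Prod.pow_fst, Prod.pow_snd, mul_assoc] at this
    rwa [mul_pos_iff_of_pos_right (mul_self_pos.2 (pow_ne_zero _ h1)),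
      mul_pos_iff_of_pos_right (mul_self_pos.2 (pow_ne_zero _ h2))] at this
  obtain ⟨K, _, j, φ, hjpos, hφ, hjmax⟩ : ∃ (K : Type) (_ : Field K) (j : K →+* R × R')
      (φ : D →+* K), (∀ s, 0 < (j s).1 ↔ 0 < (j s).2) ∧ j.comp φ = ρ.prod ρ' ∧
      ∀ t : R × R', (∀ h : K[X], 0 < (h.eval₂ j t).1 ↔ 0 < (h.eval₂ j t).2) → ∃ s, j s = t :=
    letI : Field S := hfield.toField
    ⟨S, this, S.subtype, (ρ.prod ρ').codRestrict S fun d => hS ⟨d, rfl⟩, fun s => hpos s s.2, rfl,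
      fun t ht => ⟨⟨t, hmax t ht⟩, rfl⟩⟩
  let i : K →+* R := (RingHom.fst R R').comp j
  let i' : K →+* R' := (RingHom.snd R R').comp j
  let : LinearOrder K := LinearOrder.lift' i i.injective
  have hi : StrictMono i := fun _ _ h => h
  have hi' : StrictMono i' := fun a b h => by
    have := (hjpos (b - a)).1 (by simpa [i] using hi h)
    simpa [i'] using this
  have : IsStrictOrderedRing K := Function.Injective.isStrictOrderedRing i (map_zero i) (map_one i)
    (map_add i) (map_mul i) Iff.rfl Iff.rfl
  have hev : ∀ (y : R) (z : R') (h : K[X]), h.eval₂ j (y, z) = (h.eval₂ i y, h.eval₂ i' z) := by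
    intro y z h
    exact Prod.ext (hom_eval₂ h j (RingHom.fst R R') (y, z))
      (hom_eval₂ h j (RingHom.snd R R') (y, z))
  refine ⟨K, inferInstance, inferInstance, inferInstance, i, i', φ, hi, hi',
    by rw [RingHom.comp_assoc, hφ]; rfl, by rw [RingHom.comp_assoc, hφ]; rfl, fun y z hyz => ?_⟩
  obtain ⟨s, hs⟩ := hjmax (y, z) fun h => by
    rw [hev, ← sign_eq_one_iff, ← sign_eq_one_iff, hyz]
  exact ⟨⟨s, congrArg Prod.fst hs⟩, ⟨s, congrArg Prod.snd hs⟩⟩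

/-- Given the same ordering data on `D`, a point over one field with the intermediate value property
can be replaced by a point over any other, preserving finitely many polynomial signs. -/
theorem PolyIVT.exists_sign_eval₂_eq {D : Type*} [CommRing D] (hR : PolyIVT R) (hR' : PolyIVT R')
    (ρ : D →+* R) (ρ' : D →+* R') (hρ : ∀ d, 0 < ρ d ↔ 0 < ρ' d) (y : R) (L : Finset D[X]) :
    ∃ z : R', ∀ f ∈ L, SignType.sign (f.eval₂ ρ y) = SignType.sign (f.eval₂ ρ' z) := by
  classical
  obtain ⟨K, _, _, _, i, i', φ, hi, hi', rfl, rfl, hmax⟩ :=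
    exists_maximal_common_ordered_field ρ ρ' hρ
  obtain ⟨z, hz⟩ := exists_sign_eval₂_eq_of_mem_range_of_root (R' := R') hR hi hi'
    (fun f hf => (mem_range_of_eval₂_eq_zero hR hR' hi hi' hmax f hf).1) y (L.image (map φ))
  refine ⟨z, fun f hf => ?_⟩
  have := hz _ (Finset.mem_image_of_mem _ hf)
  rwa [eval₂_map, eval₂_map] at this

end CommonSubfield

section Ultraproduct

variable {ι : Type} {U : Ultrafilter ι}

theorem Filter.Germ.eval₂_coeRingHom {D : Type*} [CommRing D] (ρ : ι → D →+* ℝ) (f : D[X])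
    (w : ι → ℝ) :
    f.eval₂ ((Filter.Germ.coeRingHom (U : Filter ι)).comp (RingHom.pi ρ)) (w : Germ (U : Filter ι) ℝ)
      = ((fun j => f.eval₂ (ρ j) (w j) : ι → ℝ) : Germ (U : Filter ι) ℝ) := by
  have h1 := hom_eval₂ f (RingHom.pi ρ) (Filter.Germ.coeRingHom (U : Filter ι)) w
  refine h1.symm.trans (congrArg _ (funext fun j => ?_))
  exact hom_eval₂ f (RingHom.pi ρ) (Pi.evalRingHom (fun _ => ℝ) j) w

theorem Filter.Germ.sign_coe_eq {g : ι → ℝ} {s : SignType} :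
    SignType.sign (g : Germ (U : Filter ι) ℝ) = s ↔ ∀ᶠ j in U, SignType.sign (g j) = s := by
  cases s
  · simp only [SignType.zero_eq_zero, sign_eq_zero_iff]
    exact Filter.Germ.coe_eq
  · simp only [SignType.neg_eq_neg_one, sign_eq_neg_one_iff]
    exact Filter.Germ.coe_lt
  · simp only [SignType.pos_eq_one, sign_eq_one_iff]
    exact Filter.Germ.coe_lt

theorem PolyIVT.real : PolyIVT ℝ := by
  intro f a b hab hneg
  have hc : ContinuousOn (fun x => f.eval x) (Set.uIcc a b) := f.continuous.continuousOn
  obtain ⟨c, hc1, hc2⟩ := intermediate_value_uIcc hc (show (0 : ℝ) ∈ Set.uIcc _ _ by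
    rw [Set.mem_uIcc]
    rcases mul_neg_iff.1 hneg with h | h
    · exact .inr ⟨h.2.le, h.1.le⟩
    · exact .inl ⟨h.1.le, h.2.le⟩)
  rw [Set.uIcc_of_le hab.le] at hc1
  refine ⟨c, lt_of_le_of_ne hc1.1 ?_, lt_of_le_of_ne hc1.2 ?_, hc2⟩
  · rintro rfl
    simp [hc2] at hneg
  · rintro rfl
    simp [hc2] at hneg

theorem PolyIVT.germ : PolyIVT (Filter.Germ (U : Filter ι) ℝ) := by
  intro f a b hab hneg
  obtain ⟨F, rfl⟩ := map_surjective (Filter.Germ.coeRingHom (U : Filter ι))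
    (fun z => Filter.Germ.inductionOn z fun g => ⟨g, rfl⟩) f
  induction a using Filter.Germ.inductionOn with | _ α => ?_
  induction b using Filter.Germ.inductionOn with | _ β => ?_
  have hev : ∀ w : ι → ℝ, (F.map (Filter.Germ.coeRingHom (U : Filter ι))).eval
      (w : Filter.Germ (U : Filter ι) ℝ) =
      ((fun j => (F.map (Pi.evalRingHom _ j)).eval (w j) : ι → ℝ) : Filter.Germ (U : Filter ι) ℝ) := by
    intro w
    rw [eval_map]
    simp_rw [eval_map]
    exact Filter.Germ.eval₂_coeRingHom (fun j => Pi.evalRingHom _ j) F w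
  rw [hev, hev, ← Filter.Germ.coe_mul] at hneg
  have h1 : ∀ᶠ j in U, α j < β j := Filter.Germ.coe_lt.1 hab
  have h2 := Filter.Germ.coe_lt.1 hneg
  have h3 : ∀ᶠ j in U, ∃ c, α j < c ∧ c < β j ∧ (F.map (Pi.evalRingHom _ j)).eval c = 0 := by
    filter_upwards [h1, h2] with j hj1 hj2
    exact PolyIVT.real _ _ _ hj1 hj2
  obtain ⟨γ, hγ⟩ := h3.choice
  refine ⟨(γ : Filter.Germ (U : Filter ι) ℝ), Filter.Germ.coe_lt.2 (hγ.mono fun j h => h.1),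
    Filter.Germ.coe_lt.2 (hγ.mono fun j h => h.2.1), ?_⟩
  rw [hev]
  exact Filter.Germ.coe_eq.2 (hγ.mono fun j h => h.2.2)

end Ultraproduct

theorem RingHom.strictMono_of_real {R : Type*} [Field R] [LinearOrder R] [IsStrictOrderedRing R]
    (φ : ℝ →+* R) : StrictMono φ := by
  intro a b hab
  have h : φ (b - a) = φ (√(b - a)) ^ 2 := by rw [← map_pow, Real.sq_sqrt (by linarith)]
  rw [← sub_pos, ← map_sub, h]
  have : φ (√(b - a)) ≠ 0 := by
    rw [Ne, map_eq_zero]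
    exact (Real.sqrt_pos.2 (sub_pos.2 hab)).ne'
  positivity

theorem MvPolynomial.eval₂_finSuccEquiv {A S : Type*} [CommRing A] [CommRing S] {k : ℕ} (φ : A →+* S)
    (x : Fin (k + 1) → S) (p : MvPolynomial (Fin (k + 1)) A) :
    (finSuccEquiv A k p).eval₂ (eval₂Hom φ fun j : Fin k => x j.succ) (x 0) = p.eval₂ φ x := by
  induction p using MvPolynomial.induction_on with
  | C a => rw [← algebraMap_eq, AlgEquiv.commutes, Polynomial.algebraMap_apply]; simp
  | add p q hp hq => simp [eval₂_add, Polynomial.eval₂_add, hp, hq]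
  | mul_X p j hp =>
    rw [map_mul, Polynomial.eval₂_mul, hp, MvPolynomial.eval₂_mul, MvPolynomial.eval₂_X]
    congr 1
    refine Fin.cases ?_ (fun j => ?_) j
    · rw [finSuccEquiv_X_zero, Polynomial.eval₂_X]
    · rw [finSuccEquiv_X_succ, Polynomial.eval₂_C]
      simp

theorem PolyIVT.exists_real_sign_eq {R : Type} [Field R] [LinearOrder R] [IsStrictOrderedRing R]
    (hR : PolyIVT R) (φ : ℝ →+* R) (k : ℕ) (x : Fin k → R) (L : Finset (MvPolynomial (Fin k) ℝ)) :
    ∃ a : Fin k → ℝ, ∀ p ∈ L,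
      SignType.sign (p.eval₂ φ x) = SignType.sign (MvPolynomial.eval a p) := by
  classical
  induction k with
  | zero =>
    refine ⟨Fin.elim0, fun p _ => ?_⟩
    obtain ⟨c, rfl⟩ := MvPolynomial.C_surjective (Fin 0) p
    rw [MvPolynomial.eval₂_C, MvPolynomial.eval_C]
    simpa using φ.strictMono_of_real.sign_eval₂_apply X c
  | succ k ih =>
    choose a ha using ih (fun j : Fin k => x j.succ)
    let U : Ultrafilter (Finset (MvPolynomial (Fin k) ℝ)) := Ultrafilter.of Filter.atTop
    have hU : ∀ p : MvPolynomial (Fin k) ℝ, ∀ᶠ l in U,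
        SignType.sign (p.eval₂ φ fun j : Fin k => x j.succ) = SignType.sign (MvPolynomial.eval (a l) p) := by
      intro p
      refine Ultrafilter.of_le _ ((Filter.eventually_ge_atTop {p}).mono fun l hl => ?_)
      exact ha l p (hl (Finset.mem_singleton_self p))
    let ρ := MvPolynomial.eval₂Hom φ fun j : Fin k => x j.succ
    let ρ' := (Filter.Germ.coeRingHom (U : Filter _)).comp
      (RingHom.pi fun l => MvPolynomial.eval (a l))
    have hρ : ∀ d, 0 < ρ d ↔ 0 < ρ' d := by
      intro d
      have : SignType.sign (ρ' d) = SignType.sign (ρ d) :=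
        Filter.Germ.sign_coe_eq.2 ((hU d).mono fun l hl => hl.symm)
      rw [← sign_eq_one_iff, ← this, sign_eq_one_iff]
    obtain ⟨z, hz⟩ := hR.exists_sign_eval₂_eq (PolyIVT.germ (U := U)) ρ ρ' hρ (x 0)
      (L.image (MvPolynomial.finSuccEquiv ℝ k))
    induction z using Filter.Germ.inductionOn with | _ w => ?_
    have hall : ∀ᶠ l in U, ∀ p ∈ L, SignType.sign (p.eval₂ φ x) =
        SignType.sign (MvPolynomial.eval (Fin.cons (w l) (a l) : Fin (k + 1) → ℝ) p) := by
      rw [Filter.eventually_all_finset]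
      intro p hp
      have h1 := (hz _ (Finset.mem_image_of_mem _ hp)).symm
      rw [Filter.Germ.eval₂_coeRingHom, Filter.Germ.sign_coe_eq] at h1
      refine h1.mono fun l hl => ?_
      rw [MvPolynomial.eval_eq_eval_mv_eval', eval_map, hl]
      rw [← MvPolynomial.eval₂_finSuccEquiv]
    obtain ⟨l, hl⟩ := hall.exists
    exact ⟨_, hl⟩

section RealNullstellensatz

variable {A : Type*} [CommRing A]

theorem Ideal.exists_isPrime_real_of_notMem {I : Ideal A}
    (hI : ∀ a s, IsSumSq s → a * a + s ∈ I → a ∈ I) {g : A} (hg : g ∉ I) :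
    ∃ J : Ideal A, J.IsPrime ∧ I ≤ J ∧ g ∉ J ∧ ∀ a s, IsSumSq s → a * a + s ∈ J → a ∈ J := by
  let M : Submonoid A :=
    { carrier := {x | ∃ k s, IsSumSq s ∧ x = g ^ k * g ^ k + s}
      one_mem' := ⟨0, 0, .zero, by simp⟩
      mul_mem' := by
        rintro _ _ ⟨k, s, hs, rfl⟩ ⟨l, t, ht, rfl⟩
        refine ⟨k + l, g ^ k * g ^ k * t + s * (g ^ l * g ^ l) + s * t,
          (((IsSumSq.mul_self _).mul ht).add (hs.mul (IsSumSq.mul_self _))).add (hs.mul ht), ?_⟩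
        ring }
  have hpow : ∀ k, g ^ k ∉ I := by
    intro k
    induction k with
    | zero => exact fun h => hg (by simpa using I.mul_mem_left g h)
    | succ k ih =>
      intro h
      rcases k with _ | k
      · exact hg (by simpa using h)
      · refine ih (hI _ 0 .zero ?_)
        rw [add_zero, show g ^ (k + 1) * g ^ (k + 1) = g ^ k * g ^ (k + 1 + 1) by ring]
        exact I.mul_mem_left _ h
  have hdisj : Disjoint (I : Set A) M := by
    rw [Set.disjoint_left]
    rintro _ hx ⟨k, s, hs, rfl⟩
    exact hpow k (hI _ s hs hx)
  obtain ⟨J, hIJ, hJ⟩ := zorn_le_nonempty₀ {p : Ideal A | Disjoint (p : Set A) M}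
    (fun c hc hc' x hx => by
      refine ⟨sSup c, Set.disjoint_left.mpr fun y hy => ?_, fun _ => le_sSup⟩
      obtain ⟨p, hp, hyp⟩ := (Submodule.mem_sSup_of_directed ⟨x, hx⟩ hc'.directedOn).1 hy
      exact Set.disjoint_left.mp (hc hp) hyp) I hdisj
  refine ⟨J, isPrime_of_maximally_disjoint _ _ hJ.prop fun _ => hJ.not_prop_of_gt, hIJ,
    fun h => Set.disjoint_left.1 hJ.prop (J.mul_mem_left g h) ⟨1, 0, .zero, by simp⟩,
    fun a s hs has => ?_⟩
  by_contra ha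
  obtain ⟨m, hm, hmM⟩ := Set.not_disjoint_iff.1
    (hJ.not_prop_of_gt (y := J ⊔ span {a}) (Submodule.lt_sup_iff_notMem.mpr ha))
  obtain ⟨j, hj, _, hr, rfl⟩ := Submodule.mem_sup.1 hm
  obtain ⟨r, rfl⟩ := mem_span_singleton.1 hr
  obtain ⟨k, t, ht, hkt⟩ := M.mul_mem hmM hmM
  refine Set.disjoint_left.1 hJ.prop (?_ : (j + a * r) * (j + a * r) + s * (r * r) ∈ J) ⟨k, t + s * (r * r),
      ht.add (hs.mul (IsSumSq.mul_self r)), by rw [hkt, add_assoc]⟩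
  rw [show (j + a * r) * (j + a * r) + s * (r * r) =
    (j + 2 * a * r) * j + r * r * (a * a + s) by ring]
  exact J.add_mem (J.mul_mem_left _ hj) (J.mul_mem_left _ has)

theorem IsSumSq.exists_sq_mul_eq_algebraMap {B F : Type*} [CommRing B] [IsDomain B] [Field F]
    [Algebra B F] [IsFractionRing B F] {x : F} (hx : IsSumSq x) :
    ∃ b t : B, b ≠ 0 ∧ IsSumSq t ∧ algebraMap B F (b * b) * x = algebraMap B F t := by
  induction hx with
  | zero => exact ⟨1, 0, one_ne_zero, .zero, by simp⟩
  | sq_add a _ ih =>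
    obtain ⟨b, t, hb, ht, h⟩ := ih
    obtain ⟨c, d, hd, rfl⟩ := IsFractionRing.div_surjective (A := B) a
    have hd0 : d ≠ 0 := nonZeroDivisors.ne_zero hd
    refine ⟨b * d, b * c * (b * c) + d * d * t, mul_ne_zero hb hd0,
      .sq_add _ ((IsSumSq.mul_self d).mul ht), ?_⟩
    have hd' : algebraMap B F d ≠ 0 := by simpa using hd0
    simp only [map_add, map_mul] at h ⊢
    rw [← h]
    field_simp

theorem Ideal.isSemireal_fractionRing_quotient {J : Ideal A} [J.IsPrime]
    (hJ : ∀ a s, IsSumSq s → a * a + s ∈ J → a ∈ J) : IsSemireal (FractionRing (A ⧸ J)) := by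
  refine ⟨fun {x} hx h => ?_⟩
  obtain ⟨b, t, hb, ht, hbt⟩ := hx.exists_sq_mul_eq_algebraMap (B := A ⧸ J)
  obtain ⟨c, rfl⟩ := Ideal.Quotient.mk_surjective b
  obtain ⟨t, ht', rfl⟩ := ht.exists_of_surjective Ideal.Quotient.mk_surjective
  refine hb (Ideal.Quotient.eq_zero_iff_mem.2 (hJ c t ht' (Ideal.Quotient.eq_zero_iff_mem.1 ?_)))
  apply IsFractionRing.injective (A ⧸ J) (FractionRing (A ⧸ J))
  rw [map_add, map_add, map_mul, ← hbt, map_zero, ← mul_one_add, h, mul_zero]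

theorem Ideal.mem_of_eval_eq_zero {n : ℕ} {I : Ideal (MvPolynomial (Fin n) ℝ)}
    (hI : ∀ a s, IsSumSq s → a * a + s ∈ I → a ∈ I) {p g : MvPolynomial (Fin n) ℝ} (hp : p ∈ I)
    (hg : ∀ x, MvPolynomial.eval x p = 0 → MvPolynomial.eval x g = 0) : g ∈ I := by
  classical
  by_contra hgI
  obtain ⟨J, hJ, hIJ, hgJ, hJr⟩ := Ideal.exists_isPrime_real_of_notMem hI hgI
  have := Ideal.isSemireal_fractionRing_quotient hJr
  obtain ⟨R, _, _, _, ⟨ψ⟩, hR⟩ := IsSemireal.exists_ringHom_polyIVT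
    (FractionRing (MvPolynomial (Fin n) ℝ ⧸ J))
  let θ : MvPolynomial (Fin n) ℝ →+* R := (ψ.comp (algebraMap _ _)).comp (Ideal.Quotient.mk J)
  have hθ : ∀ q, θ q = 0 ↔ q ∈ J := by
    intro q
    simp only [θ, RingHom.comp_apply]
    rw [map_eq_zero, IsFractionRing.to_map_eq_zero_iff, Ideal.Quotient.eq_zero_iff_mem]
  have hθ' : ∀ q : MvPolynomial (Fin n) ℝ,
      q.eval₂ (θ.comp MvPolynomial.C) (fun j => θ (.X j)) = θ q := by
    intro q
    rw [← MvPolynomial.coe_eval₂Hom]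
    exact congrArg (fun f : _ →+* R => f q) (MvPolynomial.ringHom_ext (by simp) (by simp))
  obtain ⟨a, ha⟩ := hR.exists_real_sign_eq (θ.comp MvPolynomial.C) n (fun j => θ (.X j)) {p, g}
  have h1 := ha p (by simp)
  have h2 := ha g (by simp)
  rw [hθ'] at h1 h2
  rw [(hθ p).2 (hIJ hp), sign_zero, eq_comm, sign_eq_zero_iff] at h1
  rw [hg a h1, sign_zero, sign_eq_zero_iff, hθ] at h2
  exact hgJ h2

end RealNullstellensatz

end RealAlgebra

section Functional

variable {n : ℕ}

theorem Complex.eq_zero_of_forall_nonneg_add_mul {a w : ℂ} (h : ∀ t : ℝ, 0 ≤ a + t * w) :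
    w = 0 := by
  simp only [Complex.le_def, Complex.add_re, Complex.add_im, Complex.re_ofReal_mul,
    Complex.im_ofReal_mul, Complex.zero_re, Complex.zero_im] at h
  have h0 := (h 0).2
  have h1 := (h 1).2
  refine Complex.ext ?_ (by simp only [Complex.zero_im]; linarith)
  by_contra hne
  have h2 := (h (-(a.re + 1) / w.re)).1
  rw [div_mul_cancel₀ _ hne] at h2
  linarith

theorem starC_add (P Q : MvPolynomial (Fin n) ℂ) : starC (P + Q) = starC P + starC Q :=
  map_add _ _ _

theorem starC_mul (P Q : MvPolynomial (Fin n) ℂ) : starC (P * Q) = starC P * starC Q :=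
  map_mul _ _ _

theorem starC_starC (P : MvPolynomial (Fin n) ℂ) : starC (starC P) = P := by
  rw [starC, starC, MvPolynomial.map_map]
  convert MvPolynomial.map_id P using 2
  exact congrArg MvPolynomial.map (RingHom.ext Complex.conj_conj)

theorem starC_smul (c : ℂ) (P : MvPolynomial (Fin n) ℂ) :
    starC (c • P) = (starRingEnd ℂ c) • starC P := by
  rw [starC, MvPolynomial.smul_eq_C_mul, MvPolynomial.smul_eq_C_mul, map_mul, MvPolynomial.map_C,
    starC]

theorem IsPosDefC.map_mul_eq_zero {Λ : MvPolynomial (Fin n) ℂ →ₗ[ℂ] ℂ} (hΛ : IsPosDefC Λ)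
    {f : MvPolynomial (Fin n) ℂ} (hf : Λ (starC f * f) = 0) (g : MvPolynomial (Fin n) ℂ) :
    Λ (g * f) = 0 := by
  have key : ∀ t : ℂ, 0 ≤ Λ (g * starC g) +
      (t * Λ (g * f) + starRingEnd ℂ t * Λ (starC f * starC g)) := by
    intro t
    have h := hΛ (starC g + t • f)
    have e : starC (starC g + t • f) * (starC g + t • f) = g * starC g + (t • (g * f) +
        starRingEnd ℂ t • (starC f * starC g)) + (starRingEnd ℂ t * t) • (starC f * f) := by
      rw [starC_add, starC_starC, starC_smul]
      simp only [MvPolynomial.smul_eq_C_mul, map_mul]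
      ring
    rw [e] at h
    simpa [hf] using h
  have h1 : Λ (g * f) + Λ (starC f * starC g) = 0 :=
    Complex.eq_zero_of_forall_nonneg_add_mul fun t => by simpa [mul_add] using key t
  have h2 : Complex.I * Λ (g * f) - Complex.I * Λ (starC f * starC g) = 0 :=
    Complex.eq_zero_of_forall_nonneg_add_mul fun t => by
      convert key (t * Complex.I) using 2
      simp
      ring
  rw [← mul_sub, mul_eq_zero] at h2
  have h3 := h2.resolve_left Complex.I_ne_zero
  linear_combination (h1 + h3) / 2

theorem MvPolynomial.exists_re_im {σ : Type*} (P : MvPolynomial σ ℂ) : ∃ p q : MvPolynomial σ ℝ,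
    P = map Complex.ofRealHom p + C Complex.I * map Complex.ofRealHom q := by
  induction P using MvPolynomial.induction_on with
  | C z =>
    refine ⟨C z.re, C z.im, ?_⟩
    rw [map_C, map_C, ← C_mul, ← C_add]
    congr 1
    rw [Complex.ofRealHom_eq_coe, Complex.ofRealHom_eq_coe, mul_comm, Complex.re_add_im]
  | add P Q hP hQ =>
    obtain ⟨p, q, rfl⟩ := hP
    obtain ⟨p', q', rfl⟩ := hQ
    exact ⟨p + p', q + q', by simp only [map_add]; ring⟩
  | mul_X P j hP =>
    obtain ⟨p, q, rfl⟩ := hP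
    exact ⟨p * X j, q * X j, by simp only [map_mul, map_X]; ring⟩

theorem starC_map_ofReal (p : MvPolynomial (Fin n) ℝ) :
    starC (MvPolynomial.map Complex.ofRealHom p) = MvPolynomial.map Complex.ofRealHom p := by
  rw [starC, MvPolynomial.map_map]
  congr 1
  congr 1
  ext x
  simp

theorem starC_mul_self_eq (p q : MvPolynomial (Fin n) ℝ) :
    starC (.map Complex.ofRealHom p + .C Complex.I * .map Complex.ofRealHom q) *
      (.map Complex.ofRealHom p + .C Complex.I * .map Complex.ofRealHom q) =
      .map Complex.ofRealHom (p * p + q * q) := by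
  have hI : (MvPolynomial.C Complex.I : MvPolynomial (Fin n) ℂ) * .C Complex.I = -1 := by
    rw [← map_mul, Complex.I_mul_I, map_neg, map_one]
  rw [starC_add, starC_mul, starC_map_ofReal, starC_map_ofReal, starC, MvPolynomial.map_C,
    Complex.conj_I, map_neg, map_add, map_mul, map_mul]
  linear_combination -(MvPolynomial.map Complex.ofRealHom q) ^ 2 * hI

theorem evalC_map_ofReal (p : MvPolynomial (Fin n) ℝ) (x : Fin n → ℝ) :
    evalC (.map Complex.ofRealHom p) x = MvPolynomial.eval x p := by
  rw [evalC, MvPolynomial.aeval_def, MvPolynomial.eval₂_map]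
  exact (MvPolynomial.eval₂_comp_left Complex.ofRealHom (RingHom.id ℝ) x p).symm

theorem evalC_re_im (p q : MvPolynomial (Fin n) ℝ) (x : Fin n → ℝ) :
    evalC (.map Complex.ofRealHom p + .C Complex.I * .map Complex.ofRealHom q) x =
      MvPolynomial.eval x p + MvPolynomial.eval x q * Complex.I := by
  rw [← evalC_map_ofReal, ← evalC_map_ofReal]
  simp only [evalC, map_add, map_mul, MvPolynomial.aeval_C]
  simp [mul_comm]

theorem evalC_re_im_eq_zero_iff {p q : MvPolynomial (Fin n) ℝ} {x : Fin n → ℝ} :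
    evalC (.map Complex.ofRealHom p + .C Complex.I * .map Complex.ofRealHom q) x = 0 ↔
      MvPolynomial.eval x p = 0 ∧ MvPolynomial.eval x q = 0 := by
  rw [evalC_re_im, Complex.ext_iff]
  simp

/-- The real polynomials in the left kernel of a functional. -/
def realKernel (Λ : MvPolynomial (Fin n) ℂ →ₗ[ℂ] ℂ) : Ideal (MvPolynomial (Fin n) ℝ) where
  carrier := {p | ∀ g, Λ (g * .map Complex.ofRealHom p) = 0}
  add_mem' hp hq g := by rw [map_add, mul_add, map_add, hp g, hq g, add_zero]
  zero_mem' g := by simp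
  smul_mem' c p hp g := by
    rw [smul_eq_mul, RingHom.map_mul, ← mul_assoc]
    exact hp _

theorem IsPosDefC.mem_realKernel {Λ : MvPolynomial (Fin n) ℂ →ₗ[ℂ] ℂ} (hΛ : IsPosDefC Λ)
    {a s : MvPolynomial (Fin n) ℝ} (hs : IsSumSq s) (h : a * a + s ∈ realKernel Λ) :
    a ∈ realKernel Λ := by
  have hsq : ∀ p : MvPolynomial (Fin n) ℝ, 0 ≤ Λ (.map Complex.ofRealHom (p * p)) := by
    intro p
    have := hΛ (.map Complex.ofRealHom p)
    rwa [starC_map_ofReal, ← map_mul] at this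
  have hs' : 0 ≤ Λ (.map Complex.ofRealHom s) := by
    clear h
    induction hs with
    | zero => simp
    | sq_add p _ ih =>
      rw [map_add, map_add]
      exact add_nonneg (hsq p) ih
  have h1 := h 1
  rw [one_mul, map_add, map_add] at h1
  refine hΛ.map_mul_eq_zero ?_
  rw [starC_map_ofReal, ← map_mul]
  exact ((add_eq_zero_iff_of_nonneg (hsq a) hs').1 h1).1

theorem IsPosDefC.vanishingIdealC_subset_nSetC {Λ : MvPolynomial (Fin n) ℂ →ₗ[ℂ] ℂ}
    (hΛ : IsPosDefC Λ) {P : MvPolynomial (Fin n) ℂ} (hP : P ∈ nSetC Λ) :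
    (vanishingIdealC (zSetC P) : Set (MvPolynomial (Fin n) ℂ)) ⊆ nSetC Λ := by
  intro G hG
  obtain ⟨p, q, rfl⟩ := P.exists_re_im
  obtain ⟨g, h, rfl⟩ := G.exists_re_im
  have hpq : p * p + q * q ∈ realKernel Λ := by
    intro u
    rw [← starC_mul_self_eq, ← mul_assoc]
    exact hΛ.map_mul_eq_zero hP _
  have hzero : ∀ x, MvPolynomial.eval x (p * p + q * q) = 0 →
      MvPolynomial.eval x g = 0 ∧ MvPolynomial.eval x h = 0 := by
    intro x hx
    rw [map_add, map_mul, map_mul, mul_self_add_mul_self_eq_zero] at hx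
    exact evalC_re_im_eq_zero_iff.1 (hG x (evalC_re_im_eq_zero_iff.2 hx))
  have hg := Ideal.mem_of_eval_eq_zero (fun a s => hΛ.mem_realKernel) hpq fun x hx => (hzero x hx).1
  have hh := Ideal.mem_of_eval_eq_zero (fun a s => hΛ.mem_realKernel) hpq fun x hx => (hzero x hx).2
  change Λ _ = 0
  rw [mul_add, map_add, hg, zero_add, ← mul_assoc, hh]

end Functional

section Discrete

variable {n : ℕ}

theorem evalC_add (P Q : MvPolynomial (Fin n) ℂ) (x : Fin n → ℝ) :
    evalC (P + Q) x = evalC P x + evalC Q x :=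
  map_add _ _ _

theorem evalC_mul (P Q : MvPolynomial (Fin n) ℂ) (x : Fin n → ℝ) :
    evalC (P * Q) x = evalC P x * evalC Q x :=
  map_mul _ _ _

theorem continuous_evalC (P : MvPolynomial (Fin n) ℂ) : Continuous (evalC P) := by
  unfold evalC
  simp only [MvPolynomial.aeval_def, MvPolynomial.eval₂_eq]
  fun_prop

theorem evalC_starC_mul_self (P : MvPolynomial (Fin n) ℂ) (x : Fin n → ℝ) :
    evalC (starC P * P) x = ((‖evalC P x‖ ^ 2 : ℝ) : ℂ) := by
  obtain ⟨p, q, rfl⟩ := P.exists_re_im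
  rw [starC_mul_self_eq, evalC_map_ofReal, evalC_re_im, Complex.sq_norm, Complex.normSq_add_mul_I]
  simp only [map_add, map_mul, pow_two]

theorem exists_norm_evalC_le (P : MvPolynomial (Fin n) ℂ) :
    ∃ C, 0 ≤ C ∧ ∀ x, ‖evalC P x‖ ≤ C * Real.exp ‖x‖ := by
  obtain ⟨C, d, hC, h⟩ : ∃ (C : ℝ) (d : ℕ), 0 ≤ C ∧ ∀ x, ‖evalC P x‖ ≤ C * (1 + ‖x‖) ^ d := by
    induction P using MvPolynomial.induction_on with
    | C z => exact ⟨‖z‖, 0, norm_nonneg _, fun x => by simp [evalC]⟩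
    | add P Q hP hQ =>
      obtain ⟨C, d, hC, h⟩ := hP
      obtain ⟨C', d', hC', h'⟩ := hQ
      refine ⟨C + C', d + d', add_nonneg hC hC', fun x => ?_⟩
      have h1 : 1 ≤ 1 + ‖x‖ := le_add_of_nonneg_right (norm_nonneg x)
      rw [evalC_add, add_mul]
      refine (norm_add_le _ _).trans (add_le_add ((h x).trans ?_) ((h' x).trans ?_))
      · gcongr
        exact Nat.le_add_right _ _
      · gcongr
        exact Nat.le_add_left _ _
    | mul_X P j hP =>
      obtain ⟨C, d, hC, h⟩ := hP
      refine ⟨C, d + 1, hC, fun x => ?_⟩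
      rw [evalC_mul, norm_mul, pow_succ, ← mul_assoc]
      refine mul_le_mul (h x) ?_ (norm_nonneg _) (by positivity)
      have := norm_le_pi_norm x j
      simp only [evalC, MvPolynomial.aeval_X, Complex.norm_real]
      linarith
  refine ⟨C * (d.factorial * Real.exp 1), by positivity, fun x => (h x).trans ?_⟩
  have h1 := Real.pow_div_factorial_le_exp (1 + ‖x‖) (by positivity) d
  rw [div_le_iff₀ (by positivity), Real.exp_add] at h1
  rw [mul_assoc]
  gcongr
  linarith

theorem exists_isPosDefC_nSetC_eq (V : Set (Fin n → ℝ)) :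
    ∃ L : MvPolynomial (Fin n) ℂ →ₗ[ℂ] ℂ, IsPosDefC L ∧
      nSetC L = (vanishingIdealC V : Set (MvPolynomial (Fin n) ℂ)) := by
  rcases V.eq_empty_or_nonempty with rfl | hV
  · refine ⟨0, fun P => le_rfl, Set.ext fun P => iff_of_true rfl ?_⟩
    rintro x ⟨⟩
  have : Nonempty V := hV.to_subtype
  let v : ℕ → Fin n → ℝ := fun k => TopologicalSpace.denseSeq V k
  let c : ℕ → ℝ := fun k => (1 / 2) ^ k * Real.exp (-‖v k‖)
  have hc : ∀ k, 0 < c k := fun k => by positivity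
  have hsum : ∀ P, Summable fun k => (c k : ℂ) * evalC P (v k) := by
    intro P
    obtain ⟨C, hC, h⟩ := exists_norm_evalC_le P
    refine Summable.of_norm_bounded (summable_geometric_two.mul_right C) fun k => ?_
    rw [norm_mul, Complex.norm_real, Real.norm_of_nonneg (hc k).le]
    calc c k * ‖evalC P (v k)‖ ≤ c k * (C * Real.exp ‖v k‖) := by gcongr; exact h _
      _ = (1 / 2) ^ k * C * (Real.exp (-‖v k‖) * Real.exp ‖v k‖) := by ring
      _ = (1 / 2) ^ k * C := by rw [← Real.exp_add]; simp
  let L : MvPolynomial (Fin n) ℂ →ₗ[ℂ] ℂ :=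
    { toFun := fun P => ∑' k, (c k : ℂ) * evalC P (v k)
      map_add' := fun P Q => by
        simp only [evalC_add, mul_add]
        exact (hsum P).tsum_add (hsum Q)
      map_smul' := fun z P => by
        simp only [evalC, map_smul, smul_eq_mul, RingHom.id_apply]
        rw [← tsum_mul_left]
        exact tsum_congr fun k => by ring }
  have hterm : ∀ P k, (c k : ℂ) * evalC (starC P * P) (v k) =
      ((c k * ‖evalC P (v k)‖ ^ 2 : ℝ) : ℂ) := by
    intro P k
    rw [evalC_starC_mul_self]
    exact (Complex.ofReal_mul _ _).symm
  have hL : ∀ P, L (starC P * P) = ((∑' k, c k * ‖evalC P (v k)‖ ^ 2 : ℝ) : ℂ) := by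
    intro P
    rw [Complex.ofReal_tsum]
    exact tsum_congr (hterm P)
  have hsum' : ∀ P, Summable fun k => c k * ‖evalC P (v k)‖ ^ 2 := by
    intro P
    rw [← Complex.summable_ofReal]
    exact (hsum (starC P * P)).congr (hterm P)
  have hnn : ∀ P k, 0 ≤ c k * ‖evalC P (v k)‖ ^ 2 := fun P k => mul_nonneg (hc k).le (sq_nonneg _)
  refine ⟨L, fun P => ?_, Set.ext fun P => ?_⟩
  · rw [hL]
    exact_mod_cast tsum_nonneg (hnn P)
  · change L (starC P * P) = 0 ↔ ∀ x ∈ V, evalC P x = 0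
    rw [hL, Complex.ofReal_eq_zero]
    constructor
    · intro h x hx
      have hclosed : IsClosed {y : V | evalC P y = 0} :=
        isClosed_eq ((continuous_evalC P).comp continuous_subtype_val) continuous_const
      refine (TopologicalSpace.denseRange_denseSeq V).induction_on
        (p := fun y : V => evalC P y = 0) ⟨x, hx⟩ hclosed fun k => ?_
      have hk := le_antisymm (((hsum' P).le_tsum k fun j _ => hnn P j).trans_eq h) (hnn P k)
      have h1 := (mul_eq_zero.1 hk).resolve_left (hc k).ne'
      exact norm_eq_zero.1 (pow_eq_zero_iff two_ne_zero |>.1 h1)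
    · intro h
      have : ∀ k, evalC P (v k) = 0 := fun k => h (v k) (TopologicalSpace.denseSeq V k).2
      simp [this]

end Discrete

section Limits

open Filter Topology
open scoped NNReal

theorem abs_sub_clamp_le {R : ℝ} (hR : 0 < R) (t : ℝ) :
    |t - max (-R) (min t R)| ≤ t ^ 2 / R := by
  rw [le_div_iff₀ hR]
  rcases le_total t R with h | h
  · rw [min_eq_left h]
    rcases le_total (-R) t with h' | h'
    · rw [max_eq_right h']
      simpa using sq_nonneg t
    · rw [max_eq_left h', abs_of_nonpos (by linarith)]
      nlinarith
  · rw [min_eq_right h, max_eq_right (by linarith), abs_of_nonneg (by linarith)]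
    nlinarith

theorem abs_clamp_le {R : ℝ} (hR : 0 ≤ R) (t : ℝ) : |max (-R) (min t R)| ≤ R :=
  abs_le.2 ⟨le_max_left _ _, max_le (by linarith) (min_le_right _ _)⟩

variable {E ι : Type*} [TopologicalSpace E] [MeasurableSpace E] [OpensMeasurableSpace E]

theorem MeasureTheory.FiniteMeasure.tendsto_integral_of_bounded {U : Filter ι}
    {ν : ι → FiniteMeasure E} {μ : FiniteMeasure E} (h : Tendsto ν U (𝓝 μ)) {f : E → ℝ}
    (hf : Continuous f) {R : ℝ} (hR : ∀ x, |f x| ≤ R) :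
    Tendsto (fun i => ∫ x, f x ∂(ν i : Measure E)) U (𝓝 (∫ x, f x ∂(μ : Measure E))) :=
  FiniteMeasure.tendsto_iff_forall_integral_tendsto.1 h
    (BoundedContinuousFunction.ofNormedAddCommGroup f hf R hR)

theorem integrable_of_continuous_of_bounded {μ : Measure E} [IsFiniteMeasure μ] {f : E → ℝ}
    (hf : Continuous f) {R : ℝ} (hR : ∀ x, |f x| ≤ R) : Integrable f μ :=
  Integrable.of_bound hf.measurable.aestronglyMeasurable R (ae_of_all _ hR)

variable {U : Filter ι} [U.NeBot] {ν : ι → FiniteMeasure E} {μ : FiniteMeasure E}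
  {q : E → ℝ} {C : ℝ}

theorem MeasureTheory.FiniteMeasure.integrable_sq_and_integral_sq_le (h : Tendsto ν U (𝓝 μ))
    (hq : Continuous q) (hInt : ∀ i, Integrable (fun x => q x ^ 2) (ν i : Measure E))
    (hC : ∀ i, ∫ x, q x ^ 2 ∂(ν i : Measure E) ≤ C) :
    Integrable (fun x => q x ^ 2) (μ : Measure E) ∧ ∫ x, q x ^ 2 ∂(μ : Measure E) ≤ C := by
  have hcont (k : ℕ) : Continuous fun x => min (q x ^ 2) k := by fun_prop
  have hbdd (k : ℕ) (x : E) : |min (q x ^ 2) (k : ℝ)| ≤ k := by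
    rw [abs_of_nonneg (le_min (sq_nonneg _) k.cast_nonneg)]
    exact min_le_right _ _
  have hmin (k : ℕ) : ∫ x, min (q x ^ 2) (k : ℝ) ∂(μ : Measure E) ≤ C := by
    refine le_of_tendsto (FiniteMeasure.tendsto_integral_of_bounded h (hcont k) (hbdd k))
      (Eventually.of_forall fun i => (integral_mono ?_ (hInt i) ?_).trans (hC i))
    · exact integrable_of_continuous_of_bounded (hcont k) (hbdd k)
    · exact fun x => min_le_left _ _
  have hmeas (k : ℕ) : MeasurableSet {x | q x ^ 2 ≤ (k : ℝ)} :=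
    (isClosed_le (hq.pow 2) continuous_const).measurableSet
  have hcover : AECover (μ : Measure E) atTop fun k : ℕ => {x | q x ^ 2 ≤ (k : ℝ)} :=
    { ae_eventually_mem := ae_of_all _ fun x => by
        obtain ⟨k, hk⟩ := exists_nat_ge (q x ^ 2)
        exact (eventually_ge_atTop k).mono fun j hj => hk.trans (Nat.cast_le.2 hj)
      measurableSet := hmeas }
  have heq (k : ℕ) : Set.EqOn (fun x => min (q x ^ 2) (k : ℝ)) (fun x => q x ^ 2)
      {x | q x ^ 2 ≤ (k : ℝ)} := fun x hx => min_eq_left hx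
  have hon (k : ℕ) : IntegrableOn (fun x => q x ^ 2) {x | q x ^ 2 ≤ (k : ℝ)} (μ : Measure E) :=
    (integrable_of_continuous_of_bounded (hcont k) (hbdd k)).integrableOn.congr_fun
      (heq k) (hmeas k)
  have hle (k : ℕ) : ∫ x in {x | q x ^ 2 ≤ (k : ℝ)}, q x ^ 2 ∂(μ : Measure E) ≤ C := by
    rw [← setIntegral_congr_fun (hmeas k) (heq k)]
    refine (setIntegral_le_integral
      (integrable_of_continuous_of_bounded (hcont k) (hbdd k)) ?_).trans (hmin k)
    exact ae_of_all _ fun x => le_min (sq_nonneg _) k.cast_nonneg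
  have hI : Integrable (fun x => q x ^ 2) (μ : Measure E) :=
    hcover.integrable_of_integral_bounded_of_nonneg_ae C hon
      (ae_of_all _ fun x => sq_nonneg _) (Eventually.of_forall hle)
  exact ⟨hI, le_of_tendsto (hcover.integral_tendsto_of_countably_generated hI)
    (Eventually.of_forall hle)⟩

theorem integrable_of_integrable_sq {μ : Measure E} [IsFiniteMeasure μ] (hq : Continuous q)
    (h : Integrable (fun x => q x ^ 2) μ) : Integrable q μ :=
  ((memLp_two_iff_integrable_sq hq.measurable.aestronglyMeasurable).2 h).integrable one_le_two

theorem abs_integral_sub_integral_clamp_le {μ : Measure E} [IsFiniteMeasure μ]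
    (hq : Continuous q) (h : Integrable (fun x => q x ^ 2) μ) (hC : ∫ x, q x ^ 2 ∂μ ≤ C)
    {R : ℝ} (hR : 0 < R) :
    |∫ x, q x ∂μ - ∫ x, max (-R) (min (q x) R) ∂μ| ≤ C / R := by
  have h1 : Integrable (fun x => max (-R) (min (q x) R)) μ :=
    integrable_of_continuous_of_bounded (by fun_prop) fun x => abs_clamp_le hR.le (q x)
  rw [← integral_sub (integrable_of_integrable_sq hq h) h1]
  calc _ ≤ ∫ x, |q x - max (-R) (min (q x) R)| ∂μ := abs_integral_le_integral_abs
    _ ≤ ∫ x, q x ^ 2 / R ∂μ :=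
      integral_mono ((integrable_of_integrable_sq hq h).sub h1).abs (h.div_const R)
        fun x => abs_sub_clamp_le hR (q x)
    _ = (∫ x, q x ^ 2 ∂μ) / R := integral_div _ _
    _ ≤ C / R := by gcongr

theorem MeasureTheory.FiniteMeasure.tendsto_integral_of_integral_sq_le (h : Tendsto ν U (𝓝 μ))
    (hq : Continuous q) (hInt : ∀ i, Integrable (fun x => q x ^ 2) (ν i : Measure E))
    (hC : ∀ i, ∫ x, q x ^ 2 ∂(ν i : Measure E) ≤ C) :
    Tendsto (fun i => ∫ x, q x ∂(ν i : Measure E)) U (𝓝 (∫ x, q x ∂(μ : Measure E))) := by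
  obtain ⟨hI, hIC⟩ := FiniteMeasure.integrable_sq_and_integral_sq_le h hq hInt hC
  have hC0 : 0 ≤ C := (integral_nonneg fun x => sq_nonneg (q x)).trans hIC
  rw [Metric.tendsto_nhds]
  intro ε hε
  let R := 3 * (C + 1) / ε
  have hR : 0 < R := by positivity
  have hCR : C / R < ε / 3 := by
    rw [div_lt_iff₀ hR]
    have : ε / 3 * R = C + 1 := by simp only [R]; field_simp
    linarith
  have hlim := FiniteMeasure.tendsto_integral_of_bounded h
    (f := fun x => max (-R) (min (q x) R)) (by fun_prop) fun x => abs_clamp_le hR.le (q x)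
  filter_upwards [Metric.tendsto_nhds.1 hlim (ε / 3) (by positivity)] with i hi
  have h1 := abs_le.1 (abs_integral_sub_integral_clamp_le hq (hInt i) (hC i) hR)
  have h2 := abs_le.1 (abs_integral_sub_integral_clamp_le hq hI hIC hR)
  rw [Real.dist_eq, abs_lt] at hi ⊢
  constructor <;> linarith

end Limits

section Moment

open Filter Topology
open scoped NNReal

variable {n : ℕ}

theorem integrable_eval_of_integrable_evalC {μ : Measure (Fin n → ℝ)}
    (h : ∀ Q : MvPolynomial (Fin n) ℂ, Integrable (fun x => evalC Q x) μ)
    (p : MvPolynomial (Fin n) ℝ) : Integrable (fun x => MvPolynomial.eval x p) μ := by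
  simpa [evalC_map_ofReal] using (h (.map Complex.ofRealHom p)).re

theorem integral_evalC_map_ofReal (μ : Measure (Fin n → ℝ)) (p : MvPolynomial (Fin n) ℝ) :
    ∫ x, evalC (.map Complex.ofRealHom p) x ∂μ = ((∫ x, MvPolynomial.eval x p ∂μ : ℝ) : ℂ) := by
  simp only [evalC_map_ofReal]
  exact integral_ofReal

/-- To represent a functional by a measure it is enough to integrate real polynomials. -/
theorem IsMomentC.of_real {Λ : MvPolynomial (Fin n) ℂ →ₗ[ℂ] ℂ} {μ : Measure (Fin n → ℝ)}
    (hInt : ∀ p : MvPolynomial (Fin n) ℝ, Integrable (fun x => MvPolynomial.eval x p) μ)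
    (hΛ : ∀ p : MvPolynomial (Fin n) ℝ, Λ (.map Complex.ofRealHom p) =
      ((∫ x, MvPolynomial.eval x p ∂μ : ℝ) : ℂ)) : IsMomentC Λ := by
  refine ⟨μ, fun Q => ?_, fun Q => ?_⟩
  · obtain ⟨p, q, rfl⟩ := Q.exists_re_im
    simp only [evalC_re_im]
    exact (hInt p).ofReal.add ((hInt q).ofReal.mul_const _)
  · obtain ⟨p, q, rfl⟩ := Q.exists_re_im
    simp only [evalC_re_im]
    rw [integral_add (hInt p).ofReal ((hInt q).ofReal.mul_const _), integral_mul_const,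
      integral_complex_ofReal, integral_complex_ofReal, map_add, ← MvPolynomial.smul_eq_C_mul,
      map_smul, hΛ, hΛ, smul_eq_mul, mul_comm]

/-- The set of moment functionals is sequentially closed for pointwise convergence. -/
theorem IsMomentC.of_tendsto {Λ : MvPolynomial (Fin n) ℂ →ₗ[ℂ] ℂ}
    {Λ' : ℕ → MvPolynomial (Fin n) ℂ →ₗ[ℂ] ℂ} (h : ∀ m, IsMomentC (Λ' m))
    (hlim : ∀ Q, Tendsto (fun m => Λ' m Q) atTop (𝓝 (Λ Q))) : IsMomentC Λ := by
  choose μ hInt hΛ' using h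
  have hfin (m : ℕ) : IsFiniteMeasure (μ m) := by
    have := hInt m 1
    simp only [evalC, map_one] at this
    exact ((integrable_const_iff_isFiniteMeasure one_ne_zero).1 this)
  have hreal (m : ℕ) := integrable_eval_of_integrable_evalC (hInt m)
  have hlimR (p : MvPolynomial (Fin n) ℝ) :
      Tendsto (fun m => ((∫ x, MvPolynomial.eval x p ∂μ m : ℝ) : ℂ)) atTop
        (𝓝 (Λ (.map Complex.ofRealHom p))) :=
    (hlim _).congr fun m => by rw [hΛ', integral_evalC_map_ofReal]
  have hbound (p : MvPolynomial (Fin n) ℝ) :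
      ∃ C : ℝ≥0, ∀ m, ∫ x, MvPolynomial.eval x p ∂μ m ≤ C := by
    obtain ⟨C, hC⟩ := (hlimR p).norm.bddAbove_range
    refine ⟨C.toNNReal, fun m => (le_abs_self _).trans ?_⟩
    have := hC ⟨m, rfl⟩
    simp only [Complex.norm_real, Real.norm_eq_abs] at this
    exact this.trans (Real.le_coe_toNNReal C)
  let ν : ℕ → FiniteMeasure (Fin n → ℝ) := fun m => ⟨μ m, hfin m⟩
  obtain ⟨C₁, hC₁⟩ := hbound 1
  obtain ⟨C₂, hC₂⟩ := hbound (∑ i, MvPolynomial.X i ^ 2)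
  have hmass (m : ℕ) : (ν m).mass ≤ C₁ := by
    have := hC₁ m
    simp only [map_one, integral_const, smul_eq_mul, mul_one] at this
    exact_mod_cast this
  have htight (m k : ℕ) : ν m (Metric.closedBall 0 ((k : ℝ) + 1))ᶜ ≤ C₂ / ((k : ℝ≥0) + 1) := by
    have hsub : (Metric.closedBall (0 : Fin n → ℝ) ((k : ℝ) + 1))ᶜ ⊆
        {x | (k : ℝ) + 1 ≤ MvPolynomial.eval x (∑ i, MvPolynomial.X i ^ 2)} := by
      intro x hx
      rw [Set.mem_compl_iff, mem_closedBall_zero_iff, pi_norm_le_iff_of_nonneg (by positivity)]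
        at hx
      push Not at hx
      obtain ⟨i, hi⟩ := hx
      simp only [Set.mem_ofPred_eq, map_sum, map_pow, MvPolynomial.eval_X]
      refine le_trans ?_
        (Finset.single_le_sum (fun j _ => sq_nonneg (x j)) (Finset.mem_univ i))
      rw [Real.norm_eq_abs] at hi
      rw [← sq_abs]
      nlinarith [k.cast_nonneg (α := ℝ)]
    have hmarkov := (mul_meas_ge_le_integral_of_nonneg (ae_of_all _ fun x => by
      simp only [map_sum, map_pow, MvPolynomial.eval_X, Pi.zero_apply]
      positivity) (hreal m (∑ i, MvPolynomial.X i ^ 2)) ((k : ℝ) + 1)).trans (hC₂ m)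
    rw [le_div_iff₀ (by positivity), ← NNReal.coe_le_coe]
    push_cast
    refine le_trans ?_ hmarkov
    rw [mul_comm]
    exact mul_le_mul_of_nonneg_left (measureReal_mono hsub) (by positivity)
  have hu : Tendsto (fun k : ℕ => C₂ / ((k : ℝ≥0) + 1)) atTop (𝓝 0) := by
    rw [← NNReal.tendsto_coe]
    push_cast
    exact tendsto_const_div_atTop_nhds_zero_nat (C₂ : ℝ) |>.comp (tendsto_add_atTop_nat 1)
      |>.congr fun k => by simp
  obtain ⟨μ', -, hμ'⟩ := (isCompact_setOfPred_finiteMeasure_mass_le_compl_isCompact_le C₁ hu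
    (fun k => isCompact_closedBall (0 : Fin n → ℝ) ((k : ℝ) + 1))
    (.inl inferInstance)).ultrafilter_le_nhds ((hyperfilter ℕ).map ν)
      (by
        rw [le_principal_iff]
        exact mem_map.2 (Filter.univ_mem' fun m => ⟨hmass m, htight m⟩))
  have hν : Tendsto ν (hyperfilter ℕ) (𝓝 μ') := hμ'
  have hsq (p : MvPolynomial (Fin n) ℝ) :
      (∀ m, Integrable (fun x => MvPolynomial.eval x p ^ 2) (ν m : Measure (Fin n → ℝ))) ∧
      ∃ C : ℝ≥0, ∀ m, ∫ x, MvPolynomial.eval x p ^ 2 ∂(ν m : Measure (Fin n → ℝ)) ≤ C := by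
    simp only [← map_pow]
    exact ⟨fun m => hreal m (p ^ 2), hbound (p ^ 2)⟩
  have hcont (p : MvPolynomial (Fin n) ℝ) : Continuous fun x => MvPolynomial.eval x p :=
    p.continuous_eval
  refine IsMomentC.of_real (μ := μ') (fun p => ?_) fun p => ?_
  · obtain ⟨h1, C, h2⟩ := hsq p
    exact integrable_of_integrable_sq (hcont p)
      (FiniteMeasure.integrable_sq_and_integral_sq_le hν (hcont p) h1 h2).1
  · obtain ⟨h1, C, h2⟩ := hsq p
    refine tendsto_nhds_unique ((hlimR p).mono_left Nat.hyperfilter_le_atTop) ?_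
    exact (Complex.continuous_ofReal.tendsto _).comp
      (FiniteMeasure.tendsto_integral_of_integral_sq_le hν (hcont p) h1 h2)

end Moment

section TypeC

variable {n : ℕ}

theorem IsPosDefC.vanishesOnC_span {Λ : MvPolynomial (Fin n) ℂ →ₗ[ℂ] ℂ} (hΛ : IsPosDefC Λ)
    {P : MvPolynomial (Fin n) ℂ} (hP : P ∈ nSetC Λ) : VanishesOnC Λ (Ideal.span {P}) := by
  intro F hF
  obtain ⟨g, rfl⟩ := Ideal.mem_span_singleton'.1 hF
  exact hΛ.map_mul_eq_zero hP g

theorem IsPosDefC.add_smul {Λ L : MvPolynomial (Fin n) ℂ →ₗ[ℂ] ℂ} (hΛ : IsPosDefC Λ)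
    (hL : IsPosDefC L) {c : ℝ} (hc : 0 ≤ c) : IsPosDefC (Λ + (c : ℂ) • L) := fun P =>
  add_nonneg (hΛ P) (mul_nonneg (Complex.zero_le_real.2 hc) (hL P))

theorem nSetC_add_smul {Λ L : MvPolynomial (Fin n) ℂ →ₗ[ℂ] ℂ} (hΛ : IsPosDefC Λ)
    (hL : IsPosDefC L) {c : ℝ} (hc : 0 < c) :
    nSetC (Λ + (c : ℂ) • L) = nSetC Λ ∩ nSetC L := by
  ext P
  change Λ (starC P * P) + (c : ℂ) * L (starC P * P) = 0 ↔
    Λ (starC P * P) = 0 ∧ L (starC P * P) = 0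
  rw [add_eq_zero_iff_of_nonneg (hΛ P) (mul_nonneg (Complex.zero_le_real.2 hc.le) (hL P)),
    mul_eq_zero, or_iff_right (Complex.ofReal_ne_zero.2 hc.ne')]

end TypeC

theorem stmt_0 (n : ℕ) (hn : 0 < n) (P Q : MvPolynomial (Fin n) ℂ) :
    IsTypeAC P ↔
      (∀ Λ : MvPolynomial (Fin n) ℂ →ₗ[ℂ] ℂ, IsPosDefC Λ →
        nSetC Λ = (vanishingIdealC (zSetC P) : Set (MvPolynomial (Fin n) ℂ)) →
        IsMomentC Λ) := by
  constructor
  · intro hA Λ hΛ hN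
    refine hA Λ hΛ (hΛ.vanishesOnC_span ?_)
    rw [hN]
    exact fun x hx => hx
  · intro hC Λ hΛ hvan
    have hP : P ∈ nSetC Λ := hvan _ (Ideal.mem_span_singleton'.2 ⟨starC P, rfl⟩)
    obtain ⟨L, hL, hLN⟩ := exists_isPosDefC_nSetC_eq (zSetC P)
    refine IsMomentC.of_tendsto (Λ' := fun m : ℕ => Λ + ((1 / ((m : ℝ) + 1) : ℝ) : ℂ) • L)
      (fun m => ?_) fun F => ?_
    · have hm : 0 < 1 / ((m : ℝ) + 1) := by positivity
      refine hC _ (hΛ.add_smul hL hm.le) ?_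
      rw [nSetC_add_smul hΛ hL hm, hLN]
      exact Set.inter_eq_right.2 (hΛ.vanishingIdealC_subset_nSetC hP)
    · have h := (Complex.continuous_ofReal.tendsto 0).comp
        (tendsto_one_div_add_atTop_nhds_zero_nat (𝕜 := ℝ))
      simpa using (h.mul_const (L F)).const_add (Λ F)
end

section
/- Let P, Q ∈ ℝ[X₁,…,Xₙ] be such that Z_P = Z_Q. Then P is of type A if and only if Q is of type A; that is, every positive definite linear functional on ℝ[X₁,…,Xₙ] vanishing on the ideal (P) is a moment functional if and only if every positive definite linear functional vanishing on the ideal (Q) is a moment functional. -/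
open MeasureTheory

noncomputable def evalR {n : ℕ} (P : MvPolynomial (Fin n) ℝ) (x : Fin n → ℝ) : ℝ :=
  MvPolynomial.eval x P

def IsPosDefR {n : ℕ} (Λ : MvPolynomial (Fin n) ℝ →ₗ[ℝ] ℝ) : Prop :=
  ∀ P : MvPolynomial (Fin n) ℝ, 0 ≤ Λ (P ^ 2)

def IsMomentR {n : ℕ} (Λ : MvPolynomial (Fin n) ℝ →ₗ[ℝ] ℝ) : Prop :=
  ∃ μ : Measure (Fin n → ℝ),
    (∀ Q : MvPolynomial (Fin n) ℝ, Integrable (fun x => evalR Q x) μ) ∧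
    (∀ Q : MvPolynomial (Fin n) ℝ, Λ Q = ∫ x, evalR Q x ∂μ)

noncomputable def vanishingIdealR {n : ℕ} (Z : Set (Fin n → ℝ)) :
    Ideal (MvPolynomial (Fin n) ℝ) where
  carrier := {P | ∀ x ∈ Z, evalR P x = 0}
  add_mem' := by
    intro a b ha hb x hx
    simp only [Set.mem_setOf_eq, evalR, map_add] at *
    rw [ha x hx, hb x hx, add_zero]
  zero_mem' := by
    intro x hx
    simp [evalR]
  smul_mem' := by
    intro c a ha x hx
    simp only [Set.mem_setOf_eq, evalR, smul_eq_mul, map_mul] at *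
    rw [ha x hx, mul_zero]

def zeroSetR {n : ℕ} (I : Ideal (MvPolynomial (Fin n) ℝ)) : Set (Fin n → ℝ) :=
  {x | ∀ P ∈ I, evalR P x = 0}

def zSetR {n : ℕ} (P : MvPolynomial (Fin n) ℝ) : Set (Fin n → ℝ) :=
  {x | evalR P x = 0}

def VanishesOnR {n : ℕ} (Λ : MvPolynomial (Fin n) ℝ →ₗ[ℝ] ℝ)
    (I : Ideal (MvPolynomial (Fin n) ℝ)) : Prop :=
  ∀ P ∈ I, Λ P = 0

def nSetR {n : ℕ} (Λ : MvPolynomial (Fin n) ℝ →ₗ[ℝ] ℝ) : Set (MvPolynomial (Fin n) ℝ) :=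
  {P | Λ (P ^ 2) = 0}

def IsTypeAR {n : ℕ} (P : MvPolynomial (Fin n) ℝ) : Prop :=
  ∀ Λ : MvPolynomial (Fin n) ℝ →ₗ[ℝ] ℝ,
    IsPosDefR Λ → VanishesOnR Λ (Ideal.span {P}) → IsMomentR Λ

section OrderedField

open Polynomial

variable {K : Type*} [Field K] [LinearOrder K]

/-- The intermediate value property for polynomials over an ordered field. -/
def PolynomialIVT (K : Type*) [Field K] [LinearOrder K] : Prop :=
  ∀ (p : K[X]) (a b : K), a < b → p.eval a * p.eval b < 0 → ∃ c, a < c ∧ c < b ∧ p.eval c = 0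

variable [IsStrictOrderedRing K]

lemma PolynomialIVT.eval_mul_eval_pos (hK : PolynomialIVT K) {p : K[X]} {a b : K} (hab : a ≤ b)
    (h : ∀ c, a ≤ c → c ≤ b → p.eval c ≠ 0) : 0 < p.eval a * p.eval b := by
  rcases hab.eq_or_lt with rfl | hlt
  · exact mul_self_pos.2 (h a le_rfl le_rfl)
  by_contra! hneg
  rcases hneg.lt_or_eq with hneg | hzero
  · obtain ⟨c, h1, h2, h3⟩ := hK p a b hlt hneg
    exact h c h1.le h2.le h3
  · rcases mul_eq_zero.1 hzero with h0 | h0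
    · exact h a le_rfl hab h0
    · exact h b hab le_rfl h0

lemma PolynomialIVT.exists_derivative_eq_zero_of_forall_ne (hK : PolynomialIVT K) {p : K[X]}
    (hp : p ≠ 0) {a b : K} (hab : a < b) (ha : p.eval a = 0) (hb : p.eval b = 0)
    (h : ∀ c, a < c → c < b → p.eval c ≠ 0) :
    ∃ c, a < c ∧ c < b ∧ (derivative p).eval c = 0 := by
  obtain ⟨u, hu, hua⟩ := exists_eq_pow_rootMultiplicity_mul_and_not_dvd p hp a
  have hu0 : u ≠ 0 := by rintro rfl; simp at hu; exact hp hu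
  obtain ⟨q, hq, hqb⟩ := exists_eq_pow_rootMultiplicity_mul_and_not_dvd u hu0 b
  set m := rootMultiplicity a p with hm
  set k := rootMultiplicity b u with hk
  have hub : u.eval b = 0 := by
    rw [hu] at hb
    simp only [eval_mul, eval_pow, eval_sub, eval_X, eval_C] at hb
    exact (mul_eq_zero.1 hb).resolve_left (pow_ne_zero _ (sub_ne_zero.2 hab.ne'))
  have hm0 : 0 < m := (rootMultiplicity_pos hp).2 ha
  have hk0 : 0 < k := (rootMultiplicity_pos hu0).2 hub
  rw [dvd_iff_isRoot, IsRoot] at hua hqb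
  have hqa : q.eval a ≠ 0 := by
    intro h0
    apply hua
    rw [hq]; simp [h0]
  have hqpos : 0 < q.eval a * q.eval b := by
    refine hK.eval_mul_eval_pos hab.le fun c h1 h2 h0 => ?_
    rcases h1.eq_or_lt with rfl | h1
    · exact hqa h0
    rcases h2.eq_or_lt with rfl | h2
    · exact hqb h0
    refine h c h1 h2 ?_
    rw [hu, hq]; simp [h0]
  obtain ⟨m, hm'⟩ : ∃ l, m = l + 1 := ⟨m - 1, by omega⟩
  obtain ⟨k, hk'⟩ : ∃ l, k = l + 1 := ⟨k - 1, by omega⟩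
  rw [hm'] at hu
  rw [hk'] at hq
  set w : K[X] := C ((m : K) + 1) * (X - C b) * q + C ((k : K) + 1) * (X - C a) * q +
    (X - C a) * (X - C b) * derivative q with hw
  have hder : derivative p = (X - C a) ^ m * (X - C b) ^ k * w := by
    rw [hu, hq, hw]
    simp only [derivative_mul, derivative_pow, derivative_sub, derivative_X, derivative_C,
      Nat.add_sub_cancel, Nat.cast_add, Nat.cast_one]
    simp only [map_add, map_natCast, map_one]
    ring
  have hwa : w.eval a = -((m + 1) * (b - a) * q.eval a) := by simp [hw]; ring
  have hwb : w.eval b = (k + 1) * (b - a) * q.eval b := by simp [hw]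
  obtain ⟨c, h1, h2, h3⟩ := hK w a b hab (by
    rw [hwa, hwb]
    have : 0 < ((m : K) + 1) * (b - a) * ((k + 1) * (b - a)) * (q.eval a * q.eval b) := by
      have := sub_pos.2 hab
      positivity
    linarith)
  exact ⟨c, h1, h2, by rw [hder]; simp [h3]⟩

/-- Rolle's theorem for polynomials over an ordered field with the intermediate value property. -/
lemma PolynomialIVT.exists_derivative_eq_zero (hK : PolynomialIVT K) {p : K[X]}
    {a b : K} (hab : a < b) (ha : p.eval a = 0) (hb : p.eval b = 0) :
    ∃ c, a < c ∧ c < b ∧ (derivative p).eval c = 0 := by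
  classical
  rcases eq_or_ne p 0 with rfl | hp
  · obtain ⟨c, h1, h2⟩ := exists_between hab
    exact ⟨c, h1, h2, by simp⟩
  set R := p.roots.toFinset.filter (fun c => a < c) with hR
  have hbR : b ∈ R := by simp [hR, hp, hb, hab]
  have hmin := R.min'_mem ⟨b, hbR⟩
  set d := R.min' ⟨b, hbR⟩ with hd
  have hd' : p.eval d = 0 ∧ a < d := by simpa [hR, hp] using hmin
  have hdb : d ≤ b := R.min'_le b hbR
  obtain ⟨c, h1, h2, h3⟩ := hK.exists_derivative_eq_zero_of_forall_ne hp hd'.2 ha hd'.1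
    fun c h1 h2 h0 => absurd (R.min'_le c (by simp [hR, hp, h0, h1])) (not_le.2 h2)
  exact ⟨c, h1, h2.trans_le hdb, h3⟩

/-- The mean value theorem for polynomials over an ordered field with the intermediate value
property. -/
lemma PolynomialIVT.exists_derivative_mul_eq (hK : PolynomialIVT K) (p : K[X])
    {a b : K} (hab : a < b) :
    ∃ c, a < c ∧ c < b ∧ (derivative p).eval c * (b - a) = p.eval b - p.eval a := by
  have hne : b - a ≠ 0 := sub_ne_zero.2 hab.ne'
  obtain ⟨c, h1, h2, h3⟩ := hK.exists_derivative_eq_zero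
    (p := C (b - a) * (p - C (p.eval a)) - C (p.eval b - p.eval a) * (X - C a)) hab
    (by simp) (by simp; ring)
  refine ⟨c, h1, h2, ?_⟩
  simp at h3
  linear_combination h3

/-- A polynomial with a root strictly between `a` and `b`, whose derivative has no such root,
takes values of opposite sign at `a` and `b`. -/
lemma PolynomialIVT.eval_mul_eval_neg (hK : PolynomialIVT K) {p : K[X]} {a b x : K}
    (hax : a < x) (hxb : x < b) (hx : p.eval x = 0)
    (h : ∀ c, a < c → c < b → (derivative p).eval c ≠ 0) : p.eval a * p.eval b < 0 := by
  obtain ⟨c, hc1, hc2, hc3⟩ := hK.exists_derivative_mul_eq p hax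
  obtain ⟨d, hd1, hd2, hd3⟩ := hK.exists_derivative_mul_eq p hxb
  have hpos := hK.eval_mul_eval_pos (p := derivative p) (hc2.trans hd1).le
    fun e h1 h2 => h e (hc1.trans_le h1) (h2.trans_lt hd2)
  rw [hx] at hc3 hd3
  have h1 : p.eval a = -((derivative p).eval c * (x - a)) := by linear_combination hc3
  have h2 : p.eval b = (derivative p).eval d * (b - x) := by linear_combination -hd3
  rw [h1, h2]
  have := mul_pos hpos (mul_pos (sub_pos.2 hax) (sub_pos.2 hxb))
  linarith

end OrderedField

section RootMatching

open Polynomial SignType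

variable {F K L : Type*} [Field F] [Field K] [LinearOrder K] [Field L] [LinearOrder L]

/-- `E` is the graph of an order isomorphism between the roots in `K` and the roots in `L` of the
nonzero polynomials in `D`, preserving the signs of all polynomials in `D`. -/
structure RootMatching (i : F →+* K) (j : F →+* L) (D : Set F[X]) (E : Set (K × L)) : Prop where
  finite : E.Finite
  lt_iff : ∀ u ∈ E, ∀ v ∈ E, u.1 < v.1 ↔ u.2 < v.2
  left : ∀ f ∈ D, f ≠ 0 → ∀ x, eval₂ i x f = 0 → ∃ y, (x, y) ∈ E
  right : ∀ f ∈ D, f ≠ 0 → ∀ y, eval₂ j y f = 0 → ∃ x, (x, y) ∈ E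
  sign_eq : ∀ u ∈ E, ∀ f ∈ D, sign (eval₂ i u.1 f) = sign (eval₂ j u.2 f)
  exists_root : ∀ u ∈ E, ∃ f ∈ D, f ≠ 0 ∧ eval₂ i u.1 f = 0

lemma sign_eq_sign_of_mul_pos [IsStrictOrderedRing K] {a b : K} (h : 0 < a * b) :
    sign a = sign b := by
  rcases mul_pos_iff.1 h with ⟨h1, h2⟩ | ⟨h1, h2⟩
  · rw [sign_pos h1, sign_pos h2]
  · rw [sign_neg h1, sign_neg h2]

lemma mul_neg_of_sign_eq [IsStrictOrderedRing K] [IsStrictOrderedRing L] {a b : K} {c d : L}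
    (ha : sign a = sign c) (hb : sign b = sign d) (h : a * b < 0) : c * d < 0 := by
  rw [← sign_eq_neg_one_iff, sign_mul] at h ⊢
  rw [← ha, ← hb, h]

namespace RootMatching

variable {i : F →+* K} {j : F →+* L} {D : Set F[X]} {E : Set (K × L)}

lemma symm (M : RootMatching i j D E) : RootMatching j i D (Prod.swap ⁻¹' E) where
  finite := M.finite.preimage Prod.swap_injective.injOn
  lt_iff u hu v hv := (M.lt_iff _ hu _ hv).symm
  left f hf h0 x hx := M.right f hf h0 x hx
  right f hf h0 x hx := M.left f hf h0 x hx
  sign_eq u hu f hf := (M.sign_eq _ hu f hf).symm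
  exists_root u hu := by
    obtain ⟨f, hf, h0, h⟩ := M.exists_root _ hu
    refine ⟨f, hf, h0, ?_⟩
    have := M.sign_eq _ hu f hf
    rw [h, sign_zero] at this
    exact sign_eq_zero_iff.1 this.symm

omit [Field K] [Field L] [LinearOrder L] in
lemma exists_gap (hE : E.Finite) {x : K} (hx : ∀ y, (x, y) ∉ E) (hlo : ∃ u ∈ E, u.1 < x)
    (hhi : ∃ v ∈ E, x < v.1) :
    ∃ u ∈ E, ∃ v ∈ E, u.1 < x ∧ x < v.1 ∧ ∀ w ∈ E, w.1 ≤ u.1 ∨ v.1 ≤ w.1 := by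
  obtain ⟨u, hu, humax⟩ := Set.exists_max_image {w ∈ E | w.1 < x} Prod.fst
    (hE.subset (Set.sep_subset _ _)) hlo
  obtain ⟨v, hv, hvmin⟩ := Set.exists_min_image {w ∈ E | x < w.1} Prod.fst
    (hE.subset (Set.sep_subset _ _)) hhi
  refine ⟨u, hu.1, v, hv.1, hu.2, hv.2, fun w hw => ?_⟩
  rcases lt_trichotomy w.1 x with h | h | h
  · exact .inl (humax w ⟨hw, h⟩)
  · exact absurd (h ▸ hw : (x, w.2) ∈ E) (hx _)
  · exact .inr (hvmin w ⟨hw, h⟩)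

lemma le_iff (M : RootMatching i j D E) {u v : K × L} (hu : u ∈ E) (hv : v ∈ E) :
    u.1 ≤ v.1 ↔ u.2 ≤ v.2 := by
  rw [← not_lt, ← not_lt, M.lt_iff v hv u hu]

lemma left_ne_zero_of_gap (M : RootMatching i j D E) {u v : K × L}
    (hgap : ∀ w ∈ E, w.1 ≤ u.1 ∨ v.1 ≤ w.1) {f : F[X]} (hf : f ∈ D) (hf0 : f ≠ 0)
    {c : K} (huc : u.1 < c) (hcv : c < v.1) : eval₂ i c f ≠ 0 := by
  intro h
  obtain ⟨s, hs⟩ := M.left f hf hf0 c h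
  rcases hgap _ hs with h | h
  · exact absurd huc (not_lt.2 h)
  · exact absurd hcv (not_lt.2 h)

lemma gap_right (M : RootMatching i j D E) {u v : K × L} (hu : u ∈ E) (hv : v ∈ E)
    (hgap : ∀ w ∈ E, w.1 ≤ u.1 ∨ v.1 ≤ w.1) : ∀ w ∈ E, w.2 ≤ u.2 ∨ v.2 ≤ w.2 := by
  intro w hw
  rw [← M.le_iff hw hu, ← M.le_iff hv hw]
  exact hgap w hw

variable [IsStrictOrderedRing K] [IsStrictOrderedRing L]

lemma sign_eq_of_gap (M : RootMatching i j D E) (hK : PolynomialIVT K) (hL : PolynomialIVT L)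
    (hD : ∀ f ∈ D, derivative f ∈ D) {u v : K × L} (hu : u ∈ E) (hv : v ∈ E)
    (hgap : ∀ w ∈ E, w.1 ≤ u.1 ∨ v.1 ≤ w.1) {x : K} {y : L} (hux : u.1 < x) (hxv : x < v.1)
    (huy : u.2 < y) (hyv : y < v.2) {f : F[X]} (hf : f ∈ D) :
    sign (eval₂ i x f) = sign (eval₂ j y f) := by
  rcases eq_or_ne f 0 with rfl | hf0
  · simp
  have hgap' := M.gap_right hu hv hgap
  have hleft : ∀ c, u.1 < c → c < v.1 → (f.map i).eval c ≠ 0 := fun c h1 h2 => by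
    rw [eval_map]; exact M.left_ne_zero_of_gap hgap hf hf0 h1 h2
  have hright : ∀ c, u.2 < c → c < v.2 → (f.map j).eval c ≠ 0 := fun c h1 h2 => by
    rw [eval_map]; exact M.symm.left_ne_zero_of_gap (u := u.swap) (v := v.swap)
      (fun w hw => hgap' _ hw) hf hf0 h1 h2
  have hsu := M.sign_eq u hu f hf
  have hsv := M.sign_eq v hv f hf
  simp only [← eval_map] at hsu hsv ⊢
  by_cases hu0 : (f.map i).eval u.1 = 0
  · by_cases hv0 : (f.map i).eval v.1 = 0
    · exfalso
      obtain ⟨c, h1, h2, h3⟩ := hK.exists_derivative_eq_zero (hux.trans hxv) hu0 hv0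
      rw [derivative_map, eval_map] at h3
      have : CharZero F := (i.charZero_iff i.injective).2 inferInstance
      refine M.left_ne_zero_of_gap hgap (hD f hf) (fun h0 => ?_) h1 h2 h3
      have hdeg := derivative_eq_zero.1 h0
      rw [natDegree_eq_zero] at hdeg
      obtain ⟨a, rfl⟩ := hdeg
      simp at hu0 hf0
      exact hf0 hu0
    · have hv0' : (f.map j).eval v.2 ≠ 0 := by
        rw [← sign_ne_zero, ← hsv, sign_ne_zero]; exact hv0
      rw [sign_eq_sign_of_mul_pos (hK.eval_mul_eval_pos hxv.le fun c h1 h2 => ?_), hsv,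
        ← sign_eq_sign_of_mul_pos (hL.eval_mul_eval_pos hyv.le fun c h1 h2 => ?_)]
      · rcases h2.eq_or_lt with rfl | h2
        exacts [hv0', hright c (huy.trans_le h1) h2]
      · rcases h2.eq_or_lt with rfl | h2
        exacts [hv0, hleft c (hux.trans_le h1) h2]
  · have hu0' : (f.map j).eval u.2 ≠ 0 := by
      rw [← sign_ne_zero, ← hsu, sign_ne_zero]; exact hu0
    rw [← sign_eq_sign_of_mul_pos (hK.eval_mul_eval_pos hux.le fun c h1 h2 => ?_), hsu,
      sign_eq_sign_of_mul_pos (hL.eval_mul_eval_pos huy.le fun c h1 h2 => ?_)]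
    · rcases h1.eq_or_lt with rfl | h1
      exacts [hu0', hright c h1 (h2.trans_lt hyv)]
    · rcases h1.eq_or_lt with rfl | h1
      exacts [hu0, hleft c h1 (h2.trans_lt hxv)]

lemma exists_sign_eq (M : RootMatching i j D E) (hK : PolynomialIVT K) (hL : PolynomialIVT L)
    (hD : ∀ f ∈ D, derivative f ∈ D) {x : K} (hlo : ∃ u ∈ E, u.1 < x) (hhi : ∃ v ∈ E, x < v.1) :
    ∃ y, ∀ f ∈ D, sign (eval₂ i x f) = sign (eval₂ j y f) := by
  by_cases hx : ∃ y, (x, y) ∈ E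
  · obtain ⟨y, hy⟩ := hx
    exact ⟨y, fun f hf => M.sign_eq _ hy f hf⟩
  · push Not at hx
    obtain ⟨u, hu, v, hv, hux, hxv, hgap⟩ := exists_gap M.finite hx hlo hhi
    obtain ⟨y, huy, hyv⟩ := exists_between ((M.lt_iff u hu v hv).1 (hux.trans hxv))
    exact ⟨y, fun f hf => M.sign_eq_of_gap hK hL hD hu hv hgap hux hxv huy hyv hf⟩

lemma eval₂_mod_eq {R : Type*} [CommRing R] (i : F →+* R) {p q : F[X]} {x : R}
    (h : eval₂ i x q = 0) : eval₂ i x (p % q) = eval₂ i x p := by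
  conv_rhs => rw [← EuclideanDomain.div_add_mod p q]
  rw [eval₂_add, eval₂_mul, h, zero_mul, zero_add]

omit [IsStrictOrderedRing K] [IsStrictOrderedRing L] in
lemma sign_eq_of_mod_mem (M : RootMatching i j D E) {p : F[X]}
    (hp : ∀ q ∈ D, q ≠ 0 → p % q ∈ D) {u : K × L} (hu : u ∈ E) :
    sign (eval₂ i u.1 p) = sign (eval₂ j u.2 p) := by
  obtain ⟨q, hq, hq0, hqu⟩ := M.exists_root u hu
  have hqu' : eval₂ j u.2 q = 0 := by
    have := M.sign_eq u hu q hq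
    rw [hqu, sign_zero] at this
    exact sign_eq_zero_iff.1 this.symm
  rw [← eval₂_mod_eq i hqu, ← eval₂_mod_eq j hqu']
  exact M.sign_eq u hu _ (hp q hq hq0)

/-- The pair `(x, y)` can be added to `E` without destroying its order-preserving character. -/
def Compatible (E : Set (K × L)) (x : K) (y : L) : Prop :=
  ∀ w ∈ E, (w.1 < x ↔ w.2 < y) ∧ (x < w.1 ↔ y < w.2)

lemma exists_compatible_root (M : RootMatching i j D E) (hK : PolynomialIVT K)
    (hL : PolynomialIVT L) {p : F[X]} (hpD : derivative p ∈ D) (hp0 : derivative p ≠ 0)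
    (hp : ∀ q ∈ D, q ≠ 0 → p % q ∈ D) {x : K} (hx : eval₂ i x p = 0)
    (hlo : ∃ u ∈ E, u.1 < x) (hhi : ∃ v ∈ E, x < v.1) :
    ∃ y, eval₂ j y p = 0 ∧ Compatible E x y := by
  by_cases hxE : ∃ y, (x, y) ∈ E
  · obtain ⟨y, hy⟩ := hxE
    refine ⟨y, ?_, fun w hw => ⟨M.lt_iff w hw _ hy, M.lt_iff _ hy w hw⟩⟩
    have := M.sign_eq_of_mod_mem hp hy
    rw [hx, sign_zero] at this
    exact sign_eq_zero_iff.1 this.symm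
  · push Not at hxE
    obtain ⟨u, hu, v, hv, hux, hxv, hgap⟩ := exists_gap M.finite hxE hlo hhi
    have huv := (M.lt_iff u hu v hv).1 (hux.trans hxv)
    have hneg : (p.map i).eval u.1 * (p.map i).eval v.1 < 0 := by
      refine hK.eval_mul_eval_neg hux hxv (by rwa [eval_map]) fun c h1 h2 => ?_
      rw [derivative_map, eval_map]
      exact M.left_ne_zero_of_gap hgap hpD hp0 h1 h2
    obtain ⟨y, huy, hyv, hy⟩ := hL (p.map j) u.2 v.2 huv (mul_neg_of_sign_eq
      (by simpa only [eval_map] using M.sign_eq_of_mod_mem hp hu)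
      (by simpa only [eval_map] using M.sign_eq_of_mod_mem hp hv) hneg)
    rw [eval_map] at hy
    refine ⟨y, hy, fun w hw => ?_⟩
    rcases hgap w hw with h | h
    · have h' := (M.le_iff hw hu).1 h
      exact ⟨iff_of_true (h.trans_lt hux) (h'.trans_lt huy),
        iff_of_false (h.trans_lt hux).not_gt (h'.trans_lt huy).not_gt⟩
    · have h' := (M.le_iff hv hw).1 h
      exact ⟨iff_of_false (hxv.trans_le h).not_gt (hyv.trans_le h').not_gt,
        iff_of_true (hxv.trans_le h) (hyv.trans_le h')⟩

omit [IsStrictOrderedRing L] in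
lemma lt_of_compatible (M : RootMatching i j D E) (hK : PolynomialIVT K)
    {p : F[X]} (hpD : derivative p ∈ D) (hp0 : derivative p ≠ 0) {x x' : K} {y y' : L}
    (hx : eval₂ i x p = 0) (hx' : eval₂ i x' p = 0) (hc : Compatible E x y)
    (hc' : Compatible E x' y') (h : x < x') : y < y' := by
  obtain ⟨c, h1, h2, h3⟩ := hK.exists_derivative_eq_zero (p := p.map i) h
    (by rwa [eval_map]) (by rwa [eval_map])
  rw [derivative_map, eval_map] at h3
  obtain ⟨d, hd⟩ := M.left _ hpD hp0 c h3
  exact ((hc _ hd).2.1 h1).trans ((hc' _ hd).1.1 h2)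

omit [Field K] [Field L] [IsStrictOrderedRing K] [IsStrictOrderedRing L] in
lemma Compatible.swap (h : Compatible E x y) : Compatible (Prod.swap ⁻¹' E) y x :=
  fun _ hw => ⟨(h _ hw).1.symm, (h _ hw).2.symm⟩

/-- A matching can be extended to one more polynomial `p` as soon as the derivative of `p` and the
remainders of `p` modulo the previous polynomials are already controlled. -/
lemma exists_insert (M : RootMatching i j D E) (hK : PolynomialIVT K) (hL : PolynomialIVT L)
    (hD : ∀ f ∈ D, derivative f ∈ D) {p : F[X]} (hpD : derivative p ∈ D)
    (hp0 : derivative p ≠ 0) (hp : ∀ q ∈ D, q ≠ 0 → p % q ∈ D)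
    (hbK : ∀ x, eval₂ i x p = 0 → (∃ u ∈ E, u.1 < x) ∧ ∃ v ∈ E, x < v.1)
    (hbL : ∀ y, eval₂ j y p = 0 → (∃ u ∈ E, u.2 < y) ∧ ∃ v ∈ E, y < v.2) :
    ∃ E', E ⊆ E' ∧ RootMatching i j (insert p D) E' := by
  classical
  have hpne : p ≠ 0 := by rintro rfl; simp at hp0
  have hfin : ({x : K | eval₂ i x p = 0} ×ˢ {y : L | eval₂ j y p = 0}).Finite := by
    have hK' : p.map i ≠ 0 := (Polynomial.map_ne_zero_iff i.injective).2 hpne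
    have hL' : p.map j ≠ 0 := (Polynomial.map_ne_zero_iff j.injective).2 hpne
    refine Set.Finite.prod ((p.map i).roots.toFinset.finite_toSet.subset fun x hx => ?_)
      ((p.map j).roots.toFinset.finite_toSet.subset fun x hx => ?_)
    · simpa [hK', eval_map] using hx
    · simpa [hL', eval_map] using hx
  have hcompat : ∀ u ∈ E, Compatible E u.1 u.2 := fun u hu w hw =>
    ⟨M.lt_iff w hw u hu, M.lt_iff u hu w hw⟩
  refine ⟨E ∪ {w | eval₂ i w.1 p = 0 ∧ eval₂ j w.2 p = 0 ∧ Compatible E w.1 w.2},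
    Set.subset_union_left, ?_, ?_, ?_, ?_, ?_, ?_⟩
  · exact M.finite.union (hfin.subset fun w hw => ⟨hw.1, hw.2.1⟩)
  · rintro u (hu | ⟨hu1, hu2, hu3⟩) v (hv | ⟨hv1, hv2, hv3⟩)
    · exact M.lt_iff u hu v hv
    · exact (hv3 u hu).1
    · exact (hu3 v hv).2
    · exact ⟨M.lt_of_compatible hK hpD hp0 hu1 hv1 hu3 hv3,
        M.symm.lt_of_compatible hL hpD hp0 hu2 hv2 hu3.swap hv3.swap⟩
  · rintro f (rfl | hf) hf0 x hx
    · obtain ⟨y, hy⟩ := M.exists_compatible_root hK hL hpD hp0 hp hx (hbK x hx).1 (hbK x hx).2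
      exact ⟨y, .inr ⟨hx, hy⟩⟩
    · obtain ⟨y, hy⟩ := M.left f hf hf0 x hx
      exact ⟨y, .inl hy⟩
  · rintro f (rfl | hf) hf0 y hy
    · obtain ⟨⟨u, hu, huy⟩, ⟨v, hv, hyv⟩⟩ := hbL y hy
      obtain ⟨x, hx, hc⟩ := M.symm.exists_compatible_root hL hK hpD hp0 hp hy
        ⟨u.swap, hu, huy⟩ ⟨v.swap, hv, hyv⟩
      exact ⟨x, .inr ⟨hx, hy, hc.swap⟩⟩
    · obtain ⟨x, hx⟩ := M.right f hf hf0 y hy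
      exact ⟨x, .inl hx⟩
  · rintro u (hu | ⟨hu1, hu2, hu3⟩) f (rfl | hf)
    · exact M.sign_eq_of_mod_mem hp hu
    · exact M.sign_eq u hu f hf
    · rw [hu1, hu2, sign_zero, sign_zero]
    · by_cases hE : ∃ y, (u.1, y) ∈ E
      · obtain ⟨y, hy⟩ := hE
        have : y = u.2 := le_antisymm (not_lt.1 fun h => lt_irrefl _ ((hu3 _ hy).2.2 h))
          (not_lt.1 fun h => lt_irrefl _ ((hu3 _ hy).1.2 h))
        subst this
        exact M.sign_eq _ hy f hf
      · push Not at hE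
        obtain ⟨a, ha, b, hb, h1, h2, hgap⟩ := exists_gap M.finite hE (hbK _ hu1).1 (hbK _ hu1).2
        exact M.sign_eq_of_gap hK hL hD ha hb hgap h1 h2 ((hu3 a ha).1.1 h1) ((hu3 b hb).2.1 h2) hf
  · rintro u (hu | ⟨hu1, hu2, hu3⟩)
    · obtain ⟨f, hf, h⟩ := M.exists_root u hu
      exact ⟨f, .inr hf, h⟩
    · exact ⟨p, .inl rfl, hpne, hu1⟩

end RootMatching

end RootMatching

section SignTransfer

open Polynomial SignType

variable {F : Type*} [Field F]

lemma Polynomial.mod_eq_zero_of_natDegree_eq_zero {p q : F[X]} (hq : q ≠ 0)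
    (h : q.natDegree = 0) : p % q = 0 := by
  rw [natDegree_eq_zero] at h
  obtain ⟨a, rfl⟩ := h
  have ha : a ≠ 0 := by rintro rfl; simp at hq
  exact EuclideanDomain.mod_eq_zero.2 ((isUnit_C.2 ha.isUnit).dvd)

lemma Polynomial.exists_finset_closed_aux (e : ℕ) (U V : Finset F[X]) (h0 : 0 ∈ U)
    (hder : ∀ f ∈ U, derivative f ∈ U ∨ derivative f ∈ V)
    (hmod : ∀ f ∈ U, ∀ g ∈ U, g ≠ 0 → f % g ∈ U ∨ f % g ∈ V) (hV : ∀ f ∈ V, f.natDegree < e) :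
    ∃ S : Finset F[X], U ⊆ S ∧ (∀ f ∈ S, derivative f ∈ S) ∧
      ∀ f ∈ S, ∀ g ∈ S, g ≠ 0 → f % g ∈ S := by
  classical
  induction e generalizing U V with
  | zero =>
    have : V = ∅ := Finset.eq_empty_of_forall_notMem fun f hf => absurd (hV f hf) (by simp)
    subst this
    exact ⟨U, subset_rfl, by simpa using hder, by simpa using hmod⟩
  | succ e ih =>
    set T := (U ∪ V).image derivative ∪
      ((U ∪ V) ×ˢ (U ∪ V).filter (· ≠ 0)).image (fun u => u.1 % u.2) with hT
    have hstep : ∀ f ∈ T, f ∉ U ∪ V → f.natDegree < e := by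
      intro f hf hfU
      have hf0 : f ≠ 0 := by rintro rfl; simp [h0] at hfU
      simp only [hT, Finset.mem_union, Finset.mem_image, Finset.mem_product, Finset.mem_filter,
        Prod.exists] at hf hfU
      rcases hf with ⟨g, hg, rfl⟩ | ⟨g, q, ⟨hg, hq, hq0⟩, rfl⟩
      · have hgV : g ∈ V := hg.resolve_left fun h => hfU (hder g h)
        have hlt : (derivative g).natDegree < g.natDegree := natDegree_derivative_lt fun h => by
          rw [natDegree_eq_zero] at h
          obtain ⟨a, rfl⟩ := h
          simp at hf0
        have := hV g hgV
        omega
      · have hqdeg : q.natDegree ≠ 0 := fun h => hf0 (mod_eq_zero_of_natDegree_eq_zero hq0 h)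
        have hlt : (g % q).natDegree < q.natDegree := natDegree_mod_lt g hqdeg
        by_cases hqV : q ∈ V
        · have := hV q hqV
          omega
        · have hqU := hq.resolve_right hqV
          have hgV : g ∈ V := hg.resolve_left fun h => hfU (hmod g h q hqU hq0)
          have hle : q.natDegree ≤ g.natDegree := by
            by_contra! hlt'
            apply hfU
            rw [(mod_eq_self_iff hq0).2 (degree_lt_degree hlt')]
            exact .inr hgV
          have := hV g hgV
          omega
    obtain ⟨S, hS, hS'⟩ := ih (U ∪ V) (T.filter (· ∉ U ∪ V)) (Finset.mem_union_left _ h0)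
      (fun f hf => by
        rw [Finset.mem_filter, or_iff_not_imp_left]
        exact fun h => ⟨Finset.mem_union_left _ (Finset.mem_image_of_mem _ hf), h⟩)
      (fun f hf g hg hg0 => by
        rw [Finset.mem_filter, or_iff_not_imp_left]
        refine fun h => ⟨Finset.mem_union_right _ (Finset.mem_image.2 ⟨(f, g), ?_, rfl⟩), h⟩
        exact Finset.mem_product.2 ⟨hf, Finset.mem_filter.2 ⟨hg, hg0⟩⟩)
      (fun f hf => hstep f (Finset.mem_filter.1 hf).1 (Finset.mem_filter.1 hf).2)
    exact ⟨S, Finset.union_subset_left hS, hS'⟩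

/-- Every finite set of polynomials over a field is contained in a finite set which is closed under
derivatives and remainders. -/
lemma Polynomial.exists_finset_closed (S : Finset F[X]) :
    ∃ S' : Finset F[X], S ⊆ S' ∧ (∀ f ∈ S', derivative f ∈ S') ∧
      ∀ f ∈ S', ∀ g ∈ S', g ≠ 0 → f % g ∈ S' := by
  classical
  set V := (insert 0 S).image derivative ∪ (insert 0 S ×ˢ insert 0 S).image (fun u => u.1 % u.2)
    with hV
  obtain ⟨S', h, h'⟩ := exists_finset_closed_aux (V.sup natDegree + 1) (insert 0 S) V (by simp)
    (fun f hf => .inr <| Finset.mem_union_left _ (Finset.mem_image_of_mem _ hf))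
    (fun f hf g hg _ => .inr <| Finset.mem_union_right _
      (Finset.mem_image.2 ⟨(f, g), Finset.mem_product.2 ⟨hf, hg⟩, rfl⟩))
    (fun f hf => Nat.lt_succ_of_le (Finset.le_sup hf))
  exact ⟨S', (Finset.subset_insert _ _).trans h, h'⟩

/-- An upper bound for the absolute values of the roots of `f` in ordered extension fields. -/
noncomputable def Polynomial.rootBound (f : F[X]) : F :=
  1 + ∑ k ∈ Finset.range f.natDegree, (1 + (f.coeff k / f.leadingCoeff) ^ 2)

variable {K L : Type*} [Field K] [LinearOrder K] [IsStrictOrderedRing K]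
  [Field L] [LinearOrder L] [IsStrictOrderedRing L]

lemma Polynomial.rootBound_pos (i : F →+* K) (f : F[X]) : 0 < i f.rootBound := by
  simp only [rootBound, map_add, map_one, map_sum, map_pow]
  positivity

lemma Polynomial.abs_lt_rootBound (i : F →+* K) {f : F[X]} (hf : f ≠ 0) {x : K}
    (hx : eval₂ i x f = 0) : |x| < i f.rootBound := by
  set c : ℕ → K := fun k => i (f.coeff k / f.leadingCoeff) with hc
  have hB : i f.rootBound = 1 + ∑ k ∈ Finset.range f.natDegree, (1 + c k ^ 2) := by
    simp [rootBound, hc]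
  have hlt : ∑ k ∈ Finset.range f.natDegree, |c k| < i f.rootBound := by
    rw [hB]
    have : ∑ k ∈ Finset.range f.natDegree, |c k| ≤
        ∑ k ∈ Finset.range f.natDegree, (1 + c k ^ 2) :=
      Finset.sum_le_sum fun k _ => by nlinarith [sq_nonneg (|c k| - 1), sq_abs (c k), abs_nonneg (c k)]
    linarith
  rcases lt_or_ge |x| 1 with h1 | h1
  · refine h1.trans_le ?_
    rw [hB]
    have : 0 ≤ ∑ k ∈ Finset.range f.natDegree, (1 + c k ^ 2) := by positivity
    linarith
  · refine lt_of_le_of_lt ?_ hlt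
    have hlc : i f.leadingCoeff ≠ 0 := by simpa using hf
    have hsum : x ^ f.natDegree = -∑ k ∈ Finset.range f.natDegree, c k * x ^ k := by
      rw [eval₂_eq_sum_range, Finset.sum_range_succ] at hx
      have : ∑ k ∈ Finset.range f.natDegree, c k * x ^ k =
          (i f.leadingCoeff)⁻¹ * ∑ k ∈ Finset.range f.natDegree, i (f.coeff k) * x ^ k := by
        rw [Finset.mul_sum]
        refine Finset.sum_congr rfl fun k _ => ?_
        simp only [hc, map_div₀]
        ring
      rw [this, eq_neg_of_add_eq_zero_left hx, coeff_natDegree]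
      field_simp
    obtain ⟨m, hm⟩ : ∃ m, f.natDegree = m + 1 := by
      refine Nat.exists_eq_succ_of_ne_zero fun h => ?_
      rw [h] at hsum
      simp at hsum
    rw [hm] at hsum ⊢
    have hle : |x| ^ (m + 1) ≤ (∑ k ∈ Finset.range (m + 1), |c k|) * |x| ^ m := by
      rw [← abs_pow, hsum, abs_neg, Finset.sum_mul]
      refine (Finset.abs_sum_le_sum_abs _ _).trans (Finset.sum_le_sum fun k hk => ?_)
      rw [abs_mul, abs_pow]
      exact mul_le_mul_of_nonneg_left
        (pow_le_pow_right₀ h1 (Nat.lt_succ_iff.1 (Finset.mem_range.1 hk))) (abs_nonneg _)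
    rw [pow_succ'] at hle
    exact le_of_mul_le_mul_right hle (by positivity)

/-- The constants, together with the two linear polynomials vanishing at `B` and `-B`. -/
def Polynomial.constantsAndBounds (B : F) : Set F[X] :=
  Set.range C ∪ {X - C B, X - C (-B)}

lemma RootMatching.of_constantsAndBounds {i : F →+* K} {j : F →+* L}
    (hij : ∀ a, sign (i a) = sign (j a)) (B : F) (hB : 0 < i B) :
    RootMatching i j (constantsAndBounds B) {(i B, j B), (i (-B), j (-B))} := by
  have hB' : 0 < j B := by rw [← sign_eq_one_iff, ← hij, sign_pos hB]
  have key : ∀ a : F, ∀ f ∈ Polynomial.constantsAndBounds B,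
      sign (eval₂ i (i a) f) = sign (eval₂ j (j a) f) := by
    intro a f _
    rw [eval₂_hom, eval₂_hom, hij]
  refine ⟨by simp, ?_, ?_, ?_, ?_, ?_⟩
  · have h1 : ¬ i B < -i B := by linarith
    have h2 : ¬ j B < -j B := by linarith
    have h3 : -i B < i B := by linarith
    have h4 : -j B < j B := by linarith
    rintro u (rfl | rfl) v (rfl | rfl) <;> simp [h1, h2, h3, h4]
  · rintro f (⟨a, rfl⟩ | rfl | rfl) hf0 x hx
    · simp at hx hf0
      exact absurd hx hf0
    · simp [sub_eq_zero] at hx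
      exact ⟨j B, by simp [hx]⟩
    · simp [add_eq_zero_iff_eq_neg] at hx
      exact ⟨j (-B), by simp [hx]⟩
  · rintro f (⟨a, rfl⟩ | rfl | rfl) hf0 x hx
    · simp at hx hf0
      exact absurd hx hf0
    · simp [sub_eq_zero] at hx
      exact ⟨i B, by simp [hx]⟩
    · simp [add_eq_zero_iff_eq_neg] at hx
      exact ⟨i (-B), by simp [hx]⟩
  · rintro u (rfl | rfl) f hf <;> exact key _ f hf
  · rintro u (rfl | rfl)
    · exact ⟨X - C B, by simp [Polynomial.constantsAndBounds], X_sub_C_ne_zero _, by simp⟩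
    · exact ⟨X - C (-B), by simp [Polynomial.constantsAndBounds], X_sub_C_ne_zero _, by simp⟩

lemma RootMatching.exists_of_closed {i : F →+* K} {j : F →+* L}
    (hij : ∀ a, sign (i a) = sign (j a)) (hK : PolynomialIVT K) (hL : PolynomialIVT L)
    {S : Finset F[X]} (hder : ∀ f ∈ S, derivative f ∈ S)
    (hmod : ∀ f ∈ S, ∀ g ∈ S, g ≠ 0 → f % g ∈ S) {B : F} (hB : 0 < i B)
    (hbK : ∀ f ∈ S, f ≠ 0 → ∀ x, eval₂ i x f = 0 → |x| < i B)
    (hbL : ∀ f ∈ S, f ≠ 0 → ∀ y, eval₂ j y f = 0 → |y| < j B) (d : ℕ) :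
    ∃ E : Set (K × L), {(i B, j B), (i (-B), j (-B))} ⊆ E ∧
      RootMatching i j (constantsAndBounds B ∪ {f | f ∈ S ∧ f.natDegree < d}) E := by
  classical
  have : CharZero F := (i.charZero_iff i.injective).2 inferInstance
  induction d with
  | zero => exact ⟨_, subset_rfl, by simpa using RootMatching.of_constantsAndBounds hij B hB⟩
  | succ d ih =>
    set D := Polynomial.constantsAndBounds B ∪ {f | f ∈ S ∧ f.natDegree < d} with hD
    have hC : ∀ a, C a ∈ D := fun a => .inl (.inl ⟨a, rfl⟩)
    have hconst : ∀ f : F[X], f.natDegree = 0 → f ∈ D := fun f hf => by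
      obtain ⟨a, rfl⟩ := natDegree_eq_zero.1 hf
      exact hC a
    have hderS : ∀ f ∈ S, f.natDegree ≤ d → derivative f ∈ D := fun f hf hfd => by
      by_cases h : f.natDegree = 0
      · rw [derivative_eq_zero.2 h]
        exact hconst _ natDegree_zero
      · exact .inr ⟨hder f hf, (natDegree_derivative_lt h).trans_le hfd⟩
    have hderD : ∀ f ∈ D, derivative f ∈ D := by
      rintro f ((⟨a, rfl⟩ | rfl | rfl) | ⟨hf, hfd⟩)
      · simpa using hC 0
      · simpa using hC 1
      · simpa using hC 1
      · exact hderS f hf hfd.le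
    have hmodS : ∀ p ∈ S, ∀ q ∈ S, q.natDegree ≤ d → q ≠ 0 → p % q ∈ D := fun p hp q hq hqd hq0 => by
      by_cases h : q.natDegree = 0
      · rw [mod_eq_zero_of_natDegree_eq_zero hq0 h]
        exact hconst _ natDegree_zero
      · exact .inr ⟨hmod p hp q hq hq0, (natDegree_mod_lt p h).trans_le hqd⟩
    have hmodD : ∀ p ∈ S, ∀ q ∈ D, q ≠ 0 → p % q ∈ D := by
      rintro p hp q ((⟨a, rfl⟩ | rfl | rfl) | ⟨hq, hqd⟩) hq0
      · rw [mod_eq_zero_of_natDegree_eq_zero hq0 (natDegree_C a)]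
        exact hconst _ natDegree_zero
      · rw [mod_X_sub_C_eq_C_eval]
        exact hC _
      · rw [mod_X_sub_C_eq_C_eval]
        exact hC _
      · exact hmodS p hp q hq hqd.le hq0
    suffices ∀ W : Finset F[X], (∀ f ∈ W, f ∈ S ∧ f.natDegree = d) →
        ∃ E : Set (K × L), {(i B, j B), (i (-B), j (-B))} ⊆ E ∧ RootMatching i j (D ∪ W) E by
      obtain ⟨E, hE, M⟩ := this (S.filter (·.natDegree = d)) fun f hf => by simpa using hf
      refine ⟨E, hE, ?_⟩
      convert M using 1
      ext f
      simp only [hD, Set.mem_union, Set.mem_ofPred_eq, Finset.coe_filter, Nat.lt_succ_iff_lt_or_eq]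
      tauto
    intro W
    induction W using Finset.induction_on with
    | empty => simpa using ih
    | insert p W _ ihW =>
      intro hW
      obtain ⟨E, hE, M⟩ := ihW fun f hf => hW f (Finset.mem_insert_of_mem hf)
      obtain ⟨hpS, hpd⟩ := hW p (Finset.mem_insert_self _ _)
      have hrw : D ∪ (insert p W : Finset F[X]) = insert p (D ∪ W) := by
        rw [Finset.coe_insert, Set.union_insert]
      rw [hrw]
      by_cases hp : p.natDegree = 0
      · rw [Set.insert_eq_of_mem (show p ∈ D ∪ (W : Set F[X]) from Or.inl (hconst p hp))]
        exact ⟨E, hE, M⟩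
      have hp0 : p ≠ 0 := by rintro rfl; simp at hp
      have hBE : (i B, j B) ∈ E := hE (by simp)
      have hBE' : (i (-B), j (-B)) ∈ E := hE (by simp)
      obtain ⟨E', hEE', M'⟩ := M.exists_insert hK hL (p := p)
        (fun f hf => Or.inl <| hf.elim (hderD f) fun h =>
          have := hW f (Finset.mem_insert_of_mem h)
          hderS f this.1 this.2.le)
        (Or.inl (hderS p hpS hpd.le)) (fun h => hp (derivative_eq_zero.1 h))
        (fun q hq hq0 => Or.inl <| hq.elim (fun h => hmodD p hpS q h hq0) fun h =>
          have := hW q (Finset.mem_insert_of_mem h)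
          hmodS p hpS q this.1 this.2.le hq0)
        (fun x hx => by
          have := abs_lt.1 (hbK p hpS hp0 x hx)
          exact ⟨⟨_, hBE', by simpa using this.1⟩, ⟨_, hBE, this.2⟩⟩)
        (fun x hx => by
          have := abs_lt.1 (hbL p hpS hp0 x hx)
          exact ⟨⟨_, hBE', by simpa using this.1⟩, ⟨_, hBE, this.2⟩⟩)
      exact ⟨E', hE.trans hEE', M'⟩

/-- Sign conditions on finitely many polynomials over a common subfield are simultaneously
realizable in any two ordered extension fields with the intermediate value property. -/
theorem exists_sign_eval₂_eq {i : F →+* K} {j : F →+* L}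
    (hij : ∀ a, sign (i a) = sign (j a)) (hK : PolynomialIVT K) (hL : PolynomialIVT L)
    (S : Finset F[X]) (t : K) : ∃ s : L, ∀ f ∈ S, sign (eval₂ i t f) = sign (eval₂ j s f) := by
  obtain ⟨S', hSS', hder, hmod⟩ := exists_finset_closed S
  set B : F := 1 + ∑ f ∈ S', f.rootBound with hB
  have hle : ∀ f ∈ S', i f.rootBound ≤ i B ∧ j f.rootBound ≤ j B := by
    intro f hf
    have h1 := Finset.single_le_sum (f := fun f => i f.rootBound)
      (fun f _ => (rootBound_pos i f).le) hf
    have h2 := Finset.single_le_sum (f := fun f => j f.rootBound)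
      (fun f _ => (rootBound_pos j f).le) hf
    simp only [hB, map_add, map_one, map_sum]
    constructor <;> linarith
  have hB0 : 0 < i B := by
    simp only [hB, map_add, map_one, map_sum]
    have := Finset.sum_nonneg (f := fun f => i f.rootBound) (s := S')
      (fun f _ => (rootBound_pos i f).le)
    linarith
  have hbK : ∀ f ∈ S', f ≠ 0 → ∀ x, eval₂ i x f = 0 → |x| < i B :=
    fun f hf hf0 x hx => (abs_lt_rootBound i hf0 hx).trans_le (hle f hf).1
  have hbL : ∀ f ∈ S', f ≠ 0 → ∀ x, eval₂ j x f = 0 → |x| < j B :=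
    fun f hf hf0 x hx => (abs_lt_rootBound j hf0 hx).trans_le (hle f hf).2
  obtain ⟨E, hE, M⟩ := RootMatching.exists_of_closed hij hK hL hder hmod hB0 hbK hbL
    (S'.sup natDegree + 1)
  rcases le_or_gt (i B) t with h1 | h1
  · refine ⟨j B, fun f hf => ?_⟩
    rcases eq_or_ne f 0 with rfl | hf0
    · simp
    rw [eval₂_hom, ← hij, ← eval₂_hom, ← eval_map, ← eval_map]
    refine (sign_eq_sign_of_mul_pos (hK.eval_mul_eval_pos h1 fun c hc _ h0 => ?_)).symm
    rw [eval_map] at h0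
    exact absurd (hc.trans (le_abs_self c)) (not_le.2 (hbK f (hSS' hf) hf0 c h0))
  rcases le_or_gt t (i (-B)) with h2 | h2
  · refine ⟨j (-B), fun f hf => ?_⟩
    rcases eq_or_ne f 0 with rfl | hf0
    · simp
    rw [eval₂_hom, ← hij, ← eval₂_hom, ← eval_map, ← eval_map]
    refine sign_eq_sign_of_mul_pos (hK.eval_mul_eval_pos h2 fun c _ hc h0 => ?_)
    rw [eval_map] at h0
    have := hbK f (hSS' hf) hf0 c h0
    rw [map_neg] at hc
    linarith [neg_le_abs c]
  have hDS : ∀ f ∈ S', f ∈ Polynomial.constantsAndBounds B ∪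
      {f | f ∈ S' ∧ f.natDegree < S'.sup natDegree + 1} :=
    fun f hf => .inr ⟨hf, Nat.lt_succ_of_le (Finset.le_sup hf)⟩
  have hC : ∀ a, C a ∈ Polynomial.constantsAndBounds B ∪
      {f | f ∈ S' ∧ f.natDegree < S'.sup natDegree + 1} := fun a => .inl (.inl ⟨a, rfl⟩)
  obtain ⟨s, hs⟩ := M.exists_sign_eq hK hL (x := t) (by
      rintro f ((⟨a, rfl⟩ | rfl | rfl) | ⟨hf, -⟩)
      · simpa using hC 0
      · simpa using hC 1
      · simpa using hC 1
      · exact hDS _ (hder f hf))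
    ⟨_, hE (Set.mem_insert_of_mem _ rfl), h2⟩ ⟨_, hE (Set.mem_insert _ _), h1⟩
  exact ⟨s, fun f hf => hs f (hDS f (hSS' hf))⟩

end SignTransfer

section OrderedExtension

open Polynomial

/-- A set of elements of a field which is the nonnegative part of some field ordering of
a subfield, without requiring comparability. -/
structure FieldPrecone {C : Type*} [Field C] (T : Set C) : Prop where
  one_mem : 1 ∈ T
  add_mem : ∀ x ∈ T, ∀ y ∈ T, x + y ∈ T
  mul_mem : ∀ x ∈ T, ∀ y ∈ T, x * y ∈ T
  inv_mem : ∀ x ∈ T, x⁻¹ ∈ T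
  sq_sub_mem : ∀ x ∈ T, ∀ y ∈ T, (x - y) ^ 2 ∈ T
  neg_one_notMem : -1 ∉ T

namespace FieldPrecone

variable {C : Type*} [Field C] {T : Set C}

lemma of_subset_subfield {M : Subfield C} (hM : T ⊆ M) (hadd : ∀ x ∈ T, ∀ y ∈ T, x + y ∈ T)
    (hmul : ∀ x ∈ T, ∀ y ∈ T, x * y ∈ T) (hsq : ∀ x ∈ M, x ^ 2 ∈ T) (hneg : -1 ∉ T) :
    FieldPrecone T where
  one_mem := by simpa using hsq 1 M.one_mem
  add_mem := hadd
  mul_mem := hmul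
  inv_mem x hx := by
    rcases eq_or_ne x 0 with rfl | hx0
    · simpa using hx
    · have := hmul x hx _ (hsq x⁻¹ (M.inv_mem (hM hx)))
      rwa [pow_two, mul_inv_cancel_left₀ hx0] at this
  sq_sub_mem x hx y hy := hsq _ (sub_mem (hM hx) (hM hy))
  neg_one_notMem := hneg

variable (h : FieldPrecone T)

include h

lemma zero_mem : 0 ∈ T := by simpa using h.sq_sub_mem 1 h.one_mem 1 h.one_mem

lemma two_ne_zero : (2 : C) ≠ 0 := fun h2 =>
  h.neg_one_notMem <| by
    have : (-1 : C) = 1 := by linear_combination -h2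
    rw [this]
    exact h.one_mem

lemma eq_zero_of_neg_mem {x : C} (hx : x ∈ T) (hx' : -x ∈ T) : x = 0 := by
  by_contra hx0
  apply h.neg_one_notMem
  have := h.mul_mem _ hx' _ (h.inv_mem _ hx)
  rwa [neg_mul, mul_inv_cancel₀ hx0] at this

omit h in
/-- The subfield generated by a precone. -/
def subfield (h : FieldPrecone T) : Subfield C where
  carrier := {z | ∃ x ∈ T, ∃ y ∈ T, z = x - y}
  zero_mem' := ⟨0, h.zero_mem, 0, h.zero_mem, by simp⟩
  one_mem' := ⟨1, h.one_mem, 0, h.zero_mem, by simp⟩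
  neg_mem' := by
    rintro _ ⟨x, hx, y, hy, rfl⟩
    exact ⟨y, hy, x, hx, by ring⟩
  add_mem' := by
    rintro _ _ ⟨x, hx, y, hy, rfl⟩ ⟨z, hz, w, hw, rfl⟩
    exact ⟨x + z, h.add_mem _ hx _ hz, y + w, h.add_mem _ hy _ hw, by ring⟩
  mul_mem' := by
    rintro _ _ ⟨x, hx, y, hy, rfl⟩ ⟨z, hz, w, hw, rfl⟩
    exact ⟨x * z + y * w, h.add_mem _ (h.mul_mem _ hx _ hz) _ (h.mul_mem _ hy _ hw),
      x * w + y * z, h.add_mem _ (h.mul_mem _ hx _ hw) _ (h.mul_mem _ hy _ hz), by ring⟩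
  inv_mem' := by
    rintro _ ⟨x, hx, y, hy, rfl⟩
    have hs := h.inv_mem _ (h.sq_sub_mem x hx y hy)
    refine ⟨x * ((x - y) ^ 2)⁻¹, h.mul_mem _ hx _ hs, y * ((x - y) ^ 2)⁻¹, h.mul_mem _ hy _ hs, ?_⟩
    rcases eq_or_ne (x - y) 0 with h0 | h0
    · rw [h0]; simp
    · field_simp

lemma subset_subfield : T ⊆ h.subfield := fun x hx => ⟨x, hx, 0, h.zero_mem, by simp⟩

lemma sq_mem {x : C} (hx : x ∈ h.subfield) : x ^ 2 ∈ T := by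
  obtain ⟨y, hy, z, hz, rfl⟩ := hx
  exact h.sq_sub_mem y hy z hz

omit h in
lemma exists_maximal (h : FieldPrecone T) :
    ∃ T', T ⊆ T' ∧ Maximal FieldPrecone T' := by
  refine zorn_subset_nonempty {T : Set C | FieldPrecone T} (fun c hc hchain hne => ?_) T h
  obtain ⟨U, hU⟩ := hne
  have key : ∀ x ∈ ⋃₀ c, ∀ y ∈ ⋃₀ c, ∃ t ∈ c, x ∈ t ∧ y ∈ t := by
    rintro x ⟨s, hs, hxs⟩ y ⟨t, ht, hyt⟩
    rcases hchain.total hs ht with hst | hst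
    · exact ⟨t, ht, hst hxs, hyt⟩
    · exact ⟨s, hs, hxs, hst hyt⟩
  refine ⟨⋃₀ c, ⟨⟨U, hU, (hc hU).one_mem⟩, fun x hx y hy => ?_, fun x hx y hy => ?_, ?_,
    fun x hx y hy => ?_, ?_⟩, fun s hs => Set.subset_sUnion_of_mem hs⟩
  · obtain ⟨t, ht, hxt, hyt⟩ := key x hx y hy
    exact ⟨t, ht, (hc ht).add_mem x hxt y hyt⟩
  · obtain ⟨t, ht, hxt, hyt⟩ := key x hx y hy
    exact ⟨t, ht, (hc ht).mul_mem x hxt y hyt⟩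
  · rintro x ⟨s, hs, hxs⟩
    exact ⟨s, hs, (hc hs).inv_mem x hxs⟩
  · obtain ⟨t, ht, hxt, hyt⟩ := key x hx y hy
    exact ⟨t, ht, (hc ht).sq_sub_mem x hxt y hyt⟩
  · rintro ⟨s, hs, hxs⟩
    exact (hc hs).neg_one_notMem hxs

lemma mem_or_neg_mem (hmax : Maximal FieldPrecone T) {x : C} (hx : x ∈ h.subfield) :
    x ∈ T ∨ -x ∈ T := by
  rw [or_iff_not_imp_left]
  intro hxT
  have key : FieldPrecone {z | ∃ t ∈ T, ∃ s ∈ T, z = t - x * s} := by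
    refine of_subset_subfield (M := h.subfield) ?_ ?_ ?_
      (fun z hz => ⟨z ^ 2, h.sq_mem hz, 0, h.zero_mem, by simp⟩) ?_
    · rintro _ ⟨t, ht, s, hs, rfl⟩
      exact sub_mem (h.subset_subfield ht) (h.subfield.mul_mem hx (h.subset_subfield hs))
    · rintro _ ⟨t, ht, s, hs, rfl⟩ _ ⟨t', ht', s', hs', rfl⟩
      exact ⟨t + t', h.add_mem _ ht _ ht', s + s', h.add_mem _ hs _ hs', by ring⟩
    · rintro _ ⟨t, ht, s, hs, rfl⟩ _ ⟨t', ht', s', hs', rfl⟩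
      exact ⟨t * t' + x ^ 2 * (s * s'), h.add_mem _ (h.mul_mem _ ht _ ht') _
        (h.mul_mem _ (h.sq_mem hx) _ (h.mul_mem _ hs _ hs')), t * s' + s * t',
        h.add_mem _ (h.mul_mem _ ht _ hs') _ (h.mul_mem _ hs _ ht'), by ring⟩
    · rintro ⟨t, ht, s, hs, hts⟩
      have hs0 : s ≠ 0 := by
        rintro rfl
        exact h.neg_one_notMem (by rw [hts]; simpa using ht)
      apply hxT
      have : x = (1 + t) * s⁻¹ := by
        rw [eq_mul_inv_iff_mul_eq₀ hs0]
        linear_combination hts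
      rw [this]
      exact h.mul_mem _ (h.add_mem _ h.one_mem _ ht) _ (h.inv_mem _ hs)
  exact hmax.2 key (fun t ht => ⟨t, ht, 0, h.zero_mem, by simp⟩)
    ⟨0, h.zero_mem, 1, h.one_mem, by simp⟩

lemma exists_linearOrder (hmax : Maximal FieldPrecone T) :
    ∃ (_ : LinearOrder h.subfield) (_ : IsStrictOrderedRing h.subfield),
      ∀ x : h.subfield, 0 ≤ x ↔ (x : C) ∈ T := by
  classical
  let P : RingCone h.subfield :=
    { carrier := {x | (x : C) ∈ T}
      zero_mem' := h.zero_mem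
      one_mem' := h.one_mem
      add_mem' := fun hx hy => h.add_mem _ hx _ hy
      mul_mem' := fun hx hy => h.mul_mem _ hx _ hy
      eq_zero_of_mem_of_neg_mem' := fun hx hx' => Subtype.ext (h.eq_zero_of_neg_mem hx hx') }
  have : HasMemOrNegMem P := ⟨fun x => h.mem_or_neg_mem hmax x.2⟩
  let _ : LinearOrder h.subfield := LinearOrder.mkOfAddGroupCone P
  have : IsOrderedRing h.subfield := IsOrderedRing.mkOfCone P
  refine ⟨inferInstance, IsOrderedRing.toIsStrictOrderedRing _, fun x => ?_⟩
  change x - 0 ∈ P ↔ _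
  rw [sub_zero]
  rfl

end FieldPrecone

section WeightedSquares

variable {E : Type*} [Field E] [LinearOrder E] [IsStrictOrderedRing E]

variable (E) in
/-- The semiring of sums of squares of polynomials with nonnegative weights. -/
noncomputable def weightedSumSq : Subsemiring E[X] :=
  Submonoid.subsemiringClosure
    { carrier := {q | ∃ t : E, 0 ≤ t ∧ ∃ f : E[X], q = C t * f ^ 2}
      one_mem' := ⟨1, zero_le_one, 1, by simp⟩
      mul_mem' := by
        rintro _ _ ⟨t, ht, f, rfl⟩ ⟨s, hs, g, rfl⟩
        exact ⟨t * s, mul_nonneg ht hs, f * g, by rw [C_mul]; ring⟩ }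

lemma C_mul_sq_mem_weightedSumSq {t : E} (ht : 0 ≤ t) (f : E[X]) :
    C t * f ^ 2 ∈ weightedSumSq E :=
  (Submonoid.subsemiringClosure_mem _).2 (AddSubmonoid.subset_closure ⟨t, ht, f, rfl⟩)

lemma weightedSumSq_induction {motive : E[X] → Prop} {s : E[X]} (hs : s ∈ weightedSumSq E)
    (zero : motive 0) (add : ∀ f g, motive f → motive g → motive (f + g))
    (mul_sq : ∀ t : E, 0 ≤ t → ∀ f : E[X], motive (C t * f ^ 2)) : motive s := by
  refine AddSubmonoid.closure_induction (motive := fun s _ => motive s) ?_ zero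
    (fun f g _ _ => add f g) ((Submonoid.subsemiringClosure_mem _).1 hs)
  rintro _ ⟨t, ht, f, rfl⟩
  exact mul_sq t ht f

lemma eval_nonneg_of_mem_weightedSumSq {s : E[X]} (hs : s ∈ weightedSumSq E) (a : E) :
    0 ≤ s.eval a := by
  refine weightedSumSq_induction (motive := fun s => 0 ≤ s.eval a) hs (by simp)
    (fun f g hf hg => ?_) fun t ht f => ?_
  · rw [eval_add]
    exact add_nonneg hf hg
  · simp only [eval_mul, eval_C, eval_pow]
    positivity

lemma exists_mod_of_mem_weightedSumSq {s p : E[X]} (hs : s ∈ weightedSumSq E)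
    (hp : p.natDegree ≠ 0) :
    ∃ s' ∈ weightedSumSq E, s'.natDegree ≤ 2 * (p.natDegree - 1) ∧ p ∣ s - s' := by
  refine weightedSumSq_induction (motive := fun s => ∃ s' ∈ weightedSumSq E,
    s'.natDegree ≤ 2 * (p.natDegree - 1) ∧ p ∣ s - s') hs
    ⟨0, Subsemiring.zero_mem _, by simp, by simp⟩ ?_ fun t ht f => ?_
  · rintro f g ⟨f', hf', hf1, hf2⟩ ⟨g', hg', hg1, hg2⟩
    refine ⟨f' + g', Subsemiring.add_mem _ hf' hg', natDegree_add_le_of_degree_le hf1 hg1, ?_⟩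
    rw [add_sub_add_comm]
    exact dvd_add hf2 hg2
  · refine ⟨C t * (f % p) ^ 2, C_mul_sq_mem_weightedSumSq ht _, ?_, ?_⟩
    · refine (natDegree_C_mul_le _ _).trans (natDegree_pow_le.trans ?_)
      have := natDegree_mod_lt f hp
      omega
    · have h1 : f - f % p = p * (f / p) := by
        linear_combination -EuclideanDomain.div_add_mod f p
      exact ⟨C t * (f / p) * (f + f % p), by linear_combination (C t * (f + f % p)) * h1⟩

lemma one_add_ne_mul_of_mem_weightedSumSq {a b : E} (p s g : E[X]) (hs : s ∈ weightedSumSq E)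
    (hab : p.eval a * p.eval b < 0) : 1 + s ≠ p * g := by
  induction hd : p.natDegree using Nat.strong_induction_on generalizing p s g with
  | _ d ih =>
    intro h
    have hd0 : p.natDegree ≠ 0 := fun h0 => by
      obtain ⟨c, rfl⟩ := natDegree_eq_zero.1 h0
      simp only [eval_C] at hab
      exact absurd hab (not_lt.2 (mul_self_nonneg c))
    obtain ⟨s', hs', hdeg, k, hk⟩ := exists_mod_of_mem_weightedSumSq hs hd0
    have heq : 1 + s' = (g - k) * p := by linear_combination h - hk
    have hpos : ∀ x, 0 < (g - k).eval x * p.eval x := fun x => by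
      rw [← eval_mul, ← heq, eval_add, eval_one]
      linarith [eval_nonneg_of_mem_weightedSumSq hs' x]
    have hneg : (g - k).eval a * (g - k).eval b < 0 := by
      have := mul_pos (hpos a) (hpos b)
      by_contra! hcon
      nlinarith [mul_nonneg hcon (neg_nonneg.2 hab.le)]
    have hgk : g - k ≠ 0 := by
      rintro h0
      simp [h0] at hneg
    have hp0 : p ≠ 0 := by rintro rfl; simp at hd0
    have hdeg' : (g - k).natDegree + p.natDegree ≤ 2 * (p.natDegree - 1) := by
      rw [← natDegree_mul hgk hp0, ← heq]
      exact natDegree_add_le_of_degree_le (by simp) hdeg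
    exact ih _ (by omega) (g - k) s' p hs' hneg rfl heq

end WeightedSquares

namespace FieldPrecone

variable {Ω : Type*} [Field Ω] {T : Set Ω}

lemma mem_subfield_of_aeval_eq_zero (h : FieldPrecone T) (hmax : Maximal FieldPrecone T)
    [LinearOrder h.subfield] [IsStrictOrderedRing h.subfield]
    (hle : ∀ x : h.subfield, 0 ≤ x ↔ (x : Ω) ∈ T) {p : h.subfield[X]} (hirr : Irreducible p)
    {a b : h.subfield} (hneg : p.eval a * p.eval b < 0) {c : Ω} (hc : aeval c p = 0) :
    c ∈ h.subfield := by
  have halg : IsAlgebraic h.subfield c := ⟨p, hirr.ne_zero, hc⟩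
  set M : Subfield Ω := (IntermediateField.adjoin h.subfield {c}).toSubfield with hM
  have hmem : ∀ x, x ∈ M ↔ ∃ f : h.subfield[X], aeval c f = x := fun x => by
    change x ∈ (IntermediateField.adjoin h.subfield {c}).toSubalgebra ↔ _
    rw [IntermediateField.adjoin_simple_toSubalgebra_of_isAlgebraic halg,
      Algebra.adjoin_singleton_eq_range_aeval]
    exact Iff.rfl
  have hsq : ∀ x ∈ M, ∃ s ∈ weightedSumSq h.subfield, aeval c s = x ^ 2 := by
    intro x hx
    obtain ⟨f, rfl⟩ := (hmem x).1 hx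
    refine ⟨C 1 * f ^ 2, C_mul_sq_mem_weightedSumSq zero_le_one f, ?_⟩
    rw [C_1, one_mul, map_pow]
  have hT' : FieldPrecone {z | ∃ s ∈ weightedSumSq h.subfield, aeval c s = z} := by
    refine of_subset_subfield (M := M) ?_ ?_ ?_ hsq ?_
    · rintro _ ⟨s, -, rfl⟩
      exact (hmem _).2 ⟨s, rfl⟩
    · rintro _ ⟨s, hs, rfl⟩ _ ⟨t, ht, rfl⟩
      exact ⟨s + t, (weightedSumSq _).add_mem hs ht, by simp⟩
    · rintro _ ⟨s, hs, rfl⟩ _ ⟨t, ht, rfl⟩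
      exact ⟨s * t, (weightedSumSq _).mul_mem hs ht, by simp⟩
    · rintro ⟨s, hs, hs1⟩
      have hdvd : p ∣ 1 + s := by
        refine dvd_trans ?_ (minpoly.dvd h.subfield c (p := 1 + s) (by simp [hs1]))
        rw [← minpoly.eq_of_irreducible hirr hc]
        exact dvd_mul_right _ _
      obtain ⟨g, hg⟩ := hdvd
      exact one_add_ne_mul_of_mem_weightedSumSq p s g hs hneg hg
  have hsub := hmax.2 hT' fun t ht => by
    refine ⟨C ⟨t, h.subset_subfield ht⟩ * 1 ^ 2, C_mul_sq_mem_weightedSumSq ((hle _).2 ht) 1, ?_⟩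
    rw [one_pow, mul_one, aeval_C]
    rfl
  have hcM : c ∈ M := (hmem c).2 ⟨X, by simp⟩
  have h2 := h.two_ne_zero
  have h2M : (2 : Ω) ∈ M := ofNat_mem M 2
  have hdiv : ∀ x ∈ M, (x / 2) ^ 2 ∈ T := fun x hx => hsub (hsq _ (M.div_mem hx h2M))
  refine ⟨((c + 1) / 2) ^ 2, hdiv _ (M.add_mem hcM M.one_mem), ((c - 1) / 2) ^ 2,
    hdiv _ (M.sub_mem hcM M.one_mem), ?_⟩
  field_simp
  ring

lemma polynomialIVT_of_maximal [IsAlgClosed Ω] (h : FieldPrecone T) (hmax : Maximal FieldPrecone T)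
    [LinearOrder h.subfield] [IsStrictOrderedRing h.subfield]
    (hle : ∀ x : h.subfield, 0 ≤ x ↔ (x : Ω) ∈ T) : PolynomialIVT h.subfield := by
  intro p
  induction hd : p.natDegree using Nat.strong_induction_on generalizing p with
  | _ d ih =>
    intro a b hab hneg
    have hp0 : p ≠ 0 := by rintro rfl; simp at hneg
    have hdeg : p.natDegree ≠ 0 := fun h0 => by
      obtain ⟨c, rfl⟩ := natDegree_eq_zero.1 h0
      simp only [eval_C] at hneg
      exact absurd hneg (not_lt.2 (mul_self_nonneg c))
    have hunit : ¬IsUnit p := fun hu => hdeg (natDegree_eq_zero_of_isUnit hu)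
    by_cases hirr : Irreducible p
    · obtain ⟨c, hc⟩ := IsAlgClosed.exists_aeval_eq_zero Ω p
        fun h0 => hdeg (natDegree_eq_zero_iff_degree_le_zero.2 h0.le)
      have hcE : c ∈ h.subfield := h.mem_subfield_of_aeval_eq_zero hmax hle hirr hneg hc
      have hroot : p.eval ⟨c, hcE⟩ = 0 := by
        apply Subtype.val_injective
        change algebraMap h.subfield Ω _ = _
        rw [← aeval_algebraMap_apply_eq_algebraMap_eval]
        exact hc
      obtain ⟨q, hq⟩ := dvd_iff_isRoot.2 hroot
      have hqu : IsUnit q := (hirr.isUnit_or_isUnit hq).resolve_left (not_isUnit_X_sub_C _)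
      obtain ⟨k, -, rfl⟩ := isUnit_iff.1 hqu
      rw [hq] at hneg
      simp only [eval_mul, eval_sub, eval_X, eval_C] at hneg
      rw [mul_mul_mul_comm] at hneg
      refine ⟨⟨c, hcE⟩, ?_, ?_, hroot⟩ <;> by_contra! hcon <;>
        refine absurd hneg (not_lt.2 (mul_nonneg ?_ (mul_self_nonneg k)))
      · exact mul_nonneg (sub_nonneg.2 hcon) (sub_nonneg.2 (hcon.trans hab.le))
      · exact mul_nonneg_of_nonpos_of_nonpos (sub_nonpos.2 (hab.le.trans hcon))
          (sub_nonpos.2 hcon)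
    · obtain ⟨q, r, hq, hr, rfl⟩ : ∃ q r, ¬IsUnit q ∧ ¬IsUnit r ∧ p = q * r := by
        rw [irreducible_iff] at hirr
        push Not at hirr
        obtain ⟨q, r, hqr, hq, hr⟩ := hirr hunit
        exact ⟨q, r, hq, hr, hqr⟩
      have hq0 : q ≠ 0 := left_ne_zero_of_mul hp0
      have hr0 : r ≠ 0 := right_ne_zero_of_mul hp0
      have hqd : q.natDegree ≠ 0 := fun h0 => hq (isUnit_iff_degree_eq_zero.2 (by
        rw [degree_eq_natDegree hq0, h0]; rfl))
      have hrd : r.natDegree ≠ 0 := fun h0 => hr (isUnit_iff_degree_eq_zero.2 (by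
        rw [degree_eq_natDegree hr0, h0]; rfl))
      rw [natDegree_mul hq0 hr0] at hd
      rw [eval_mul, eval_mul, mul_mul_mul_comm] at hneg
      rcases mul_neg_iff.1 hneg with ⟨-, h1⟩ | ⟨h1, -⟩
      · obtain ⟨c, hac, hcb, hc⟩ := ih _ (by omega) r rfl a b hab h1
        exact ⟨c, hac, hcb, by simp [hc]⟩
      · obtain ⟨c, hac, hcb, hc⟩ := ih _ (by omega) q rfl a b hab h1
        exact ⟨c, hac, hcb, by simp [hc]⟩

end FieldPrecone

/-- A field in which `-1` is not a sum of squares embeds in an ordered field with the intermediate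
value property for polynomials. -/
theorem exists_ringHom_polynomialIVT.{u} {F : Type u} [Field F] (hF : ¬IsSumSq (-1 : F)) :
    ∃ (K : Type u) (_ : Field K) (_ : LinearOrder K) (_ : IsStrictOrderedRing K) (_ : F →+* K),
      PolynomialIVT K := by
  set g := algebraMap F (AlgebraicClosure F)
  have h0 : FieldPrecone (g '' {x | IsSumSq x}) := by
    refine FieldPrecone.of_subset_subfield (M := g.fieldRange) ?_ ?_ ?_ ?_ ?_
    · rintro _ ⟨x, -, rfl⟩
      exact ⟨x, rfl⟩
    · rintro _ ⟨x, hx, rfl⟩ _ ⟨y, hy, rfl⟩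
      exact ⟨x + y, IsSumSq.add hx hy, map_add _ _ _⟩
    · rintro _ ⟨x, hx, rfl⟩ _ ⟨y, hy, rfl⟩
      exact ⟨x * y, IsSumSq.mul hx hy, map_mul _ _ _⟩
    · rintro _ ⟨x, rfl⟩
      exact ⟨x * x, IsSumSq.mul_self x, by rw [map_mul, pow_two]⟩
    · rintro ⟨x, hx, hx1⟩
      apply hF
      rwa [show (-1 : F) = x from g.injective (by rw [hx1]; simp)]
  obtain ⟨T, hT, hmax⟩ := h0.exists_maximal
  have h := hmax.1
  obtain ⟨_, _, hle⟩ := h.exists_linearOrder hmax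
  have hmem : ∀ x : F, g x ∈ h.subfield := fun x => by
    have h2 : (2 : F) ≠ 0 := fun h2 => h.two_ne_zero (by
      have := congrArg g h2
      rwa [map_ofNat, map_zero] at this)
    have hsq : ∀ y : F, g (y * y) ∈ T := fun y => hT ⟨y * y, IsSumSq.mul_self y, rfl⟩
    refine ⟨_, hsq ((x + 1) / 2), _, hsq ((x - 1) / 2), ?_⟩
    rw [← map_sub]
    congr 1
    field_simp
    ring
  exact ⟨h.subfield, inferInstance, inferInstance, inferInstance, g.codRestrict h.subfield hmem,
    h.polynomialIVT_of_maximal hmax hle⟩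

end OrderedExtension

section RealIdeal

variable {A : Type*} [CommRing A]

/-- An ideal is real if it contains every element whose square completes to a sum of squares
in the ideal. -/
def Ideal.IsReal (J : Ideal A) : Prop :=
  ∀ f s : A, IsSumSq s → f * f + s ∈ J → f ∈ J

lemma Ideal.IsReal.comap_mulLeft {J : Ideal A} (hJ : J.IsReal) (a : A) :
    Ideal.IsReal (Submodule.comap (LinearMap.mulLeft A a) J) := by
  intro f s hs hfs
  change a * (f * f + s) ∈ J at hfs
  refine hJ (a * f) (a * a * s) ((IsSumSq.mul_self a).mul hs) ?_
  rw [show a * f * (a * f) + a * a * s = a * (a * (f * f + s)) by ring]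
  exact J.mul_mem_left a hfs

lemma Ideal.IsReal.exists_isPrime [IsNoetherianRing A] {I : Ideal A} (hI : I.IsReal) {p : A}
    (hp : p ∉ I) : ∃ J : Ideal A, I ≤ J ∧ J.IsPrime ∧ J.IsReal ∧ p ∉ J := by
  obtain ⟨J, ⟨hIJ, hJ, hpJ⟩, hmax⟩ := exists_maximal_of_wellFoundedGT
    (fun J : Ideal A => I ≤ J ∧ J.IsReal ∧ p ∉ J) ⟨I, le_rfl, hI, hp⟩
  have key : ∀ a b, a * b ∈ J → b ∉ J → a * p ∈ J := by
    intro a b hab hb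
    by_contra hap
    have hle : J ≤ Submodule.comap (LinearMap.mulLeft A a) J := fun x hx => J.mul_mem_left a hx
    exact hb (hmax ⟨hIJ.trans hle, hJ.comap_mulLeft a, hap⟩ hle hab)
  refine ⟨J, hIJ, ⟨(J.ne_top_iff_one).2 fun h1 => hpJ (by simpa using J.mul_mem_left p h1), ?_⟩,
    hJ, hpJ⟩
  intro a b hab
  by_contra! h
  have hpp := key p a (by rw [mul_comm]; exact key a b hab h.2) h.1
  exact hpJ (hJ p 0 .zero (by simpa using hpp))

lemma Ideal.IsReal.not_isSumSq_neg_one {J : Ideal A} [J.IsPrime] (hJ : J.IsReal) :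
    ¬IsSumSq (-1 : FractionRing (A ⧸ J)) := by
  set g : A →+* FractionRing (A ⧸ J) := (algebraMap (A ⧸ J) _).comp (Ideal.Quotient.mk J)
  have hg : ∀ a, g a = 0 ↔ a ∈ J := fun a => by
    rw [← Ideal.Quotient.eq_zero_iff_mem]
    exact FaithfulSMul.algebraMap_eq_zero_iff (A ⧸ J) (FractionRing (A ⧸ J))
  have hfrac : ∀ z, ∃ u v, g v ≠ 0 ∧ z * g v = g u := by
    intro z
    obtain ⟨x, y, hy, rfl⟩ := IsFractionRing.div_surjective (A := A ⧸ J) z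
    obtain ⟨u, rfl⟩ := Ideal.Quotient.mk_surjective x
    obtain ⟨v, rfl⟩ := Ideal.Quotient.mk_surjective y
    have hv : g v ≠ 0 := IsFractionRing.to_map_ne_zero_of_mem_nonZeroDivisors (R := A ⧸ J) hy
    exact ⟨u, v, hv, div_mul_cancel₀ _ hv⟩
  have key : ∀ y, IsSumSq y → ∃ b s, g b ≠ 0 ∧ IsSumSq s ∧ y * g b ^ 2 = g s := by
    intro y hy
    induction hy with
    | zero => exact ⟨1, 0, by simp, .zero, by simp⟩
    | sq_add a _ ih =>
      obtain ⟨b, s, hb, hs, hbs⟩ := ih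
      obtain ⟨u, v, hv, huv⟩ := hfrac a
      refine ⟨b * v, u * b * (u * b) + v * v * s, by simp [hb, hv],
        .sq_add _ ((IsSumSq.mul_self v).mul hs), ?_⟩
      simp only [map_mul, map_add, ← huv, ← hbs]
      ring
  intro h
  obtain ⟨b, s, hb, hs, hbs⟩ := key _ h
  refine hb ((hg b).2 (hJ b s hs ((hg _).1 ?_)))
  rw [map_add, map_mul, ← hbs]
  ring

lemma Ideal.IsReal.exists_ringHom_polynomialIVT.{u} {A : Type u} [CommRing A] [IsNoetherianRing A]
    {I : Ideal A} (hI : I.IsReal) {p : A} (hp : p ∉ I) :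
    ∃ (K : Type u) (_ : Field K) (_ : LinearOrder K) (_ : IsStrictOrderedRing K) (g : A →+* K),
      PolynomialIVT K ∧ (∀ f ∈ I, g f = 0) ∧ g p ≠ 0 := by
  obtain ⟨J, hIJ, _, hJ, hpJ⟩ := hI.exists_isPrime hp
  obtain ⟨K, _, _, _, i, hK⟩ := _root_.exists_ringHom_polynomialIVT hJ.not_isSumSq_neg_one
  refine ⟨K, _, _, inferInstance,
    i.comp ((algebraMap (A ⧸ J) (FractionRing (A ⧸ J))).comp (Ideal.Quotient.mk J)), hK,
    fun f hf => ?_, fun h0 => hpJ ?_⟩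
  · simp [Ideal.Quotient.eq_zero_iff_mem.2 (hIJ hf)]
  · simpa [Ideal.Quotient.eq_zero_iff_mem] using h0

end RealIdeal

section Transfer

open Filter SignType

section RingHom

open Polynomial

variable {A K L : Type*} [CommRing A] [Field K] [LinearOrder K] [IsStrictOrderedRing K]
  [Field L] [LinearOrder L] [IsStrictOrderedRing L]

lemma exists_sign_eval₂_eq_of_sign_eq {φ : A →+* K} {ψ : A →+* L}
    (h : ∀ a, sign (φ a) = sign (ψ a)) (hK : PolynomialIVT K) (hL : PolynomialIVT L)
    (S : Finset A[X]) (t : K) : ∃ s : L, ∀ f ∈ S, sign (eval₂ φ t f) = sign (eval₂ ψ s f) := by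
  classical
  have : (RingHom.ker φ).IsPrime := RingHom.ker_isPrime φ
  have hker : ∀ a, ψ a = 0 ↔ φ a = 0 := fun a => by rw [← sign_eq_zero_iff, ← h, sign_eq_zero_iff]
  set B := A ⧸ RingHom.ker φ
  set i₀ : B →+* K := Ideal.Quotient.lift (RingHom.ker φ) φ fun a ha => ha
  set j₀ : B →+* L := Ideal.Quotient.lift (RingHom.ker φ) ψ fun a ha => (hker a).2 ha
  have hi₀ : Function.Injective i₀ := (injective_iff_map_eq_zero _).2 fun b hb => by
    obtain ⟨a, rfl⟩ := Ideal.Quotient.mk_surjective b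
    exact Ideal.Quotient.eq_zero_iff_mem.2 hb
  have hj₀ : Function.Injective j₀ := (injective_iff_map_eq_zero _).2 fun b hb => by
    obtain ⟨a, rfl⟩ := Ideal.Quotient.mk_surjective b
    exact Ideal.Quotient.eq_zero_iff_mem.2 ((hker a).1 hb)
  set i : FractionRing B →+* K := IsFractionRing.lift hi₀
  set j : FractionRing B →+* L := IsFractionRing.lift hj₀
  set g : A →+* FractionRing B := (algebraMap B _).comp (Ideal.Quotient.mk _)
  have hi : i.comp g = φ := RingHom.ext fun a => IsFractionRing.lift_algebraMap hi₀ _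
  have hj : j.comp g = ψ := RingHom.ext fun a => IsFractionRing.lift_algebraMap hj₀ _
  have hij : ∀ z, sign (i z) = sign (j z) := by
    intro z
    obtain ⟨x, y, hy, rfl⟩ := IsFractionRing.div_surjective (A := B) z
    obtain ⟨u, rfl⟩ := Ideal.Quotient.mk_surjective x
    obtain ⟨v, rfl⟩ := Ideal.Quotient.mk_surjective y
    have hv : g v ≠ 0 := IsFractionRing.to_map_ne_zero_of_mem_nonZeroDivisors (R := B) hy
    change sign (i (g u / g v)) = sign (j (g u / g v))
    have hmul : g u / g v * g v = g u := div_mul_cancel₀ _ hv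
    have h1 := congrArg (fun z => sign (i z)) hmul
    have h2 := congrArg (fun z => sign (j z)) hmul
    simp only [map_mul, sign_mul] at h1 h2
    have hsign : ∀ a, sign (i (g a)) = sign (j (g a)) := fun a => by
      have := h a
      rwa [← hi, ← hj] at this
    rw [hsign, hsign] at h1
    refine mul_right_cancel₀ ?_ (h1.trans h2.symm)
    rw [Ne, sign_eq_zero_iff, map_eq_zero]
    exact hv
  obtain ⟨s, hs⟩ := exists_sign_eval₂_eq hij hK hL (S.image (Polynomial.map g)) t
  refine ⟨s, fun f hf => ?_⟩
  have := hs _ (Finset.mem_image_of_mem _ hf)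
  rwa [eval₂_map, eval₂_map, hi, hj] at this

end RingHom

lemma Real.polynomialIVT : PolynomialIVT ℝ := by
  intro p a b hab hneg
  have hcont : ContinuousOn (fun x => p.eval x) (Set.Icc a b) := p.continuous.continuousOn
  rcases mul_neg_iff.1 hneg with ⟨ha, hb⟩ | ⟨ha, hb⟩
  · obtain ⟨c, hc, h0⟩ := intermediate_value_Ioo' hab.le hcont ⟨hb, ha⟩
    exact ⟨c, hc.1, hc.2, h0⟩
  · obtain ⟨c, hc, h0⟩ := intermediate_value_Ioo hab.le hcont ⟨ha, hb⟩
    exact ⟨c, hc.1, hc.2, h0⟩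

lemma RingHom.sign_map_real {K : Type*} [Field K] [LinearOrder K] [IsStrictOrderedRing K]
    (i : ℝ →+* K) (r : ℝ) : sign (i r) = sign r := by
  have hpos : ∀ r : ℝ, 0 < r → 0 < i r := fun r hr => by
    rw [← Real.sq_sqrt hr.le, map_pow]
    have : i (√r) ≠ 0 := by simpa using (Real.sqrt_pos.2 hr).ne'
    positivity
  rcases lt_trichotomy r 0 with hr | rfl | hr
  · have := hpos (-r) (neg_pos.2 hr)
    rw [map_neg, neg_pos] at this
    rw [sign_neg hr, sign_neg this]
  · simp
  · rw [sign_pos hr, sign_pos (hpos r hr)]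

namespace Filter.Germ

variable {α : Type*} {U : Ultrafilter α}

lemma sign_coe_eq_iff {f : α → ℝ} {s : SignType} :
    sign (f : Germ (U : Filter α) ℝ) = s ↔ ∀ᶠ x in U, sign (f x) = s := by
  cases s
  · change sign _ = 0 ↔ ∀ᶠ x in U, sign (f x) = 0
    simp only [sign_eq_zero_iff]
    exact coe_eq
  · change sign _ = -1 ↔ ∀ᶠ x in U, sign (f x) = -1
    simp only [sign_eq_neg_one_iff]
    exact coe_lt
  · change sign _ = 1 ↔ ∀ᶠ x in U, sign (f x) = 1
    simp only [sign_eq_one_iff]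
    exact coe_lt

lemma polynomialIVT : PolynomialIVT (Germ (U : Filter α) ℝ) := by
  intro p a b hab hneg
  have hrep : ∀ z : Germ (U : Filter α) ℝ, ∃ f : α → ℝ, (f : Germ (U : Filter α) ℝ) = z :=
    fun z => z.inductionOn fun f => ⟨f, rfl⟩
  choose rep hrep using hrep
  set P : α → Polynomial ℝ := fun x =>
    ∑ k ∈ Finset.range (p.natDegree + 1), Polynomial.C (rep (p.coeff k) x) * Polynomial.X ^ k
    with hP
  have heval : ∀ f : α → ℝ, p.eval (f : Germ (U : Filter α) ℝ) =
      ((fun x => (P x).eval (f x) : α → ℝ) : Germ (U : Filter α) ℝ) := by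
    intro f
    have : (fun x => (P x).eval (f x)) =
        ∑ k ∈ Finset.range (p.natDegree + 1), rep (p.coeff k) * f ^ k := by
      ext x
      simp [hP, Polynomial.eval_finsetSum]
    rw [this, Polynomial.eval_eq_sum_range]
    change _ = coeRingHom (U : Filter α) _
    rw [map_sum]
    refine Finset.sum_congr rfl fun k _ => ?_
    rw [map_mul, map_pow]
    change _ = (rep (p.coeff k) : Germ (U : Filter α) ℝ) * _
    rw [hrep]
    rfl
  obtain ⟨u, rfl⟩ : ∃ u : α → ℝ, (u : Germ (U : Filter α) ℝ) = a := ⟨_, hrep a⟩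
  obtain ⟨v, rfl⟩ : ∃ v : α → ℝ, (v : Germ (U : Filter α) ℝ) = b := ⟨_, hrep b⟩
  rw [heval, heval, ← coe_mul] at hneg
  have hev : ∀ᶠ x in U, ∃ c, u x < c ∧ c < v x ∧ (P x).eval c = 0 := by
    filter_upwards [coe_lt.1 hab, coe_lt.1 hneg] with x h1 h2
    exact Real.polynomialIVT (P x) _ _ h1 h2
  obtain ⟨c, hc⟩ := hev.choice
  refine ⟨(c : α → ℝ), coe_lt.2 (hc.mono fun x hx => hx.1), coe_lt.2 (hc.mono fun x hx => hx.2.1),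
    ?_⟩
  rw [heval]
  exact coe_eq.2 (hc.mono fun x hx => hx.2.2)

end Filter.Germ

open MvPolynomial in
/-- Sign conditions on finitely many real polynomials that are realizable in an ordered extension
field with the intermediate value property are realizable over the reals. -/
theorem MvPolynomial.exists_sign_eval₂_eq_sign_eval {K : Type*} [Field K] [LinearOrder K]
    [IsStrictOrderedRing K] (hK : PolynomialIVT K) (i : ℝ →+* K) {n : ℕ} (k : Fin n → K)
    (S : Finset (MvPolynomial (Fin n) ℝ)) :
    ∃ x : Fin n → ℝ, ∀ f ∈ S, sign (eval₂ i k f) = sign (eval x f) := by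
  classical
  induction n with
  | zero =>
    refine ⟨Fin.elim0, fun f _ => ?_⟩
    obtain ⟨r, rfl⟩ := MvPolynomial.C_surjective (Fin 0) f
    rw [eval₂_C, eval_C, i.sign_map_real]
  | succ n ih =>
    set φ : MvPolynomial (Fin n) ℝ →+* K := eval₂Hom i (Fin.tail k) with hφ
    choose X hX using fun T : Finset (MvPolynomial (Fin n) ℝ) => ih (Fin.tail k) T
    set U : Ultrafilter (Finset (MvPolynomial (Fin n) ℝ)) := Ultrafilter.of atTop
    set e := Germ.coeRingHom (R := ℝ) (U : Filter (Finset (MvPolynomial (Fin n) ℝ)))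
    set ψ : MvPolynomial (Fin n) ℝ →+* Germ (U : Filter (Finset (MvPolynomial (Fin n) ℝ))) ℝ :=
      e.comp (RingHom.pi fun T => eval (X T)) with hψ
    have hsign : ∀ a, sign (φ a) = sign (ψ a) := by
      intro a
      refine (Germ.sign_coe_eq_iff.2 ?_).symm
      have hU : ∀ᶠ T in (U : Filter _), ({a} : Finset (MvPolynomial (Fin n) ℝ)) ≤ T :=
        (eventually_ge_atTop ({a} : Finset (MvPolynomial (Fin n) ℝ))).filter_mono
          (Ultrafilter.of_le atTop)
      filter_upwards [hU] with T hT
      exact (hX T a (hT (Finset.mem_singleton_self a))).symm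
    obtain ⟨s, hs⟩ := exists_sign_eval₂_eq_of_sign_eq hsign hK Germ.polynomialIVT
      (S.image (finSuccEquiv ℝ n)) (k 0)
    obtain ⟨σ, rfl⟩ : ∃ σ : Finset (MvPolynomial (Fin n) ℝ) → ℝ, e σ = s :=
      s.inductionOn fun f => ⟨f, rfl⟩
    have hleft : (Polynomial.eval₂RingHom φ (k 0)).comp
        (finSuccEquiv ℝ n : MvPolynomial (Fin (n + 1)) ℝ →+* _) = eval₂Hom i k := by
      rw [finSuccEquiv_eq]
      refine ringHom_ext (fun r => by simp [hφ]) fun m => ?_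
      refine Fin.cases ?_ (fun m => ?_) m <;> simp [hφ, Fin.tail]
    have hright : (Polynomial.eval₂RingHom ψ (e σ)).comp
        (finSuccEquiv ℝ n : MvPolynomial (Fin (n + 1)) ℝ →+* _) =
        e.comp (RingHom.pi fun T => eval (Fin.cons (σ T) (X T))) := by
      rw [finSuccEquiv_eq]
      refine ringHom_ext (fun r => ?_) fun m => ?_
      · simp only [RingHom.comp_apply, hψ]
        simp
        refine congrArg e ?_
        ext T
        simp [RingHom.pi_apply]
      · refine Fin.cases ?_ (fun m => ?_) m
        · simp only [RingHom.comp_apply, hψ]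
          simp
          refine congrArg e ?_
          ext T
          simp [RingHom.pi_apply]
        · simp only [RingHom.comp_apply, hψ]
          simp
          refine congrArg e ?_
          ext T
          simp [RingHom.pi_apply]
    have hev : ∀ f ∈ S, ∀ᶠ T in U,
        sign (eval (Fin.cons (σ T) (X T) : Fin (n + 1) → ℝ) f) = sign (eval₂ i k f) := by
      intro f hf
      refine Germ.sign_coe_eq_iff.1 ?_
      have h1 := RingHom.congr_fun hleft f
      have h2 := RingHom.congr_fun hright f
      exact ((congrArg sign h1).symm.trans
        ((hs _ (Finset.mem_image_of_mem _ hf)).trans (congrArg sign h2))).symm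
    obtain ⟨T, hT⟩ := ((eventually_all_finset S).2 hev).exists
    exact ⟨_, fun f hf => (hT f hf).symm⟩

end Transfer

section RealNullstellensatz

open MvPolynomial

/-- The real Nullstellensatz, for real ideals and with a single vanishing condition. -/
theorem Ideal.IsReal.mem_of_eval_eq_zero {n : ℕ} {I : Ideal (MvPolynomial (Fin n) ℝ)}
    (hI : I.IsReal) {p q : MvPolynomial (Fin n) ℝ} (hq : q ∈ I)
    (h : ∀ x, eval x q = 0 → eval x p = 0) : p ∈ I := by
  classical
  by_contra hp
  obtain ⟨K, _, _, _, g, hK, hgI, hgp⟩ := hI.exists_ringHom_polynomialIVT hp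
  have hg : g = eval₂Hom (g.comp C) (fun m => g (X m)) := by
    refine ringHom_ext (fun r => ?_) fun m => ?_ <;> simp
  obtain ⟨x, hx⟩ := exists_sign_eval₂_eq_sign_eval hK (g.comp C) (fun m => g (X m)) {p, q}
  have hsign : ∀ f ∈ ({p, q} : Finset _), g f = 0 ↔ eval x f = 0 := fun f hf => by
    rw [← sign_eq_zero_iff (a := eval x f), ← hx f hf, sign_eq_zero_iff, ← coe_eval₂Hom, ← hg]
  exact hgp ((hsign p (by simp)).2 (h x ((hsign q (by simp)).1 (hgI q hq))))

/-- The largest ideal contained in the kernel of a linear functional. -/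
def LinearMap.kernelIdeal {n : ℕ} (Λ : MvPolynomial (Fin n) ℝ →ₗ[ℝ] ℝ) :
    Ideal (MvPolynomial (Fin n) ℝ) where
  carrier := {f | ∀ g, Λ (f * g) = 0}
  zero_mem' := by simp
  add_mem' := fun hf hg k => by rw [add_mul, map_add, hf, hg, add_zero]
  smul_mem' := fun c f hf g => by rw [smul_eq_mul, mul_comm c, mul_assoc, hf]

lemma IsPosDefR.isReal_kernelIdeal {n : ℕ} {Λ : MvPolynomial (Fin n) ℝ →ₗ[ℝ] ℝ}
    (hΛ : IsPosDefR Λ) : Λ.kernelIdeal.IsReal := by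
  have hnonneg : ∀ s, IsSumSq s → 0 ≤ Λ s := by
    intro s hs
    induction hs with
    | zero => simp
    | sq_add a _ ih =>
      rw [map_add, ← pow_two]
      exact add_nonneg (hΛ a) ih
  intro f s hs hfs g
  have hff : Λ (f ^ 2) = 0 := by
    have h1 := hfs 1
    rw [mul_one, map_add, ← pow_two] at h1
    linarith [hnonneg s hs, hΛ f]
  have hquad : ∀ t : ℝ, 0 ≤ 2 * t * Λ (f * g) + Λ (g ^ 2) := by
    intro t
    have h1 := hΛ (t • f + g)
    have h2 : (t • f + g) ^ 2 = (t ^ 2) • f ^ 2 + (2 * t) • (f * g) + g ^ 2 := by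
      simp only [smul_eq_C_mul, C_mul, C_pow, map_ofNat]
      ring
    rw [h2, map_add, map_add, map_smul, map_smul, hff] at h1
    simpa using h1
  by_contra hne
  have h1 := hquad (-(Λ (g ^ 2) + 1) / (2 * Λ (f * g)))
  rw [show 2 * (-(Λ (g ^ 2) + 1) / (2 * Λ (f * g))) * Λ (f * g) = -(Λ (g ^ 2) + 1) by
    field_simp] at h1
  linarith

lemma IsTypeAR.of_zSetR_subset {n : ℕ} {P Q : MvPolynomial (Fin n) ℝ} (hP : IsTypeAR P)
    (h : zSetR Q ⊆ zSetR P) : IsTypeAR Q := by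
  intro Λ hΛ hQ
  have hmem : Q ∈ Λ.kernelIdeal := fun g =>
    hQ _ (Ideal.mul_mem_right _ _ (Ideal.mem_span_singleton_self Q))
  have hPmem : P ∈ Λ.kernelIdeal :=
    hΛ.isReal_kernelIdeal.mem_of_eval_eq_zero hmem fun x hx => h hx
  refine hP Λ hΛ fun f hf => ?_
  obtain ⟨g, rfl⟩ := Ideal.mem_span_singleton.1 hf
  exact hPmem g

end RealNullstellensatz

theorem stmt_1 (n : ℕ) (hn : 0 < n) (P Q : MvPolynomial (Fin n) ℝ)
    (hPQ : zSetR P = zSetR Q) :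
    IsTypeAR P ↔ IsTypeAR Q :=
  ⟨fun h => h.of_zSetR_subset hPQ.ge, fun h => h.of_zSetR_subset hPQ.le⟩
end
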